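/- Let A be a separable simple pure C*-algebra (i.e., Cu(A) is almost unperforated and almost divisible) which is not purely infinite. Then A has stable rank one. -/

import Mathlib

open scoped ENNReal
open Filter Topology

noncomputable section

namespace Paper

/-! ### Generic definitions in a (non-unital) C*-algebra -/

variable (R : Type*) [NonUnitalCStarAlgebra R] [PartialOrder R] [StarOrderedRing R]

variable {R} in
/-- The hereditary C*-subalgebra generated by `b`, i.e. `closure (b R b)`. -/
def her (b : R) : Set R := closure {x : R | ∃ y : R, x = b * y * b}

/-- `I` is a (not necessarily closed) two-sided ideal of the subalgebra `B`. -/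
def IsIdealIn (B I : Set R) : Prop :=
  I ⊆ B ∧ (0 : R) ∈ I ∧ (∀ x ∈ I, ∀ y ∈ I, x + y ∈ I) ∧ (∀ x ∈ I, -x ∈ I) ∧
    (∀ x ∈ I, ∀ b ∈ B, x * b ∈ I ∧ b * x ∈ I)

variable {R} in
/-- The Pedersen ideal of the subalgebra `B`: the minimal dense two-sided ideal of `B`,
equivalently the intersection of all dense two-sided ideals of `B`. -/
def pedersenIn (B : Set R) : Set R :=
  ⋂ I ∈ {I : Set R | IsIdealIn R B I ∧ B ⊆ closure I}, I

/-- The Pedersen ideal of `R`. -/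
def pedersen : Set R := pedersenIn (Set.univ : Set R)

variable {R} in
/-- Cuntz subequivalence `a ≲ b`. -/
def CuntzLE (a b : R) : Prop :=
  ∃ x : ℕ → R, Tendsto (fun n => ‖a - star (x n) * b * x n‖) atTop (𝓝 0)

variable {R} in
/-- Cuntz subequivalence relative to a subset `B` (the `xₙ` are taken in `B`). -/
def CuntzLEIn (B : Set R) (a b : R) : Prop :=
  ∃ x : ℕ → R, (∀ n, x n ∈ B) ∧ Tendsto (fun n => ‖a - star (x n) * b * x n‖) atTop (𝓝 0)

variable {R} in
/-- Cuntz equivalence `a ∼ b`. -/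
def CuntzEq (a b : R) : Prop := CuntzLE a b ∧ CuntzLE b a

/-- The cut-off function `f_ε`: `0` on `[0, ε/2]`, `1` on `[ε, ∞)`, linear in between. -/
def cutoff (ε : ℝ) : ℝ → ℝ := fun t => min 1 (max 0 (2 * t / ε - 1))

variable {R} in
/-- `f_ε(a)`, via the (non-unital) continuous functional calculus. -/
def fEps (ε : ℝ) (a : R) : R := cfcₙ (cutoff ε) a

/-- A densely defined 2-quasitrace on `R` (recorded by its values on positive elements;
the value on non-positive elements is normalised to `0`). -/
structure QuasiTrace : Type _ where
  toFun : R → ℝ≥0∞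
  zero_of_not_nonneg : ∀ a : R, ¬ (0 ≤ a) → toFun a = 0
  map_zero : toFun 0 = 0
  map_smul : ∀ (r : ℝ) (a : R), 0 < r → 0 ≤ a → toFun (r • a) = ENNReal.ofReal r * toFun a
  map_add_of_commute : ∀ a b : R, 0 ≤ a → 0 ≤ b → a * b = b * a →
    toFun (a + b) = toFun a + toFun b
  map_star_mul_self : ∀ x : R, toFun (star x * x) = toFun (x * star x)
  lowerSemicontinuousOn : LowerSemicontinuousOn toFun {a : R | 0 ≤ a}
  finite_on_pedersen : ∀ a ∈ pedersen R, 0 ≤ a → toFun a < ∞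
  exists_matrix_extension : ∃ σ : Matrix (Fin 2) (Fin 2) R → ℝ≥0∞,
    (∀ a : R, σ (fun i j => if i = 0 ∧ j = 0 then a else 0) = toFun a) ∧
    σ 0 = 0 ∧
    (∀ (r : ℝ) (x : Matrix (Fin 2) (Fin 2) R), 0 < r → (∃ y, x = star y * y) →
      σ (r • x) = ENNReal.ofReal r * σ x) ∧
    (∀ x y : Matrix (Fin 2) (Fin 2) R, (∃ z, x = star z * z) → (∃ z, y = star z * z) →
      x * y = y * x → σ (x + y) = σ x + σ y) ∧
    (∀ x : Matrix (Fin 2) (Fin 2) R, σ (star x * x) = σ (x * star x))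

/-- The topology of pointwise convergence on the Pedersen ideal. -/
instance : TopologicalSpace (QuasiTrace R) :=
  TopologicalSpace.induced (fun τ => fun a : pedersen R => τ.toFun a) inferInstance

variable {R}

/-- The zero quasitrace. -/
def QuasiTrace.IsZero (τ : QuasiTrace R) : Prop := ∀ a : R, τ.toFun a = 0

/-- The dimension function `d_τ(a) = lim_{ε → 0} τ(f_ε(a))`. -/
def dTau (τ : QuasiTrace R) (a : R) : ℝ≥0∞ :=
  ⨆ n : ℕ, τ.toFun (fEps (1 / (n + 1)) a)

/-- `ω(a)` relative to a set `S` of quasitraces: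
`lim_n sup {d_τ(a) - τ(f_{1/n}(a)) : τ ∈ S}`. -/
def omegaOn (S : Set (QuasiTrace R)) (a : R) : ℝ≥0∞ :=
  ⨅ n : ℕ, ⨆ τ ∈ S, (dTau τ a - τ.toFun (fEps (1 / (n + 1)) a))

/-- The seminorm `‖x‖_{2,S}`. -/
def norm2On (S : Set (QuasiTrace R)) (x : R) : ℝ≥0∞ :=
  ⨆ τ ∈ S, (τ.toFun (star x * x)) ^ (1 / 2 : ℝ)

variable (R)

/-- `R` has (Blackadar's) strict comparison. -/
def StrictComparison : Prop :=
  ∀ a b : R, 0 ≤ a → 0 ≤ b →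
    (∀ τ : QuasiTrace R, ¬ τ.IsZero → dTau τ a < dTau τ b) → CuntzLE a b

/-- `R` is a simple C*-algebra: it is nonzero and has no nontrivial closed two-sided ideals. -/
def IsSimpleCStar : Prop :=
  (∃ x : R, x ≠ 0) ∧
    ∀ I : TwoSidedIdeal R, IsClosed (I : Set R) → (I : Set R) = {0} ∨ (I : Set R) = Set.univ

/-- `R` is σ-unital: it contains a strictly positive element `h`
(equivalently, `Her(h) = R`). -/
def SigmaUnital : Prop := ∃ h : R, 0 ≤ h ∧ her h = Set.univ

/-- `R` is elementary: isomorphic to the algebra of compact operators on some Hilbert space. -/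
def IsElementary : Prop :=
  ∃ (H : Type) (_ : NormedAddCommGroup H) (_ : InnerProductSpace ℂ H) (_ : CompleteSpace H)
    (φ : R →⋆ₙₐ[ℂ] (H →L[ℂ] H)), Function.Injective φ ∧
      Set.range φ = {T : H →L[ℂ] H | IsCompactOperator (⇑T)}

/-- `R` is purely infinite: `R ≇ ℂ` and `b ≲ a` for all nonzero positive `a, b`. -/
def PurelyInfinite : Prop :=
  (¬ ∃ φ : R →⋆ₙₐ[ℂ] ℂ, Function.Bijective φ) ∧
    ∀ a b : R, 0 ≤ a → 0 ≤ b → a ≠ 0 → b ≠ 0 → CuntzLE b a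

/-- `R` is finite: its minimal unitization contains no non-unitary isometry. -/
def IsFiniteCStar : Prop :=
  ∀ v : Unitization ℂ R, star v * v = 1 → v * star v = 1

/-- `R` has stable rank one: the invertible elements are dense in the minimal unitization. -/
def StableRankOne : Prop := Dense {x : Unitization ℂ R | IsUnit x}

variable {R}

/-- `c` represents `n·[a]` in the Cuntz semigroup: it is the sum of `n` mutually
orthogonal positive elements, each Cuntz equivalent to `a`. -/
def IsNFoldRep (n : ℕ) (a c : R) : Prop :=
  ∃ f : Fin n → R, (∀ i, 0 ≤ f i) ∧ (∀ i, CuntzEq (f i) a) ∧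
    (∀ i j, i ≠ j → f i * f j = 0) ∧ c = ∑ i, f i

/-- `s` represents the supremum of the increasing sequence of Cuntz classes `[y n]`. -/
def IsCuntzLUB (y : ℕ → R) (s : R) : Prop :=
  (∀ n, CuntzLE (y n) s) ∧ ∀ c : R, 0 ≤ c → (∀ n, CuntzLE (y n) c) → CuntzLE s c

/-- `[x] ≪ [y]` in the Cuntz semigroup. -/
def CuntzWayBelow (x y : R) : Prop :=
  ∀ yseq : ℕ → R, (∀ n, 0 ≤ yseq n) → (∀ n, CuntzLE (yseq n) (yseq (n + 1))) →
    ∀ s : R, 0 ≤ s → IsCuntzLUB yseq s → CuntzLE y s → ∃ n₀, CuntzLE x (yseq n₀)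

variable (R)

/-- The Cuntz semigroup of `R` is almost unperforated. -/
def AlmostUnperforated : Prop :=
  ∀ (a b : R) (k : ℕ), 1 ≤ k → 0 ≤ a → 0 ≤ b →
    (∃ c d : R, IsNFoldRep (k + 1) a c ∧ IsNFoldRep k b d ∧ CuntzLE c d) → CuntzLE a b

/-- The Cuntz semigroup of `R` is almost divisible. -/
def AlmostDivisible : Prop :=
  ∀ x y : R, 0 ≤ x → 0 ≤ y → CuntzWayBelow x y → ∀ n : ℕ, 1 ≤ n →
    ∃ z : R, 0 ≤ z ∧ (∃ c : R, IsNFoldRep n z c ∧ CuntzLE c y) ∧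
      (∃ c : R, IsNFoldRep (n + 1) z c ∧ CuntzLE x c)

/-! ### The stabilization `W ≅ A ⊗ K` -/

variable (A W : Type*) [NonUnitalCStarAlgebra A] [PartialOrder A] [StarOrderedRing A]
  [NonUnitalCStarAlgebra W] [PartialOrder W] [StarOrderedRing W]

/-- A realization of `W` as the stabilization `A ⊗ K`: the maps `emb i j : a ↦ a ⊗ e_{ij}`
are isometric, satisfy the matrix-unit relations, and have dense joint linear span. -/
structure Stabilization : Type _ where
  emb : ℕ → ℕ → (A →ₗ[ℂ] W)
  emb_mul : ∀ (i j k l : ℕ) (a b : A),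
    emb i j a * emb k l b = if j = k then emb i l (a * b) else 0
  emb_star : ∀ (i j : ℕ) (a : A), star (emb i j a) = emb j i (star a)
  norm_emb : ∀ (i j : ℕ) (a : A), ‖emb i j a‖ = ‖a‖
  dense_span : Dense (Submodule.span ℂ {w : W | ∃ (i j : ℕ) (a : A), w = emb i j a} : Set W)

variable {A W}

/-- The set `QT(A)` of quasitraces normalized on `A ⊆ A ⊗ K`. -/
def QTSet (SB : Stabilization A W) : Set (QuasiTrace W) :=
  {τ | (⨆ a : {a : A // 0 ≤ a ∧ ‖a‖ ≤ 1}, τ.toFun (SB.emb 0 0 a)) = 1}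

/-- The quasitraces normalized on the hereditary subalgebra `Her(c) ⊆ W`. -/
def QTSetHer (c : W) : Set (QuasiTrace W) :=
  {τ : QuasiTrace W |
    (⨆ a : {a : W // a ∈ her c ∧ 0 ≤ a ∧ ‖a‖ ≤ 1}, τ.toFun a) = 1}

/-- `ω(a) = 0` for `a ∈ W = A ⊗ K`, computed relative to `\overline{QT(Her(e))}^w`
for any nonzero `e ∈ Ped(A)₊`. -/
def OmegaZero (SB : Stabilization A W) (a : W) : Prop :=
  ∀ e : A, 0 ≤ e → e ≠ 0 → e ∈ pedersen A →
    omegaOn (closure (QTSetHer (SB.emb 0 0 e))) a = 0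

/-- `A` has tracial approximate oscillation zero. -/
def TAOZ (SB : Stabilization A W) : Prop :=
  ∀ e : A, 0 ≤ e → e ≠ 0 → e ∈ pedersen A →
    ∀ a : W, 0 ≤ a → a ∈ pedersen W →
      ∃ b : ℕ → W, (∀ n, 0 ≤ b n) ∧ (∀ n, ‖b n‖ ≤ 1) ∧
        (∀ n, b n ∈ pedersenIn (her a)) ∧
        Tendsto (fun n => omegaOn (closure (QTSetHer (SB.emb 0 0 e))) (b n)) atTop (𝓝 0) ∧
        Tendsto (fun n => norm2On (closure (QTSetHer (SB.emb 0 0 e))) (a - b n)) atTop (𝓝 0)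

/-! ### Affine functions on the quasitrace cone and the map `Γ` -/

variable (W) in
/-- `ρ = t·τ + (1-t)·σ` as quasitraces. -/
def IsCombo (t : ℝ) (τ σ ρ : QuasiTrace W) : Prop :=
  ∀ a : W, 0 ≤ a →
    ρ.toFun a = ENNReal.ofReal t * τ.toFun a + ENNReal.ofReal (1 - t) * σ.toFun a

variable (W) in
/-- `f` is affine on the quasitrace cone. -/
def IsAffineQT (f : QuasiTrace W → ℝ≥0∞) : Prop :=
  ∀ t : ℝ, 0 ≤ t → t ≤ 1 → ∀ τ σ ρ : QuasiTrace W, IsCombo W t τ σ ρ →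
    f ρ = ENNReal.ofReal t * f τ + ENNReal.ofReal (1 - t) * f σ

variable (W) in
/-- Membership in `Aff₊(QT̃(A))`. -/
def MemAffPlus (f : QuasiTrace W → ℝ≥0∞) : Prop :=
  (∀ τ, f τ = 0) ∨
    (Continuous f ∧ IsAffineQT W f ∧ (∀ τ, f τ < ∞) ∧
      (∀ τ : QuasiTrace W, ¬ τ.IsZero → 0 < f τ) ∧
      (∀ τ : QuasiTrace W, τ.IsZero → f τ = 0))

variable (W) in
/-- Membership in `LAff₊(QT̃(A))`. -/
def MemLAffPlus (f : QuasiTrace W → ℝ≥0∞) : Prop :=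
  ∃ g : ℕ → QuasiTrace W → ℝ≥0∞, (∀ n, MemAffPlus W (g n)) ∧
    (∀ n τ, g n τ ≤ g (n + 1) τ) ∧ ∀ τ, f τ = ⨆ n, g n τ

variable (W) in
/-- The canonical map `Γ : Cu(A) → LAff₊(QT̃(A))`, `Γ([a])(τ) = d_τ(a)`, is surjective. -/
def GammaSurjective : Prop :=
  ∀ f : QuasiTrace W → ℝ≥0∞, MemLAffPlus W f →
    ∃ a : W, 0 ≤ a ∧ ∀ τ : QuasiTrace W, dTau τ a = f τ


set_option linter.unusedSectionVars false
set_option linter.unusedVariables false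

section Generic
variable {M : Type*} [CStarAlgebra M] [PartialOrder M] [StarOrderedRing M]

/-! ### functional calculus helpers -/

lemma fc_mul {f g : ℝ → ℝ} (hf : Continuous f) (hg : Continuous g) (a : M) :
    cfc f a * cfc g a = cfc (fun t => f t * g t) a :=
  (cfc_mul f g a hf.continuousOn hg.continuousOn).symm

lemma fc_add {f g : ℝ → ℝ} (hf : Continuous f) (hg : Continuous g) (a : M) :
    cfc f a + cfc g a = cfc (fun t => f t + g t) a :=
  (cfc_add (f := f) (g := g) a hf.continuousOn hg.continuousOn).symm

lemma fc_sub {f g : ℝ → ℝ} (hf : Continuous f) (hg : Continuous g) (a : M) :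
    cfc f a - cfc g a = cfc (fun t => f t - g t) a :=
  (cfc_sub (f := f) (g := g) a hf.continuousOn hg.continuousOn).symm

lemma fc_sa (f : ℝ → ℝ) (a : M) : IsSelfAdjoint (cfc f a) := cfc_predicate f a

@[simp] lemma fc_star (f : ℝ → ℝ) (a : M) : star (cfc f a) = cfc f a := (fc_sa f a).star_eq

lemma fc_id {a : M} (ha : 0 ≤ a) : cfc (fun t : ℝ => t) a = a :=
  cfc_id' ℝ a (IsSelfAdjoint.of_nonneg ha)

lemma fc_one {a : M} (ha : 0 ≤ a) : cfc (fun _ : ℝ => (1 : ℝ)) a = 1 :=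
  cfc_const_one ℝ a (IsSelfAdjoint.of_nonneg ha)

lemma fc_comm (f g : ℝ → ℝ) (a : M) : cfc f a * cfc g a = cfc g a * cfc f a :=
  (cfc_commute_cfc f g a).eq

lemma spec_bd {a : M} (ha : 0 ≤ a) {t : ℝ} (ht : t ∈ spectrum ℝ a) : 0 ≤ t ∧ t ≤ ‖a‖ := by
  refine ⟨spectrum_nonneg_of_nonneg ha ht, ?_⟩
  have := spectrum.norm_le_norm_mul_of_mem ht
  rcases subsingleton_or_nontrivial M with h | h
  · exact absurd ht (by rw [spectrum.of_subsingleton]; simp)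
  · rw [norm_one, mul_one] at this
    exact (le_abs_self t).trans this

lemma fc_congr {f g : ℝ → ℝ} {a : M} (ha : 0 ≤ a) (h : ∀ t, 0 ≤ t → f t = g t) :
    cfc f a = cfc g a :=
  cfc_congr fun _ ht => h _ (spec_bd ha ht).1

lemma fc_congr' {f g : ℝ → ℝ} {a : M} (ha : 0 ≤ a) (h : ∀ t, 0 ≤ t → t ≤ ‖a‖ → f t = g t) :
    cfc f a = cfc g a :=
  cfc_congr fun _ ht => h _ (spec_bd ha ht).1 (spec_bd ha ht).2

lemma fc_nonneg {f : ℝ → ℝ} {a : M} (ha : 0 ≤ a) (h : ∀ t, 0 ≤ t → 0 ≤ f t) :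
    0 ≤ cfc f a :=
  cfc_nonneg fun _ ht => h _ (spec_bd ha ht).1

lemma fc_mono {f g : ℝ → ℝ} (hf : Continuous f) (hg : Continuous g) {a : M} (ha : 0 ≤ a)
    (h : ∀ t, 0 ≤ t → t ≤ ‖a‖ → f t ≤ g t) :
    cfc f a ≤ cfc g a :=
  cfc_mono (fun _ ht => h _ (spec_bd ha ht).1 (spec_bd ha ht).2)
    hf.continuousOn hg.continuousOn

lemma fc_norm_le {f : ℝ → ℝ} {a : M} (ha : 0 ≤ a) {C : ℝ} (hC : 0 ≤ C)
    (h : ∀ t, 0 ≤ t → t ≤ ‖a‖ → |f t| ≤ C) : ‖cfc f a‖ ≤ C :=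
  norm_cfc_le hC fun _ ht => h _ (spec_bd ha ht).1 (spec_bd ha ht).2

lemma fc_zero {f : ℝ → ℝ} {a : M} (ha : 0 ≤ a) (h : ∀ t, 0 ≤ t → t ≤ ‖a‖ → f t = 0) :
    cfc f a = 0 := by
  rw [fc_congr' (g := fun _ => 0) ha h, cfc_const_zero]

lemma fc_le_one {f : ℝ → ℝ} (hf : Continuous f) {a : M} (ha : 0 ≤ a)
    (h : ∀ t, 0 ≤ t → t ≤ ‖a‖ → f t ≤ 1) :
    cfc f a ≤ 1 := by
  rw [← fc_one ha]; exact fc_mono hf continuous_const ha h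

lemma fc_comp {f g : ℝ → ℝ} (hf : Continuous f) (hg : Continuous g) {a : M} (ha : 0 ≤ a) :
    cfc g (cfc f a) = cfc (fun t => g (f t)) a :=
  (cfc_comp' g f a hg.continuousOn hf.continuousOn (IsSelfAdjoint.of_nonneg ha)).symm

lemma nsq (x : M) : ‖star x * x‖ = ‖x‖ ^ 2 := by
  rw [CStarRing.norm_star_mul_self, sq]

lemma nsq' (x : M) : ‖x * star x‖ = ‖x‖ ^ 2 := by
  rw [CStarRing.norm_self_mul_star, sq]

lemma norm_mono {a b : M} (ha : 0 ≤ a) (hab : a ≤ b) : ‖a‖ ≤ ‖b‖ :=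
  CStarAlgebra.norm_le_norm_of_nonneg_of_le ha hab

lemma conj_mono {a b : M} (h : a ≤ b) (x : M) : star x * a * x ≤ star x * b * x :=
  star_left_conjugate_le_conjugate h x

lemma conj_nonneg {a : M} (h : 0 ≤ a) (x : M) : 0 ≤ star x * a * x :=
  star_left_conjugate_nonneg h x

lemma sa_le_norm {a : M} (h : IsSelfAdjoint a) : a ≤ algebraMap ℝ M ‖a‖ :=
  h.le_algebraMap_norm_self

lemma norm_le_one_of {a : M} (h0 : 0 ≤ a) (h : a ≤ 1) : ‖a‖ ≤ 1 := by
  rcases subsingleton_or_nontrivial M with hs | hs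
  · rw [Subsingleton.elim a 0]; simp
  · simpa using norm_mono h0 h

lemma le_one_of_norm {a : M} (h0 : 0 ≤ a) (h : ‖a‖ ≤ 1) : a ≤ 1 := by
  have h1 := sa_le_norm (IsSelfAdjoint.of_nonneg h0)
  refine h1.trans ?_
  rw [← map_one (algebraMap ℝ M)]
  exact algebraMap_mono M h

lemma nonneg_sa {a : M} (h : 0 ≤ a) : star a = a := (IsSelfAdjoint.of_nonneg h).star_eq

/-- positive square root -/
def rt (a : M) : M := cfc Real.sqrt a

lemma rt_nonneg {a : M} (ha : 0 ≤ a) : 0 ≤ rt a := fc_nonneg ha fun _ _ => Real.sqrt_nonneg _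
lemma rt_star (a : M) : star (rt a) = rt a := fc_star _ _
lemma rt_mul {a : M} (ha : 0 ≤ a) : rt a * rt a = a := by
  rw [rt, fc_mul Real.continuous_sqrt Real.continuous_sqrt,
    fc_congr (g := fun t => t) ha fun t ht => Real.mul_self_sqrt ht, fc_id ha]

/-! ### ramps and cuts -/
def ramp (a b : ℝ) : ℝ → ℝ := fun t => max 0 (min 1 ((t - a) / (b - a)))

lemma ramp_cont (a b : ℝ) : Continuous (ramp a b) := by unfold ramp; fun_prop
lemma ramp_nonneg (a b t : ℝ) : 0 ≤ ramp a b t := le_max_left _ _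
lemma ramp_le_one (a b t : ℝ) : ramp a b t ≤ 1 := max_le zero_le_one (min_le_left _ _)
lemma ramp_eq_zero {a b t : ℝ} (hab : a < b) (h : t ≤ a) : ramp a b t = 0 := by
  unfold ramp
  have : (t - a) / (b - a) ≤ 0 := div_nonpos_of_nonpos_of_nonneg (by linarith) (by linarith)
  exact max_eq_left ((min_le_right _ _).trans this)
lemma ramp_eq_one {a b t : ℝ} (hab : a < b) (h : b ≤ t) : ramp a b t = 1 := by
  unfold ramp
  have : 1 ≤ (t - a) / (b - a) := by rw [le_div_iff₀ (by linarith)]; linarith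
  rw [min_eq_left this]; simp
lemma ramp_abs_le (a b t : ℝ) : |ramp a b t| ≤ 1 := by
  rw [abs_of_nonneg (ramp_nonneg a b t)]; exact ramp_le_one a b t

def cutf (ε : ℝ) : ℝ → ℝ := fun t => max (t - ε) 0
lemma cutf_cont (ε : ℝ) : Continuous (cutf ε) := by unfold cutf; fun_prop
lemma cutf_nonneg (ε t : ℝ) : 0 ≤ cutf ε t := le_max_right _ _
lemma cutf_eq_zero {ε t : ℝ} (h : t ≤ ε) : cutf ε t = 0 := max_eq_right (by linarith)
lemma cutf_eq {ε t : ℝ} (h : ε ≤ t) : cutf ε t = t - ε := max_eq_left (by linarith)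

def cut (ε : ℝ) (a : M) : M := cfc (cutf ε) a
def rmp (x y : ℝ) (a : M) : M := cfc (ramp x y) a

lemma cut_nonneg {ε : ℝ} {a : M} (ha : 0 ≤ a) : 0 ≤ cut ε a := fc_nonneg ha fun _ _ => cutf_nonneg _ _
lemma rmp_nonneg {x y : ℝ} {a : M} (ha : 0 ≤ a) : 0 ≤ rmp x y a :=
  fc_nonneg ha fun _ _ => ramp_nonneg _ _ _
lemma rmp_le_one {x y : ℝ} {a : M} (ha : 0 ≤ a) : rmp x y a ≤ 1 :=
  fc_le_one (ramp_cont _ _) ha fun _ _ _ => ramp_le_one _ _ _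
lemma rmp_norm {x y : ℝ} {a : M} (ha : 0 ≤ a) : ‖rmp x y a‖ ≤ 1 :=
  norm_le_one_of (rmp_nonneg ha) (rmp_le_one ha)
lemma rmp_star (x y : ℝ) (a : M) : star (rmp x y a) = rmp x y a := fc_star _ _
lemma cut_star (x : ℝ) (a : M) : star (cut x a) = cut x a := fc_star _ _
lemma cut_approx {ε : ℝ} (hε : 0 ≤ ε) {a : M} (ha : 0 ≤ a) : ‖a - cut ε a‖ ≤ ε := by
  have : a - cut ε a = cfc (fun t => t - cutf ε t) a := by
    rw [← fc_sub continuous_id' (cutf_cont ε), fc_id ha, cut]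
  rw [this]
  refine fc_norm_le ha hε fun t ht _ => ?_
  rcases le_total t ε with h | h
  · rw [cutf_eq_zero h, sub_zero, abs_of_nonneg ht]; exact h
  · rw [cutf_eq h]; simp [abs_of_nonneg hε]
lemma cut_le {ε : ℝ} (hε : 0 ≤ ε) {a : M} (ha : 0 ≤ a) : cut ε a ≤ a := by
  nth_rewrite 2 [← fc_id ha]
  exact fc_mono (cutf_cont _) continuous_id' ha fun t ht _ => max_le (by linarith) ht

/-! ### Lemma Y -/

def rs (δ : ℝ) : ℝ → ℝ := fun t => (Real.sqrt (|t| + δ))⁻¹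
lemma rs_cont {δ : ℝ} (hδ : 0 < δ) : Continuous (rs δ) := by
  unfold rs
  refine Continuous.inv₀ (by fun_prop) fun t => ?_
  have : 0 < Real.sqrt (|t| + δ) := Real.sqrt_pos.2 (by positivity)
  exact this.ne'

lemma rs_bd {δ t : ℝ} (hδ : 0 < δ) (ht : 0 ≤ t) :
    t * rs δ t ≤ √t ∧ √t - √δ ≤ t * rs δ t := by
  unfold rs
  rw [abs_of_nonneg ht]
  have h1 : 0 < √(t + δ) := Real.sqrt_pos.2 (by linarith)
  have h2 : √t ≤ √(t + δ) := Real.sqrt_le_sqrt (by linarith)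
  have h4 : √δ ≤ √(t + δ) := Real.sqrt_le_sqrt (by linarith)
  have h3 := Real.sq_sqrt (show 0 ≤ t + δ by linarith)
  have h5 := Real.sq_sqrt ht
  have h6 := Real.sq_sqrt hδ.le
  have := Real.sqrt_nonneg t
  have := Real.sqrt_nonneg δ
  rw [← div_eq_mul_inv, div_le_iff₀ h1, le_div_iff₀ h1]
  constructor
  · nlinarith
  · nlinarith

lemma star_mul_self_sub_norm (Z : M) {y : M} (hy : 0 ≤ y) (hyz : y ≤ star Z * Z)
    {f : ℝ → ℝ} (hf : Continuous f) {C : ℝ} (hC : 0 ≤ C)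
    (h : ∀ t, 0 ≤ t → |t * f t| ≤ C) :
    ‖Z * cfc f (star Z * Z) * rt y‖ ≤ C := by
  have hz : 0 ≤ star Z * Z := star_mul_self_nonneg Z
  set z := star Z * Z with hzdef
  have h1 : ‖Z * cfc f z * rt y‖ ^ 2 = ‖rt z * cfc f z * rt y‖ ^ 2 := by
    rw [← nsq, ← nsq]
    congr 1
    simp only [star_mul, fc_star, rt_star]
    calc _ = rt y * (cfc f z * (star Z * Z) * cfc f z) * rt y := by simp only [mul_assoc]
      _ = rt y * (cfc f z * (rt z * rt z) * cfc f z) * rt y := by rw [rt_mul hz]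
      _ = _ := by simp only [mul_assoc]
  have h2 : ‖rt z * cfc f z * rt y‖ ^ 2 ≤ C ^ 2 := by
    rw [← nsq']
    set d := rt z * cfc f z with hd
    have hds : star d = d := by
      rw [hd, star_mul, rt_star, fc_star, rt, fc_comm]
    have : d * rt y * star (d * rt y) = star d * y * d := by
      rw [star_mul, rt_star, hds]
      calc _ = d * (rt y * rt y) * d := by simp only [mul_assoc]
        _ = _ := by rw [rt_mul hy]
    rw [this]
    refine (norm_mono (conj_nonneg hy d) (conj_mono hyz d)).trans ?_
    have e : star d * z * d = cfc (fun t => (t * f t) ^ 2) z := by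
      rw [hds, hd]
      calc _ = cfc f z * rt z * z * (rt z * cfc f z) := by
            rw [rt, fc_comm]
        _ = cfc f z * rt z * (rt z * rt z) * (rt z * cfc f z) := by rw [rt_mul hz]
        _ = cfc f z * (rt z * rt z) * ((rt z * rt z) * cfc f z) := by simp only [mul_assoc]
        _ = cfc f z * cfc (fun t : ℝ => t) z * (cfc (fun t : ℝ => t) z * cfc f z) := by
            rw [rt_mul hz, fc_id hz]
        _ = _ := by
            rw [fc_mul hf continuous_id', fc_mul continuous_id' hf,
              fc_mul (by fun_prop) (by fun_prop)]
            congr 1; ext t; ring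
    rw [e]
    refine fc_norm_le hz (by positivity) fun t ht _ => ?_
    rw [abs_pow]
    exact pow_le_pow_left₀ (abs_nonneg _) (h t ht) 2
  rw [← h1] at h2
  exact le_of_sq_le_sq h2 hC
where
  le_of_sq_le_sq {a b : ℝ} (h : a ^ 2 ≤ b ^ 2) (hb : 0 ≤ b) : a ≤ b := abs_le_of_sq_le_sq' h hb |>.2

theorem lemmaY (Z : M) {y : M} (hy : 0 ≤ y) (hyz : y ≤ star Z * Z) :
    ∃ Y : M, star Y * Y = y ∧ Y ∈ closure (Set.range (Z * ·)) := by
  have hz : 0 ≤ star Z * Z := star_mul_self_nonneg Z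
  set z := star Z * Z with hzdef
  set δ : ℕ → ℝ := fun n => (1 / (n + 1 : ℝ)) ^ 2 with hδdef
  have hδ : ∀ n, 0 < δ n := fun n => by rw [hδdef]; positivity
  have hδs : ∀ n, √(δ n) = 1 / (n + 1 : ℝ) := fun n => Real.sqrt_sq (by positivity)
  set S : ℕ → M := fun n => Z * cfc (rs (δ n)) z * rt y with hS
  have hlim : Tendsto (fun n : ℕ => 1 / (n + 1 : ℝ)) atTop (𝓝 0) :=
    tendsto_one_div_add_atTop_nhds_zero_nat
  have hd : ∀ n m, n ≤ m → dist (S n) (S m) ≤ 1 / (n + 1 : ℝ) := by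
    intro n m hnm
    rw [dist_eq_norm]
    have : S n - S m = Z * cfc (fun t => rs (δ n) t - rs (δ m) t) z * rt y := by
      rw [← fc_sub (rs_cont (hδ n)) (rs_cont (hδ m)), mul_sub, sub_mul]
    rw [this]
    refine star_mul_self_sub_norm Z hy hyz ((rs_cont (hδ n)).sub (rs_cont (hδ m)))
      (by positivity) fun t ht => ?_
    have h1 := rs_bd (hδ n) ht
    have h2 := rs_bd (hδ m) ht
    rw [hδs] at h1 h2
    have : 1 / (m + 1 : ℝ) ≤ 1 / (n + 1 : ℝ) := by
      apply one_div_le_one_div_of_le (by positivity); exact_mod_cast Nat.succ_le_succ hnm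
    change |t * (rs (δ n) t - rs (δ m) t)| ≤ _
    rw [mul_sub, abs_le]
    constructor <;> linarith
  have hc : CauchySeq S := cauchySeq_of_le_tendsto_0 (fun n : ℕ => 1 / (n + 1 : ℝ))
    (fun n m N hn hm => by
      rcases le_total n m with h | h
      · refine (hd n m h).trans ?_
        apply one_div_le_one_div_of_le (by positivity); exact_mod_cast Nat.succ_le_succ hn
      · rw [dist_comm]
        refine (hd m n h).trans ?_
        apply one_div_le_one_div_of_le (by positivity); exact_mod_cast Nat.succ_le_succ hm) hlim
  obtain ⟨Y, hY⟩ := cauchySeq_tendsto_of_complete hc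
  refine ⟨Y, ?_, ?_⟩
  · have h1 : Tendsto (fun n => star (S n) * S n) atTop (𝓝 (star Y * Y)) :=
      (hY.star).mul hY
    refine tendsto_nhds_unique h1 ?_
    rw [tendsto_iff_norm_sub_tendsto_zero]
    refine squeeze_zero (fun _ => norm_nonneg _) (fun n => ?_) (hlim.pow 2 |>.trans (by simp))
    -- y - S*S = rt y (1 - c z c) rt y
    have e : star (S n) * S n - y = - (star (cfc (fun t => √(δ n) * rs (δ n) t) z * rt y) *
        (cfc (fun t => √(δ n) * rs (δ n) t) z * rt y)) := by
      have hr := rs_cont (hδ n)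
      have k : cfc (rs (δ n)) z * z * cfc (rs (δ n)) z +
         cfc (fun t => √(δ n) * rs (δ n) t) z * cfc (fun t => √(δ n) * rs (δ n) t) z = 1 := by
        nth_rewrite 2 [← fc_id hz]
        rw [fc_mul hr continuous_id', fc_mul (by fun_prop) hr, fc_mul (by fun_prop) (by fun_prop),
          fc_add (by fun_prop) (by fun_prop), ← fc_one hz]
        refine fc_congr hz fun t ht => ?_
        have h1 : 0 < √(t + δ n) := Real.sqrt_pos.2 (by linarith [hδ n])
        have h3 := Real.sq_sqrt (show 0 ≤ t + δ n by linarith [hδ n])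
        have h6 := Real.sq_sqrt (hδ n).le
        simp only [rs, abs_of_nonneg ht]
        field_simp
        rw [h3, h6]
      have : star (S n) * S n = rt y * (cfc (rs (δ n)) z * z * cfc (rs (δ n)) z) * rt y := by
        simp only [hS, star_mul, fc_star, rt_star, hzdef, mul_assoc]
      rw [this, ← eq_sub_iff_add_eq.2 k |>.symm, star_mul, fc_star, rt_star, mul_sub, mul_one, sub_mul,
        rt_mul hy]
      simp only [mul_assoc]; abel
    rw [e, norm_neg, nsq]
    refine pow_le_pow_left₀ (norm_nonneg _) ?_ 2
    have hr := rs_cont (hδ n)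
    have : ‖cfc (fun t => √(δ n) * rs (δ n) t) z * rt y‖ ^ 2 ≤ (1 / (n + 1 : ℝ)) ^ 2 := by
      rw [← nsq', star_mul, fc_star, rt_star]
      set d := cfc (fun t => √(δ n) * rs (δ n) t) z with hdd
      have : d * rt y * (rt y * d) = star d * y * d := by
        rw [hdd, fc_star]
        calc _ = d * (rt y * rt y) * d := by simp only [mul_assoc]; rfl
          _ = _ := by rw [rt_mul hy]
      rw [this]
      refine (norm_mono (conj_nonneg hy d) (conj_mono hyz d)).trans ?_
      rw [hdd, fc_star]
      nth_rewrite 2 [← fc_id hz]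
      rw [fc_mul (by fun_prop) (by fun_prop), fc_mul (by fun_prop) (by fun_prop)]
      refine fc_norm_le hz (by positivity) fun t ht _ => ?_
      have h1 : 0 < √(t + δ n) := Real.sqrt_pos.2 (by linarith [hδ n])
      have h3 := Real.sq_sqrt (show 0 ≤ t + δ n by linarith [hδ n])
      simp only [rs, abs_of_nonneg ht, hδs]
      rw [abs_of_nonneg (by positivity)]
      have : (1 / (n + 1 : ℝ)) * (√(t + δ n))⁻¹ * t * ((1 / (n + 1 : ℝ)) * (√(t + δ n))⁻¹)
        = (1 / (n + 1 : ℝ)) ^ 2 * (t / (t + δ n)) := by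
        nth_rewrite 3 [← h3]
        field_simp
      rw [this]
      refine mul_le_of_le_one_right (by positivity) ?_
      rw [div_le_one (by linarith [hδ n])]; linarith [hδ n]
    exact abs_le_of_sq_le_sq' this (by positivity) |>.2
  · exact mem_closure_of_tendsto hY (Eventually.of_forall fun n => ⟨cfc (rs (δ n)) z * rt y, by
      simp only [hS, mul_assoc]⟩)

end Generic

section Generic2
variable {M : Type*} [CStarAlgebra M] [PartialOrder M] [StarOrderedRing M]

/-! ### Cuntz comparison in a unital C*-algebra -/

def CLE (a b : M) : Prop := ∀ ε : ℝ, 0 < ε → ∃ x : M, ‖a - star x * b * x‖ < ε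

lemma CLE.refl (a : M) : CLE a a := fun ε hε => ⟨1, by simpa using hε⟩

lemma CLE.conj (a x : M) : CLE (star x * a * x) a := fun ε hε => ⟨x, by simpa using hε⟩

lemma CLE.zero (b : M) : CLE 0 b := fun ε hε => ⟨0, by simpa using hε⟩

lemma CLE.of_approx {a b : M} (h : ∀ ε : ℝ, 0 < ε → ∃ a' : M, ‖a - a'‖ < ε ∧ CLE a' b) :
    CLE a b := by
  intro ε hε
  obtain ⟨a', h1, h2⟩ := h (ε / 2) (by linarith)
  obtain ⟨x, hx⟩ := h2 (ε / 2) (by linarith)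
  refine ⟨x, ?_⟩
  calc _ = ‖(a - a') + (a' - star x * b * x)‖ := by congr 1; abel
    _ ≤ _ := norm_add_le _ _
    _ < ε := by linarith

lemma norm_conj_le (x c : M) : ‖star x * c * x‖ ≤ ‖c‖ * ‖x‖ ^ 2 := by
  calc _ ≤ ‖star x‖ * ‖c‖ * ‖x‖ := (norm_mul_le _ _).trans (by gcongr; exact norm_mul_le _ _)
    _ = _ := by rw [norm_star]; ring

lemma CLE.trans {a b c : M} (h1 : CLE a b) (h2 : CLE b c) : CLE a c := by
  refine CLE.of_approx fun ε hε => ?_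
  obtain ⟨x, hx⟩ := h1 ε hε
  refine ⟨_, hx, ?_⟩
  intro δ hδ
  obtain ⟨y, hy⟩ := h2 (δ / (‖x‖ ^ 2 + 1)) (by positivity)
  refine ⟨y * x, ?_⟩
  have : star x * b * x - star (y * x) * c * (y * x) = star x * (b - star y * c * y) * x := by
    rw [star_mul]; noncomm_ring
  rw [this]
  refine (norm_conj_le _ _).trans_lt ?_
  rw [lt_div_iff₀ (by positivity)] at hy
  nlinarith [norm_nonneg (b - star y * c * y)]

lemma CLE.of_le {y z : M} (hy : 0 ≤ y) (h : y ≤ z) : CLE y z := by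
  have hz := hy.trans h
  have e : star (rt z) * rt z = z := by rw [rt_star, rt_mul hz]
  obtain ⟨Y, hY, hYc⟩ := lemmaY (rt z) hy (by rw [e]; exact h)
  rw [Metric.mem_closure_iff] at hYc
  intro ε hε
  set K := 2 * ‖Y‖ + 1
  have hK : 0 < K := by positivity
  obtain ⟨_, ⟨x, rfl⟩, hx⟩ := hYc (min 1 (ε / K)) (by positivity)
  refine ⟨x, ?_⟩
  have e2 : star x * z * x = star (rt z * x) * (rt z * x) := by
    rw [star_mul, rt_star]; nth_rewrite 1 [← rt_mul hz]; simp only [mul_assoc]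
  rw [e2, ← hY]
  simp only at hx
  set B := rt z * x
  rw [dist_eq_norm] at hx
  have e3 : star Y * Y - star B * B = star (Y - B) * Y + star B * (Y - B) := by
    rw [star_sub]; noncomm_ring
  have hB : ‖B‖ ≤ ‖Y‖ + 1 := by
    calc ‖B‖ = ‖Y - (Y - B)‖ := by congr 1; abel
      _ ≤ ‖Y‖ + ‖Y - B‖ := norm_sub_le _ _
      _ ≤ _ := by linarith [min_le_left 1 (ε / K)]
  rw [e3]
  calc _ ≤ ‖star (Y - B) * Y‖ + ‖star B * (Y - B)‖ := norm_add_le _ _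
    _ ≤ ‖Y - B‖ * ‖Y‖ + ‖B‖ * ‖Y - B‖ := by
        gcongr
        · exact (norm_mul_le _ _).trans (by rw [norm_star])
        · exact (norm_mul_le _ _).trans (by rw [norm_star])
    _ ≤ ‖Y - B‖ * K := by nlinarith [norm_nonneg (Y - B)]
    _ < ε := by
        have := hx.trans_le (min_le_right _ _)
        rwa [lt_div_iff₀ hK] at this

lemma CLE.sm (y : M) : CLE (star y * y) (y * star y) := by
  intro ε hε
  set z := star y * y with hz
  have h0 : 0 ≤ z := star_mul_self_nonneg y
  have hr := rs_cont (show 0 < ε / 2 by linarith)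
  refine ⟨y * cfc (rs (ε / 2)) z, ?_⟩
  have : star (y * cfc (rs (ε / 2)) z) * (y * star y) * (y * cfc (rs (ε / 2)) z)
      = cfc (rs (ε / 2)) z * z * (z * cfc (rs (ε / 2)) z) := by
    rw [star_mul, fc_star, hz]; simp only [mul_assoc]
  rw [this]
  have e : z - cfc (rs (ε / 2)) z * z * (z * cfc (rs (ε / 2)) z) =
      cfc (fun t => t - rs (ε / 2) t * t * (t * rs (ε / 2) t)) z := by
    rw [← fc_sub (by fun_prop) (by fun_prop), fc_id h0, ← fc_mul (by fun_prop) (by fun_prop),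
      ← fc_mul (by fun_prop) (by fun_prop), ← fc_mul (by fun_prop) (by fun_prop), fc_id h0]
  rw [e]
  refine (fc_norm_le h0 (C := ε / 2) (by positivity) fun t ht _ => ?_).trans_lt (by linarith)
  have h1 : 0 < √(t + ε / 2) := Real.sqrt_pos.2 (by linarith)
  have h3 := Real.sq_sqrt (show 0 ≤ t + ε / 2 by linarith)
  simp only [rs, abs_of_nonneg ht]
  have : t - (√(t + ε / 2))⁻¹ * t * (t * (√(t + ε / 2))⁻¹) = ε / 2 * (t / (t + ε / 2)) := by
    have h4 : 0 < t + ε / 2 := by linarith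
    have : (√(t + ε / 2))⁻¹ * t * (t * (√(t + ε / 2))⁻¹) = t ^ 2 / (t + ε / 2) := by
      rw [show t ^ 2 / (t + ε / 2) = t ^ 2 / (√(t + ε / 2)) ^ 2 by rw [h3]]; ring
    rw [this]; field_simp; ring
  rw [this, abs_of_nonneg (by positivity)]
  refine mul_le_of_le_one_right (by positivity) ?_
  rw [div_le_one (by linarith)]; linarith

lemma CLE.ms (y : M) : CLE (y * star y) (star y * y) := by
  have := CLE.sm (star y); rwa [star_star] at this

lemma CLE.smul_left {a : M} (r : ℝ) (hr : 0 ≤ r) : CLE (r • a) a := by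
  have := CLE.conj a ((√r) • (1 : M))
  convert this using 1
  simp only [star_smul, star_one, smul_mul_assoc, mul_smul_comm, one_mul, mul_one, smul_smul,
    star_trivial, Real.mul_self_sqrt hr]

/-- `f(a) ≲ a` whenever `0 ≤ f(t) ≤ C t` -/
lemma CLE.cfc_le {f g : ℝ → ℝ} (hf : Continuous f) (hg : Continuous g) {a : M} (ha : 0 ≤ a) {C : ℝ} (hC : 0 ≤ C)
    (h : ∀ t, 0 ≤ t → t ≤ ‖a‖ → 0 ≤ f t ∧ f t ≤ C * g t) : CLE (cfc f a) (cfc g a) := by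
  refine CLE.trans (CLE.of_le (z := C • cfc g a) ?_ ?_) (CLE.smul_left C hC)
  · exact cfc_nonneg fun t ht => (h t (spec_bd ha ht).1 (spec_bd ha ht).2).1
  · rw [← cfc_smul C g a hg.continuousOn]
    exact fc_mono hf (by fun_prop) ha fun t h0 h1 => (h t h0 h1).2

lemma CLE.cfc_self {f : ℝ → ℝ} (hf : Continuous f) {a : M} (ha : 0 ≤ a) {C : ℝ} (hC : 0 ≤ C)
    (h : ∀ t, 0 ≤ t → t ≤ ‖a‖ → 0 ≤ f t ∧ f t ≤ C * t) : CLE (cfc f a) a := by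
  have := CLE.cfc_le hf continuous_id' ha hC h
  rwa [fc_id ha] at this

lemma CLE.cut_self {ε : ℝ} (hε : 0 ≤ ε) {a : M} (ha : 0 ≤ a) : CLE (cut ε a) a :=
  CLE.of_le (cut_nonneg ha) (cut_le hε ha)

/-- L5 -/
lemma CLE.cut_of_le {a b : M} (ha : 0 ≤ a) {ε : ℝ}
    (h : a ≤ b + algebraMap ℝ M ε) : CLE (cut ε a) b := by
  refine CLE.of_approx fun δ hδ => ?_
  set e := rmp ε (ε + δ / 2) a with he
  have hes : star e = e := rmp_star _ _ _
  have hle : e * cfc (fun t => t - ε) a * e ≤ star e * b * e := by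
    rw [← fc_sub (f := fun t => t) (g := fun _ => ε) continuous_id' continuous_const, fc_id ha,
      cfc_const ε a (IsSelfAdjoint.of_nonneg ha)]
    nth_rewrite 1 [← hes]
    exact conj_mono (by rw [sub_le_iff_le_add]; exact h) e
  have hc := ramp_cont ε (ε + δ / 2)
  have heq : e * cfc (fun t => t - ε) a * e = cfc (fun t => ramp ε (ε + δ / 2) t * (t - ε) *
      ramp ε (ε + δ / 2) t) a := by
    rw [he, rmp, fc_mul hc (by fun_prop), fc_mul (by fun_prop) hc]
  rw [heq] at hle
  refine ⟨_, ?_, (CLE.of_le (cfc_nonneg fun t ht => ?_) hle).trans (CLE.conj b e)⟩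
  · rw [cut, fc_sub (cutf_cont _) (by fun_prop)]
    refine (fc_norm_le ha (C := δ / 2) (by positivity) fun t ht _ => ?_).trans_lt (by linarith)
    rcases le_total t ε with h1 | h1
    · rw [cutf_eq_zero h1, ramp_eq_zero (by linarith) h1]; simp; positivity
    · rw [cutf_eq h1]
      rcases le_total (ε + δ / 2) t with h2 | h2
      · rw [ramp_eq_one (by linarith) h2]; simp; positivity
      · have r0 := ramp_nonneg ε (ε + δ / 2) t
        have r1 := ramp_le_one ε (ε + δ / 2) t
        set r := ramp ε (ε + δ / 2) t
        rw [abs_le]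
        have : t - ε - r * (t - ε) * r = (t - ε) * (1 - r ^ 2) := by ring
        have : r ^ 2 ≤ 1 := pow_le_one₀ r0 r1
        constructor <;> nlinarith
  · have r0 := ramp_nonneg ε (ε + δ / 2) t
    rcases le_total t ε with h1 | h1
    · rw [ramp_eq_zero (by linarith) h1]; simp
    · have : 0 ≤ t - ε := by linarith
      positivity

lemma CLE.cut_of_norm {a b : M} (ha : 0 ≤ a) (hb : 0 ≤ b) {ε : ℝ} (h : ‖a - b‖ ≤ ε) :
    CLE (cut ε a) b := by
  refine CLE.cut_of_le ha ?_
  have h1 := sa_le_norm (a := a - b) ((IsSelfAdjoint.of_nonneg ha).sub (IsSelfAdjoint.of_nonneg hb))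
  have h2 : algebraMap ℝ M ‖a - b‖ ≤ algebraMap ℝ M ε := algebraMap_mono M h
  rw [← sub_le_iff_le_add']
  exact h1.trans h2

/-- L6 -/
lemma CLE.cut_cut {a b : M} (ha : 0 ≤ a) (hb : 0 ≤ b) (h : CLE a b) {ε : ℝ} (hε : 0 < ε) :
    ∃ δ > 0, CLE (cut ε a) (cut δ b) := by
  obtain ⟨x, hx⟩ := h (ε / 2) (by linarith)
  refine ⟨ε / 2 / (‖x‖ ^ 2 + 1), by positivity, ?_⟩
  set δ := ε / 2 / (‖x‖ ^ 2 + 1)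
  refine (CLE.cut_of_norm ha (conj_nonneg (cut_nonneg (ε := δ) hb) x) ?_).trans (CLE.conj _ x)
  have h1 : ‖star x * (b - cut δ b) * x‖ ≤ ε / 2 := by
    refine (norm_conj_le _ _).trans ?_
    have : δ * (‖x‖ ^ 2 + 1) = ε / 2 := by simp only [δ]; field_simp
    have h3 := cut_approx (show 0 ≤ δ by positivity) hb
    have : 0 ≤ δ := by positivity
    nlinarith [sq_nonneg ‖x‖]
  calc _ = ‖(a - star x * b * x) + star x * (b - cut δ b) * x‖ := by congr 1; noncomm_ring
    _ ≤ _ := norm_add_le _ _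
    _ ≤ ε := by linarith

/-- L7 -/
lemma CLE.of_cut {a b : M} (ha : 0 ≤ a) (h : ∀ ε : ℝ, 0 < ε → CLE (cut ε a) b) : CLE a b :=
  CLE.of_approx fun ε hε => ⟨cut (ε / 2) a, (cut_approx (by linarith) ha).trans_lt (by linarith),
    h _ (by linarith)⟩

/-- exact version -/
lemma CLE.exact {k a : M} (hk : 0 ≤ k) (ha : 0 ≤ a) (h : CLE k a) {η : ℝ} (hη : 0 < η) :
    ∃ Y : M, star Y * Y = cut η k ∧ Y ∈ closure (Set.range (rt a * ·)) := by
  obtain ⟨x, hx⟩ := h (η / 2) (by linarith)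
  set f : ℝ → ℝ := fun t => √(cutf η t / max (t - η / 2) (η / 2)) with hf
  have hfc : Continuous f := by
    refine Real.continuous_sqrt.comp ((cutf_cont η).div (by fun_prop) fun t => ?_)
    have := le_max_right (t - η / 2) (η / 2)
    exact ne_of_gt (by linarith)
  have h1 : k - algebraMap ℝ M (η / 2) ≤ star x * a * x := by
    have h1 := sa_le_norm (a := k - star x * a * x)
      ((IsSelfAdjoint.of_nonneg hk).sub (IsSelfAdjoint.of_nonneg (conj_nonneg ha x)))
    have h2 : algebraMap ℝ M ‖k - star x * a * x‖ ≤ algebraMap ℝ M (η / 2) :=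
      algebraMap_mono M hx.le
    rw [sub_le_iff_le_add, ← sub_le_iff_le_add']
    exact h1.trans h2
  have h2 := conj_mono h1 (cfc f k)
  have e1 : star (cfc f k) * (k - algebraMap ℝ M (η / 2)) * cfc f k = cut η k := by
    rw [fc_star, ← cfc_const (η / 2) k (IsSelfAdjoint.of_nonneg hk)]
    nth_rewrite 2 [← fc_id hk]
    rw [fc_sub continuous_id' continuous_const, fc_mul hfc (by fun_prop),
      fc_mul (by fun_prop) hfc, cut]
    refine fc_congr hk fun t ht => ?_
    rcases le_total t η with h3 | h3
    · simp [hf, cutf_eq_zero h3]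
    · have h4 : max (t - η / 2) (η / 2) = t - η / 2 := max_eq_left (by linarith)
      have h5 : 0 < t - η / 2 := by linarith
      simp only [hf, h4, cutf_eq h3]
      have := Real.mul_self_sqrt (show 0 ≤ (t - η) / (t - η / 2) from div_nonneg (by linarith) h5.le)
      calc _ = (√((t - η) / (t - η / 2)) * √((t - η) / (t - η / 2))) * (t - η / 2) := by ring
        _ = _ := by rw [this]; exact div_mul_cancel₀ _ h5.ne'
  rw [e1] at h2
  have e2 : star (cfc f k) * (star x * a * x) * cfc f k =
      star (rt a * (x * cfc f k)) * (rt a * (x * cfc f k)) := by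
    rw [star_mul, star_mul, rt_star]; nth_rewrite 1 [← rt_mul ha]
    simp only [mul_assoc]
  rw [e2] at h2
  obtain ⟨Y, hY, hYc⟩ := lemmaY _ (cut_nonneg hk) h2
  refine ⟨Y, hY, closure_mono ?_ hYc⟩
  rintro _ ⟨w, rfl⟩
  exact ⟨x * cfc f k * w, by simp only [mul_assoc]⟩

/-- closed conditions for elements of `closure (Z M)` -/
lemma clos_left {Z Y d : M} (c : ℂ) (hd : d * Z = c • Z) (h : Y ∈ closure (Set.range (Z * ·))) :
    d * Y = c • Y := by
  have : IsClosed {y : M | d * y = c • y} := isClosed_eq (by fun_prop) (by fun_prop)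
  refine this.closure_subset_iff.2 ?_ h
  rintro _ ⟨w, rfl⟩
  simp only [Set.mem_ofPred_eq, ← mul_assoc, hd, smul_mul_assoc]

lemma clos_one {Z Y d : M} (hd : d * Z = Z) (h : Y ∈ closure (Set.range (Z * ·))) :
    d * Y = Y := by
  simpa using clos_left 1 (by simpa using hd) h

lemma clos_zero {Z Y d : M} (hd : d * Z = 0) (h : Y ∈ closure (Set.range (Z * ·))) :
    d * Y = 0 := by
  simpa using clos_left 0 (by simpa using hd) h

/-- monotonicity of cuts -/
lemma CLE.cut_mono_le {a b : M} (ha : 0 ≤ a) (hab : a ≤ b) {ε : ℝ} (hε : 0 ≤ ε) :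
    CLE (cut ε a) (cut ε b) := by
  refine CLE.cut_of_le ha (hab.trans ?_)
  have hb := ha.trans hab
  have := cut_approx hε hb
  have h1 := sa_le_norm (a := b - cut ε b)
      ((IsSelfAdjoint.of_nonneg hb).sub (IsSelfAdjoint.of_nonneg (cut_nonneg hb)))
  have h2 : algebraMap ℝ M ‖b - cut ε b‖ ≤ algebraMap ℝ M ε := algebraMap_mono M this
  rw [← sub_le_iff_le_add']
  exact h1.trans h2

lemma CLE.cut_cut_le {a : M} (ha : 0 ≤ a) {ε δ : ℝ} (h : δ ≤ ε) :
    CLE (cut ε a) (cut δ a) :=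
  CLE.of_le (cut_nonneg ha) (fc_mono (cutf_cont _) (cutf_cont _) ha fun t _ _ =>
    max_le_max (by linarith) le_rfl)

lemma cut_le_add {ε : ℝ} (hε : 0 ≤ ε) {b : M} (hb : 0 ≤ b) : b ≤ cut ε b + algebraMap ℝ M ε := by
  have := cut_approx hε hb
  have h1 := sa_le_norm (a := b - cut ε b)
      ((IsSelfAdjoint.of_nonneg hb).sub (IsSelfAdjoint.of_nonneg (cut_nonneg hb)))
  have h2 : algebraMap ℝ M ‖b - cut ε b‖ ≤ algebraMap ℝ M ε := algebraMap_mono M this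
  rw [← sub_le_iff_le_add']
  exact h1.trans h2

/-- compression by a contraction -/
lemma CLE.cut_conj {a x : M} (ha : 0 ≤ a) (hx : ‖x‖ ≤ 1) {ε : ℝ} (hε : 0 ≤ ε) :
    CLE (cut ε (star x * a * x)) (cut ε a) := by
  refine (CLE.cut_of_le (b := star x * cut ε a * x) (conj_nonneg ha x) ?_).trans (CLE.conj _ x)
  have h := conj_mono (cut_le_add hε ha) x
  refine h.trans ?_
  rw [mul_add, add_mul]
  refine add_le_add le_rfl ?_
  have h1 : star x * x ≤ 1 := le_one_of_norm (star_mul_self_nonneg x) (by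
    rw [nsq]; exact pow_le_one₀ (norm_nonneg _) hx)
  rw [← Algebra.commutes, mul_assoc]
  rw [Algebra.algebraMap_eq_smul_one, smul_mul_assoc, one_mul]
  exact smul_le_smul_of_nonneg_left h1 hε

lemma CLE.cut_add {a b : M} (ha : 0 ≤ a) (hb : 0 ≤ b) {ε : ℝ} (hε : 0 ≤ ε) :
    CLE (cut ε (a + b)) (cut ε a + b) := by
  refine CLE.cut_of_le (add_nonneg ha hb) ?_
  have := add_le_add_left (cut_le_add hε ha) b
  calc a + b ≤ cut ε a + algebraMap ℝ M ε + b := this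
    _ = _ := by abel

/-- L11 -/
lemma CLE.add_orth {a b a' b' : M} (ha : 0 ≤ a') (hb : 0 ≤ b') (h : a' * b' = 0)
    (h1 : CLE a a') (h2 : CLE b b') : CLE (a + b) (a' + b') := by
  have hba : b' * a' = 0 := by
    have := congrArg star h
    simpa [star_mul, nonneg_sa ha, nonneg_sa hb] using this
  intro ε hε
  obtain ⟨x, hx⟩ := h1 (ε / 4) (by linarith)
  obtain ⟨y, hy⟩ := h2 (ε / 4) (by linarith)
  -- approximate units
  have key : ∀ c : M, 0 ≤ c → ∀ x : M, ∀ δ > 0, ∃ u : M, (∃ v, u = v * c) ∧ (∃ v, u = c * v) ∧ star u = u ∧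
      ‖star x * c * x - star (u * x) * c * (u * x)‖ < δ := by
    intro c hc x δ hδ
    set κ := δ / (4 * (‖x‖ ^ 2 + 1)) with hκd
    have hκ : 0 < κ := by positivity
    have hi : Continuous (fun t : ℝ => (|t| + κ)⁻¹) :=
      Continuous.inv₀ (by fun_prop) fun t => by positivity
    refine ⟨cfc (fun t => t * (|t| + κ)⁻¹) c, ⟨cfc (fun t => (|t| + κ)⁻¹) c, ?_⟩,
      ⟨cfc (fun t => (|t| + κ)⁻¹) c, ?_⟩, fc_star _ _, ?_⟩
    · nth_rewrite 3 [← fc_id hc]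
      rw [fc_mul hi continuous_id']; congr 1; ext t; ring
    · nth_rewrite 2 [← fc_id hc]
      rw [fc_mul continuous_id' hi]
    · set u := cfc (fun t => t * (|t| + κ)⁻¹) c with hu
      have : star x * c * x - star (u * x) * c * (u * x) = star x * (c - u * c * u) * x := by
        rw [star_mul, hu, fc_star]; noncomm_ring
      rw [this]
      have e : c - u * c * u = cfc (fun t => t - t * (|t| + κ)⁻¹ * t * (t * (|t| + κ)⁻¹)) c := by
        rw [← fc_sub (by fun_prop) (by fun_prop), fc_id hc, ← fc_mul (by fun_prop) (by fun_prop),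
          ← fc_mul (by fun_prop) (by fun_prop), fc_id hc]
      have hn : ‖c - u * c * u‖ ≤ 2 * κ := by
        rw [e]
        refine fc_norm_le hc (by positivity) fun t ht _ => ?_
        rw [abs_of_nonneg ht]
        have hp : 0 < t + κ := by linarith
        have : t - t * (t + κ)⁻¹ * t * (t * (t + κ)⁻¹) = κ * (t * (2 * t + κ)) / (t + κ) ^ 2 := by
          field_simp; ring
        rw [this, abs_of_nonneg (by positivity), div_le_iff₀ (by positivity)]
        nlinarith [mul_pos hκ hκ, mul_nonneg ht hκ.le]
      refine (norm_conj_le _ _).trans_lt ?_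
      have : κ * (4 * (‖x‖ ^ 2 + 1)) = δ := by rw [hκd]; field_simp
      nlinarith [sq_nonneg ‖x‖]
  obtain ⟨u, ⟨u1, hu1⟩, ⟨u2, hu2⟩, hus, hu⟩ := key a' ha x (ε / 4) (by linarith)
  obtain ⟨v, ⟨v1, hv1⟩, ⟨v2, hv2⟩, hvs, hv⟩ := key b' hb y (ε / 4) (by linarith)
  refine ⟨u * x + v * y, ?_⟩
  have e1 : u * b' = 0 := by rw [hu1, mul_assoc, h, mul_zero]
  have e2 : v * a' = 0 := by rw [hv1, mul_assoc, hba, mul_zero]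
  have e3 : b' * u = 0 := by rw [hu2, ← mul_assoc, hba, zero_mul]
  have e4 : a' * v = 0 := by rw [hv2, ← mul_assoc, h, zero_mul]
  have e : star (u * x + v * y) * (a' + b') * (u * x + v * y) =
      star (u * x) * a' * (u * x) + star (v * y) * b' * (v * y) := by
    simp only [star_add, star_mul, hus, hvs, mul_add, add_mul]
    have f1 : star x * u * b' = 0 := by rw [mul_assoc, e1, mul_zero]
    have f2 : star y * v * a' = 0 := by rw [mul_assoc, e2, mul_zero]
    have f3 : star x * u * a' * (v * y) = 0 := by
      rw [mul_assoc, ← mul_assoc a', e4, zero_mul, mul_zero]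
    have f4 : star y * v * b' * (u * x) = 0 := by
      rw [mul_assoc, ← mul_assoc b', e3, zero_mul, mul_zero]
    simp [f1, f2, f3, f4]
  rw [e]
  calc _ = ‖(a - star x * a' * x) + (star x * a' * x - star (u * x) * a' * (u * x)) +
        ((b - star y * b' * y) + (star y * b' * y - star (v * y) * b' * (v * y)))‖ := by
        congr 1; abel
    _ ≤ _ := (norm_add_le _ _).trans (add_le_add (norm_add_le _ _) (norm_add_le _ _))
    _ < ε := by linarith

end Generic2

section Generic3
variable {M : Type*} [CStarAlgebra M] [PartialOrder M] [StarOrderedRing M]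

/-! ### intertwining -/

lemma aeval_intertwine {S T Y : M} (h : S * Y = Y * T) (p : Polynomial ℝ) :
    Polynomial.aeval S p * Y = Y * Polynomial.aeval T p := by
  induction p using Polynomial.induction_on' with
  | add p q hp hq => rw [map_add, map_add, add_mul, mul_add, hp, hq]
  | monomial n a =>
    rw [Polynomial.aeval_monomial, Polynomial.aeval_monomial]
    have hpow : S ^ n * Y = Y * T ^ n := by
      induction n with
      | zero => simp
      | succ n ih => rw [pow_succ, mul_assoc, h, ← mul_assoc, ih, mul_assoc, ← pow_succ]
    rw [mul_assoc, hpow, ← mul_assoc, ← mul_assoc, Algebra.commutes]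

lemma poly_approx {f : ℝ → ℝ} (hf : Continuous f) {S T : M} (hS : IsSelfAdjoint S)
    (hT : IsSelfAdjoint T) {ε : ℝ} (hε : 0 < ε) :
    ∃ p : Polynomial ℝ, ‖Polynomial.aeval S p - cfc f S‖ ≤ ε ∧
      ‖Polynomial.aeval T p - cfc f T‖ ≤ ε := by
  set R := max ‖S‖ ‖T‖
  obtain ⟨p, hp⟩ := exists_polynomial_near_of_continuousOn (-R) R f hf.continuousOn ε hε
  have key : ∀ X : M, IsSelfAdjoint X → ‖X‖ ≤ R → ‖Polynomial.aeval X p - cfc f X‖ ≤ ε := by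
    intro X hX hXR
    rw [← cfc_polynomial p X hX, fc_sub (Polynomial.continuous p) hf]
    refine norm_cfc_le hε.le fun t ht => (hp t ?_).le
    have := spectrum.norm_le_norm_mul_of_mem ht
    rcases subsingleton_or_nontrivial M with h | h
    · exact absurd ht (by rw [spectrum.of_subsingleton]; simp)
    · rw [norm_one, mul_one] at this
      exact abs_le.1 (this.trans hXR)
  exact ⟨p, key S hS (le_max_left _ _), key T hT (le_max_right _ _)⟩

lemma eq_zero_of_norm_le {x : M} {C : ℝ} (h : ∀ ε > 0, ‖x‖ ≤ C * ε) : x = 0 := by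
  rw [← norm_le_zero_iff]
  refine le_of_forall_pos_le_add fun ε hε => ?_
  refine (h (ε / (|C| + 1)) (by positivity)).trans ?_
  rw [zero_add, mul_div_assoc', div_le_iff₀ (by positivity)]
  nlinarith [le_abs_self C]

lemma intertwine {S T Y : M} (hS : IsSelfAdjoint S) (hT : IsSelfAdjoint T) (h : S * Y = Y * T)
    {f : ℝ → ℝ} (hf : Continuous f) : cfc f S * Y = Y * cfc f T := by
  rw [← sub_eq_zero]
  refine eq_zero_of_norm_le (C := 2 * ‖Y‖) fun ε hε => ?_
  obtain ⟨p, h1, h2⟩ := poly_approx hf hS hT hε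
  have : cfc f S * Y - Y * cfc f T = Y * (Polynomial.aeval T p - cfc f T)
     - (Polynomial.aeval S p - cfc f S) * Y := by
    rw [mul_sub, sub_mul, aeval_intertwine h]; abel
  rw [this]
  calc _ ≤ ‖Y * (Polynomial.aeval T p - cfc f T)‖ + ‖(Polynomial.aeval S p - cfc f S) * Y‖ :=
        norm_sub_le _ _
    _ ≤ ‖Y‖ * ε + ε * ‖Y‖ := by
        gcongr
        · exact (norm_mul_le _ _).trans (by gcongr)
        · exact (norm_mul_le _ _).trans (by gcongr)
    _ = _ := by ring

lemma fc_eig {T Q : M} {μ : ℝ} (hT : IsSelfAdjoint T) (h : T * Q = μ • Q)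
    {f : ℝ → ℝ} (hf : Continuous f) : cfc f T * Q = f μ • Q := by
  have := intertwine (T := algebraMap ℝ M μ) (Y := Q) hT (.algebraMap M (.all μ)) (by
    rw [h, ← Algebra.commutes, Algebra.smul_def]) hf
  rw [this, cfc_algebraMap, ← Algebra.commutes, Algebra.smul_def]

lemma fc_ann {T Q : M} (hT : IsSelfAdjoint T) (h : T * Q = 0)
    {f : ℝ → ℝ} (hf : Continuous f) (h0 : f 0 = 0) : cfc f T * Q = 0 := by
  rw [fc_eig (μ := 0) hT (by simpa using h) hf, h0, zero_smul]

lemma fc_ann' {T Q : M} (hT : IsSelfAdjoint T) (h : Q * T = 0)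
    {f : ℝ → ℝ} (hf : Continuous f) (h0 : f 0 = 0) : Q * cfc f T = 0 := by
  have h1 : T * star Q = 0 := by
    have := congrArg star h; simpa [hT.star_eq] using this
  have := congrArg star (fc_ann hT h1 hf h0)
  simpa using this

lemma star_mul_self_zero {x : M} (h : star x * x = 0) : x = 0 :=
  (CStarRing.star_mul_self_eq_zero_iff x).1 h

lemma rt_ann {a d : M} (ha : 0 ≤ a) (h : d * a = 0) : d * rt a = 0 :=
  fc_ann' (IsSelfAdjoint.of_nonneg ha) h Real.continuous_sqrt Real.sqrt_zero

lemma rt_unit {a d : M} (ha : 0 ≤ a) (h : d * a = a) : d * rt a = rt a := by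
  have := rt_ann (d := 1 - d) ha (by rw [sub_mul, one_mul, h, sub_self])
  rw [sub_mul, one_mul, sub_eq_zero] at this
  exact this.symm

/-- contraction lemma -/
lemma contr_fix {V c : M} (hV : ‖V‖ ≤ 1) (h : V * c = c) : star V * c = c := by
  have h1 : V * star V ≤ 1 := le_one_of_norm (mul_star_self_nonneg V) (by
    rw [nsq']; exact pow_le_one₀ (norm_nonneg _) hV)
  have h2 : star c * star V = star c := by rw [← star_mul, h]
  have e : star (star V * c - c) * (star V * c - c) = star c * (V * star V) * c - star c * c := by
    simp only [star_sub, star_mul, star_star, sub_mul, mul_sub]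
    have a1 : star c * V * c = star c * c := by rw [mul_assoc, h]
    have a2 : star c * (star V * c) = star c * c := by rw [← mul_assoc, h2]
    rw [a1, a2]; simp only [mul_assoc]; abel
  have h3 : star (star V * c - c) * (star V * c - c) ≤ 0 := by
    rw [e, sub_nonpos]
    have := conj_mono h1 c
    rwa [mul_one] at this
  have h4 := le_antisymm h3 (star_mul_self_nonneg _)
  exact sub_eq_zero.1 (star_mul_self_zero h4)

lemma contr_fix' {V c : M} (hV : ‖V‖ ≤ 1) (h : V * c = c) (hc : star c = c) : c * V = c := by
  have := congrArg star (contr_fix hV h)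
  simpa [hc] using this

/-! ### units -/

lemma alg_nonneg {r : ℝ} (hr : 0 ≤ r) : (0 : M) ≤ algebraMap ℝ M r := by
  rw [← map_zero (algebraMap ℝ M)]; exact algebraMap_mono M hr

lemma pos_add_unit {a : M} (ha : 0 ≤ a) {l : ℝ} (hl : 0 < l) : IsUnit (a + algebraMap ℝ M l) := by
  have h1 : algebraMap ℝ M l ≤ a + algebraMap ℝ M l := le_add_of_nonneg_left ha
  refine CStarAlgebra.isUnit_of_le _ h1 ?_
  exact IsUnit.isStrictlyPositive ((isUnit_iff_ne_zero.2 hl.ne').map (algebraMap ℝ M))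
    (alg_nonneg hl.le)

lemma unit_star_mul_star {u : M} (h : u * star u = 1) (h' : star u * u = 1) : IsUnit u :=
  ⟨⟨u, star u, h, h'⟩, rfl⟩

lemma clos_unit_mul {x y : M} (hx : x ∈ closure {x : M | IsUnit x})
    (hy : y ∈ closure {x : M | IsUnit x}) : x * y ∈ closure {x : M | IsUnit x} :=
  map_mem_closure₂ continuous_mul hx hy fun _ ha _ hb => IsUnit.mul ha hb

lemma clos_unit_star {x : M} (hx : x ∈ closure {x : M | IsUnit x}) :
    star x ∈ closure {x : M | IsUnit x} :=
  map_mem_closure continuous_star hx fun _ ha => IsUnit.star ha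

lemma clos_of_approx {S : Set M} {x : M} (h : ∀ ε > 0, ∃ y ∈ closure S, ‖x - y‖ ≤ ε) :
    x ∈ closure S := by
  rw [← closure_closure, Metric.mem_closure_iff]
  intro ε hε
  obtain ⟨y, hy, hxy⟩ := h (ε / 2) (by linarith)
  exact ⟨y, hy, by rw [dist_eq_norm]; linarith⟩

/-! ### invertibles acting as a scalar on `Q` -/

def GLQ (Q : M) : Set M := {G | IsUnit G ∧ ∃ μ : ℝ, 0 < μ ∧ G * Q = μ • Q ∧ Q * G = μ • Q}

lemma GLQ_mul {Q x y : M} (hx : x ∈ GLQ Q) (hy : y ∈ GLQ Q) : x * y ∈ GLQ Q := by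
  obtain ⟨hx, a, ha, h1, h2⟩ := hx
  obtain ⟨hy, b, hb, h3, h4⟩ := hy
  refine ⟨hx.mul hy, a * b, mul_pos ha hb, ?_, ?_⟩
  · rw [mul_assoc, h3, mul_smul_comm, h1, smul_smul, mul_comm]
  · rw [← mul_assoc, h2, smul_mul_assoc, h4, smul_smul]

lemma clos_GLQ_mul {Q x y : M} (hx : x ∈ closure (GLQ Q))
    (hy : y ∈ closure (GLQ Q)) : x * y ∈ closure (GLQ Q) :=
  map_mem_closure₂ continuous_mul hx hy fun _ ha _ hb => GLQ_mul ha hb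

lemma nilp_unit {a : M} (ha : a * a = 0) {l : ℝ} (hl : l ≠ 0) : IsUnit (a + algebraMap ℝ M l) := by
  have e1 : (a + algebraMap ℝ M l) * ((l⁻¹ * l⁻¹) • (algebraMap ℝ M l - a)) = 1 := by
    rw [mul_smul_comm]
    have : (a + algebraMap ℝ M l) * (algebraMap ℝ M l - a) = (l * l) • 1 := by
      rw [add_mul, mul_sub, mul_sub, ha, Algebra.commutes l a, ← map_mul,
        Algebra.algebraMap_eq_smul_one (l * l)]; abel
    rw [this, smul_smul, show l⁻¹ * l⁻¹ * (l * l) = 1 by field_simp, one_smul]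
  have e2 : ((l⁻¹ * l⁻¹) • (algebraMap ℝ M l - a)) * (a + algebraMap ℝ M l) = 1 := by
    rw [smul_mul_assoc]
    have : (algebraMap ℝ M l - a) * (a + algebraMap ℝ M l) = (l * l) • 1 := by
      rw [sub_mul, mul_add, mul_add, ha, Algebra.commutes l a, ← map_mul,
        Algebra.algebraMap_eq_smul_one (l * l)]; abel
    rw [this, smul_smul, show l⁻¹ * l⁻¹ * (l * l) = 1 by field_simp, one_smul]
  exact ⟨⟨_, _, e1, e2⟩, rfl⟩

lemma norm_alg_le {r : ℝ} (hr : 0 ≤ r) : ‖algebraMap ℝ M r‖ ≤ r := by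
  rcases subsingleton_or_nontrivial M with h | h
  · rw [Subsingleton.elim (algebraMap ℝ M r) 0, norm_zero]; exact hr
  · rw [norm_algebraMap', Real.norm_of_nonneg hr]

lemma clos_GLQ_nilp {Q a : M} (ha : a * a = 0) (h1 : a * Q = 0) (h2 : Q * a = 0) :
    a ∈ closure (GLQ Q) := by
  refine clos_of_approx fun ε hε => ⟨a + algebraMap ℝ M ε, subset_closure
    ⟨nilp_unit ha hε.ne', ε, hε, ?_, ?_⟩, ?_⟩
  · rw [add_mul, h1, zero_add, Algebra.smul_def]
  · rw [mul_add, h2, zero_add, Algebra.smul_def, Algebra.commutes]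
  · rw [sub_add_cancel_left, norm_neg]; exact norm_alg_le hε.le

lemma clos_GLQ_pos {Q p : M} (hp : 0 ≤ p) {κ : ℝ} (hκ : 0 ≤ κ) (h1 : p * Q = κ • Q)
    (h2 : Q * p = κ • Q) : p ∈ closure (GLQ Q) := by
  refine clos_of_approx fun ε hε => ⟨p + algebraMap ℝ M ε, subset_closure
    ⟨pos_add_unit hp hε, κ + ε, by positivity, ?_, ?_⟩, ?_⟩
  · rw [add_mul, h1, add_smul, Algebra.smul_def ε]
  · rw [mul_add, h2, add_smul, Algebra.smul_def ε, Algebra.commutes ε]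
  · rw [sub_add_cancel_left, norm_neg]; exact norm_alg_le hε.le

/-- polar decomposition of an element of `GLQ`. -/
lemma polar {Q G : M} (hQ : star Q = Q) (hG : G ∈ GLQ Q) :
    ∃ U : M, star U * U = 1 ∧ U * star U = 1 ∧ U * Q = Q ∧ Q * U = Q ∧
      U * rt (star G * G) = G ∧ ∀ p : M, star G * G * p = p → U * p = G * p := by
  obtain ⟨hu, μ, hμ, h1, h2⟩ := hG
  have hz := star_mul_self_nonneg G
  set z := star G * G with hzd
  have hzu : IsUnit z := hu.star.mul hu
  have hru : IsUnit (rt z) := by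
    have : IsUnit (rt z * rt z) := by rwa [rt_mul hz]
    exact isUnit_of_mul_isUnit_left' this
  obtain ⟨r, hr⟩ := hru
  have hrs : star (↑r⁻¹ : M) = ↑r⁻¹ := by
    have : star r = r := Units.ext (by rw [Units.coe_star, hr, rt_star])
    rw [← Units.coe_star, star_inv, this]
  have hGU : G * ↑r⁻¹ * rt z = G := by rw [← hr, mul_assoc, Units.inv_mul, mul_one]
  have hU : star (G * ↑r⁻¹) * (G * ↑r⁻¹) = 1 := by
    rw [star_mul, hrs]
    calc _ = (↑r⁻¹ : M) * (star G * G) * ↑r⁻¹ := by simp only [mul_assoc]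
      _ = (↑r⁻¹ : M) * (rt z * rt z) * ↑r⁻¹ := by rw [rt_mul hz]
      _ = _ := by rw [← hr]; simp [mul_assoc]
  have hUu : IsUnit (G * ↑r⁻¹) := hu.mul (Units.isUnit _)
  have hU' : (G * ↑r⁻¹) * star (G * ↑r⁻¹) = 1 := by
    obtain ⟨u, hu⟩ := hUu
    rw [← hu] at hU ⊢
    have h7 : star (u : M) = ↑u⁻¹ := by
      rw [← mul_one (star (u : M)), ← Units.mul_inv u, ← mul_assoc, hU, one_mul]
    rw [h7, Units.mul_inv]
  have hstarQ : star G * Q = μ • Q := by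
    have := congrArg star h2
    simpa [hQ] using this
  have hzQ : z * Q = (μ * μ) • Q := by
    rw [hzd, mul_assoc, h1, mul_smul_comm, hstarQ, smul_smul]
  have hrQ : rt z * Q = μ • Q := by
    have := fc_eig (IsSelfAdjoint.of_nonneg hz) hzQ Real.continuous_sqrt
    rwa [Real.sqrt_mul_self hμ.le] at this
  have hQr : Q * rt z = μ • Q := by
    have := congrArg star hrQ
    simpa [hQ, rt_star] using this
  refine ⟨G * ↑r⁻¹, hU, hU', ?_, ?_, hGU, ?_⟩
  · have : (↑r⁻¹ : M) * Q = μ⁻¹ • Q := by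
      have h3 : Q = μ⁻¹ • (rt z * Q) := by rw [hrQ, smul_smul, inv_mul_cancel₀ hμ.ne', one_smul]
      nth_rewrite 1 [h3]
      rw [mul_smul_comm, ← mul_assoc, ← hr, Units.inv_mul, one_mul]
    rw [mul_assoc, this, mul_smul_comm, h1, smul_smul, inv_mul_cancel₀ hμ.ne', one_smul]
  · rw [← mul_assoc, h2, smul_mul_assoc, ← smul_mul_assoc, ← hQr, mul_assoc, ← hr, Units.mul_inv,
      mul_one]
  · intro p hp
    have h4 : rt z * p = p := by
      have := fc_eig (Q := p) (μ := 1) (IsSelfAdjoint.of_nonneg hz) (by rw [hp, one_smul])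
        Real.continuous_sqrt
      rw [Real.sqrt_one, one_smul] at this
      exact this
    have : (↑r⁻¹ : M) * p = p := by
      nth_rewrite 1 [← h4]
      rw [← mul_assoc, ← hr, Units.inv_mul, one_mul]
    rw [mul_assoc, this]
where
  isUnit_of_mul_isUnit_left' {x : M} (h : IsUnit (x * x)) : IsUnit x := by
    obtain ⟨u, hu⟩ := h
    have e : (x * x) * ↑u⁻¹ = 1 := by rw [← hu, Units.mul_inv]
    have e' : ↑u⁻¹ * (x * x) = 1 := by rw [← hu, Units.inv_mul]
    have c : x * ↑u⁻¹ = ↑u⁻¹ * x := by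
      calc x * ↑u⁻¹ = (↑u⁻¹ * (x * x)) * (x * ↑u⁻¹) := by rw [e', one_mul]
        _ = ↑u⁻¹ * x * ((x * x) * ↑u⁻¹) := by simp only [mul_assoc]
        _ = _ := by rw [e, mul_one]
    exact ⟨⟨x, x * ↑u⁻¹, by rw [← mul_assoc, e], by rw [c, mul_assoc, e']⟩, rfl⟩

/-- Lemma U -/
lemma lemmaU {Q y c : M} (hQ : star Q = Q) (hy : y ∈ closure (GLQ Q)) (hc : 0 ≤ c)
    (hyc : star y * y = c * c) {η : ℝ} (hη : 0 < η) :
    ∃ U : M, star U * U = 1 ∧ U * star U = 1 ∧ U * Q = Q ∧ Q * U = Q ∧ ‖U * c - y‖ < η := by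
  obtain ⟨g, hg, hlim⟩ := mem_closure_iff_seq_limit.1 hy
  have h1 : Tendsto (fun n => star (g n) * g n) atTop (𝓝 (c * c)) := by
    rw [← hyc]; exact hlim.star.mul hlim
  have hcc : 0 ≤ c * c := by rw [← hyc]; exact star_mul_self_nonneg y
  have hrt : rt (c * c) = c := by
    have : c * c = cfc (fun t : ℝ => t * t) c := by
      rw [← fc_mul continuous_id' continuous_id', fc_id hc]
    rw [rt, this, fc_comp (by fun_prop) Real.continuous_sqrt hc,
      fc_congr (g := fun t => t) hc fun t ht => Real.sqrt_mul_self ht, fc_id hc]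
  have h2 : Tendsto (fun n => rt (star (g n) * g n)) atTop (𝓝 c) := by
    rw [show 𝓝 c = 𝓝 (rt (c * c)) by rw [hrt]]
    set R := ‖c * c‖ + 1
    refine Filter.Tendsto.cfc (s := Set.Icc 0 R) isCompact_Icc Real.sqrt h1 ?_ ?_ ?_ ?_
      Real.continuous_sqrt.continuousOn
    · have : ∀ᶠ n in atTop, ‖star (g n) * g n‖ < R :=
        h1.norm.eventually (eventually_lt_nhds (by simp [R]))
      filter_upwards [this] with n hn t ht
      have := spec_bd (star_mul_self_nonneg (g n)) ht
      exact ⟨this.1, this.2.trans hn.le⟩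
    · exact Eventually.of_forall fun n => IsSelfAdjoint.star_mul_self _
    · intro t ht
      have := spec_bd hcc ht
      exact ⟨this.1, this.2.trans (by simp [R])⟩
    · exact IsSelfAdjoint.of_nonneg hcc
  have h3 : Tendsto (fun n => ‖rt (star (g n) * g n) - c‖ + ‖g n - y‖) atTop (𝓝 0) := by
    have := (tendsto_iff_norm_sub_tendsto_zero.1 h2).add (tendsto_iff_norm_sub_tendsto_zero.1 hlim)
    simpa using this
  obtain ⟨n, hn⟩ := (h3.eventually (eventually_lt_nhds hη)).exists
  obtain ⟨U, hU1, hU2, hU3, hU4, hU5, -⟩ := polar hQ (hg n)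
  refine ⟨U, hU1, hU2, hU3, hU4, ?_⟩
  have hUn : ‖U‖ ≤ 1 := by
    have := nsq U
    rw [hU1] at this
    rcases subsingleton_or_nontrivial M with h | h
    · rw [Subsingleton.elim U 0]; simp
    · rw [norm_one] at this; nlinarith [norm_nonneg U]
  calc ‖U * c - y‖ = ‖(g n - y) - U * (rt (star (g n) * g n) - c)‖ := by
        rw [mul_sub, hU5]; congr 1; abel
    _ ≤ ‖g n - y‖ + ‖U * (rt (star (g n) * g n) - c)‖ := norm_sub_le _ _
    _ ≤ ‖g n - y‖ + 1 * ‖rt (star (g n) * g n) - c‖ := by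
        gcongr; exact (norm_mul_le _ _).trans (by gcongr)
    _ < η := by linarith

lemma unitary_norm {U : M} (h : star U * U = 1) : ‖U‖ ≤ 1 := by
  have := nsq U
  rw [h] at this
  rcases subsingleton_or_nontrivial M with h | h
  · rw [Subsingleton.elim U 0]; simp
  · rw [norm_one] at this; nlinarith [norm_nonneg U]

/-- Lemma Exact -/
lemma lemmaExact {Q w c q p : M} (hQ : star Q = Q) (hw : ‖w‖ ≤ 1) (hwQ : w * Q = Q) (hQw : Q * w = Q)
    (hc : 0 ≤ c) (hq : 0 ≤ q) (hq1 : q ≤ 1) (hqQ : q * Q = 0)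
    (hwc : star w * w * c = c) (hcq : c * q = q) (hqp : q * p = p)
    (hcl : w * c ∈ closure (GLQ Q)) :
    ∃ P : M, star P * P = 1 ∧ P * star P = 1 ∧ P * Q = Q ∧ Q * P = Q ∧ P * p = w * p := by
  have hcs := nonneg_sa hc
  have hqs := nonneg_sa hq
  have hyc : star (w * c) * (w * c) = c * c := by
    rw [star_mul, hcs, mul_assoc, ← mul_assoc (star w), hwc]
  obtain ⟨U, hU1, hU2, hU3, hU4, hU5⟩ := lemmaU hQ hcl hc hyc (η := 1 / 12) (by norm_num)
  have hUQ : star U * Q = Q := by nth_rewrite 1 [← hU3]; rw [← mul_assoc, hU1, one_mul]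
  have hQU : Q * star U = Q := by nth_rewrite 1 [← hU4]; rw [mul_assoc, hU2, mul_one]
  have hQq : Q * q = 0 := by
    have := congrArg star hqQ; simpa [hQ, hqs] using this
  obtain ⟨T, hT⟩ : ∃ T, T = star U * w := ⟨_, rfl⟩
  have hTn : ‖T‖ ≤ 1 := by
    rw [hT]
    refine (norm_mul_le _ _).trans ?_
    rw [norm_star]
    exact mul_le_one₀ (unitary_norm hU1) (norm_nonneg _) hw
  have hTT : star T * T = star w * w := by
    rw [hT, star_mul, star_star]
    calc _ = star w * (U * star U) * w := by simp only [mul_assoc]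
      _ = _ := by rw [hU2, mul_one]
  have hTTq : star T * T * q = q := by
    rw [hTT]; nth_rewrite 1 [← hcq]; rw [← mul_assoc, hwc, hcq]
  have hTTp : star T * T * p = p := by
    nth_rewrite 1 [← hqp]; rw [← mul_assoc, hTTq, hqp]
  have hTq : ‖T * q - q‖ ≤ 1 / 12 := by
    have : T * q - q = - (star U * (U * c - w * c) * q) := by
      rw [mul_sub, ← mul_assoc, hU1, one_mul, sub_mul, hcq, ← mul_assoc, mul_assoc (star U * w), hcq, ← hT]
      abel
    rw [this, norm_neg]
    have hq' := norm_le_one_of hq hq1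
    have hu' : ‖star U‖ ≤ 1 := by rw [norm_star]; exact unitary_norm hU1
    calc _ ≤ ‖star U * (U * c - w * c)‖ * ‖q‖ := norm_mul_le _ _
      _ ≤ (‖star U‖ * ‖U * c - w * c‖) * ‖q‖ := by gcongr; exact norm_mul_le _ _
      _ ≤ (1 * (1 / 12)) * 1 := by gcongr
      _ = _ := by norm_num
  have hTqT : ‖T * q * star T - q‖ ≤ 1 / 6 := by
    have : T * q * star T - q = (T * q - q) * star T + star (T * q - q) := by
      rw [star_sub, star_mul, hqs]; noncomm_ring
    rw [this]
    calc _ ≤ ‖T * q - q‖ * ‖star T‖ + ‖T * q - q‖ := by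
          refine (norm_add_le _ _).trans ?_
          rw [norm_star (T * q - q)]
          gcongr; exact norm_mul_le _ _
      _ ≤ 1 / 12 * 1 + 1 / 12 := by gcongr; rw [norm_star]; exact hTn
      _ = _ := by norm_num
  obtain ⟨Y, hY⟩ : ∃ Y, Y = T * q + (1 - T * q * star T) * (1 - q) := ⟨_, rfl⟩
  have hY1 : ‖1 - Y‖ < 1 := by
    have : 1 - Y = q * (1 - q) - (T * q - q) + (T * q * star T - q) * (1 - q) := by
      rw [hY]; noncomm_ring
    rw [this]
    have a1 : ‖q * (1 - q)‖ ≤ 1 / 4 := by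
      have e : q * (1 - q) = cfc (fun t : ℝ => t * (1 - t)) q := by
        rw [← fc_mul continuous_id' (by fun_prop), ← fc_sub continuous_const continuous_id', fc_id hq,
          fc_one hq]
      rw [e]
      have hqn := norm_le_one_of hq hq1
      refine fc_norm_le hq (by norm_num) fun t h0 h1 => ?_
      rw [abs_of_nonneg (mul_nonneg h0 (by linarith))]
      nlinarith [sq_nonneg (t - 1 / 2)]
    have a2 : ‖1 - q‖ ≤ 1 := norm_le_one_of (sub_nonneg.2 hq1) (sub_le_self _ hq)
    calc _ ≤ ‖q * (1 - q)‖ + ‖T * q - q‖ + ‖T * q * star T - q‖ * ‖1 - q‖ := by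
          refine (norm_add_le _ _).trans ?_
          gcongr
          · exact norm_sub_le _ _
          · exact norm_mul_le _ _
      _ ≤ 1 / 4 + 1 / 12 + 1 / 6 * 1 := by gcongr
      _ < 1 := by norm_num
  have hYu : IsUnit Y := by
    have := isUnit_one_sub_of_norm_lt_one hY1
    rwa [sub_sub_cancel] at this
  have hTQ : T * Q = Q := by rw [hT, mul_assoc, hwQ, hUQ]
  have hQT : Q * T = Q := by rw [hT, ← mul_assoc, hQU, hQw]
  have hTsQ : star T * Q = Q := by
    have := congrArg star hQT; simpa [hQ] using this
  have hYQ : Y * Q = Q := by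
    rw [hY, add_mul, mul_assoc, hqQ, mul_zero, zero_add, mul_assoc, sub_mul 1 q, hqQ, one_mul, sub_zero,
      sub_mul, one_mul, mul_assoc, hTsQ, mul_assoc, hqQ, mul_zero, sub_zero]
  have hQY : Q * Y = Q := by
    have h8 : Q * (1 - T * q * star T) = Q := by
      rw [mul_sub, mul_one, ← mul_assoc, ← mul_assoc, hQT, hQq, zero_mul, sub_zero]
    rw [hY, mul_add, ← mul_assoc, hQT, hQq, zero_add, ← mul_assoc, h8, mul_sub, hQq, mul_one, sub_zero]
  obtain ⟨V, hV1, hV2, hV3, hV4, -, hV5⟩ := polar (G := Y) hQ ⟨hYu, 1, one_pos, by simpa using hYQ,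
    by simpa using hQY⟩
  have hYp : Y * p = T * p := by
    rw [hY, add_mul, mul_assoc, hqp, mul_assoc, sub_mul 1 q, hqp, one_mul, sub_self, mul_zero, add_zero]
  have hYT : star Y * (T * p) = p := by
    have : star Y = q * star T + (1 - q) * (1 - T * q * star T) := by
      rw [hY]; simp [star_mul, hqs, mul_assoc]
    rw [this, add_mul]
    have b1 : q * star T * (T * p) = p := by
      rw [mul_assoc, ← mul_assoc (star T), hTTp, hqp]
    have b2 : (1 - T * q * star T) * (T * p) = 0 := by
      rw [sub_mul, one_mul, mul_assoc, ← mul_assoc (star T), hTTp, mul_assoc, hqp, sub_self]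
    rw [b1, mul_assoc, b2, mul_zero, add_zero]
  have hVp := hV5 p (by rw [mul_assoc, hYp, hYT])
  refine ⟨U * V, ?_, ?_, ?_, ?_, ?_⟩
  · rw [star_mul, mul_assoc, ← mul_assoc (star U), hU1, one_mul, hV1]
  · rw [star_mul, mul_assoc, ← mul_assoc V, hV2, one_mul, hU2]
  · rw [mul_assoc, hV3, hU3]
  · rw [← mul_assoc, hU4, hV4]
  · rw [mul_assoc, hVp, hYp, hT, ← mul_assoc, ← mul_assoc, hU2, one_mul]

end Generic3

section Generic4
variable {M : Type*} [CStarAlgebra M] [PartialOrder M] [StarOrderedRing M]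

lemma absorb_core {D s q ρ : M} (hD : 0 ≤ D) (hD1 : D ≤ 1) (hs : star s * s = q) (hq1 : q ≤ 1)
    (hDs : D * s = s) (hsD : s * D = 0) (hDρ : D * ρ = 0) (hρD : ρ * D = 0) (hρq : ρ * q = ρ) :
    1 - D + ρ ∈ closure {x : M | IsUnit x} := by
  have hDst := nonneg_sa hD
  have hq0 : 0 ≤ q := hs ▸ star_mul_self_nonneg s
  have hqs := nonneg_sa hq0
  have hss : s * s = 0 := by nth_rewrite 2 [← hDs]; rw [← mul_assoc, hsD, zero_mul]
  have hss' : star s * star s = 0 := by rw [← star_mul, hss, star_zero]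
  have hDs' : star s * D = star s := by
    have := congrArg star hDs; simpa [hDst] using this
  have hsD' : D * star s = 0 := by
    have := congrArg star hsD; simpa [hDst] using this
  obtain ⟨e, he⟩ : ∃ e, e = s * star s := ⟨_, rfl⟩
  have he0 : 0 ≤ e := he ▸ mul_star_self_nonneg s
  have hqe : q * e = 0 := by rw [← hs, he, mul_assoc, ← mul_assoc s, hss, zero_mul, mul_zero]
  have heq : e * q = 0 := by
    have := congrArg star hqe; simpa [nonneg_sa he0, hqs] using this
  obtain ⟨p, hp⟩ : ∃ p, p = q + e := ⟨_, rfl⟩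
  have hp0 : 0 ≤ p := hp ▸ add_nonneg hq0 he0
  have hps := nonneg_sa hp0
  have hqq : q * q ≤ q := by
    have h1 : q * q = cfc (fun t : ℝ => t * t) q := by
      rw [← fc_mul continuous_id' continuous_id', fc_id hq0]
    have h2 := norm_le_one_of hq0 hq1
    rw [h1]
    nth_rewrite 2 [← fc_id hq0]
    refine fc_mono (by fun_prop) (by fun_prop) hq0 fun t h0 h3 => ?_
    nlinarith
  have hee : e * e ≤ e := by
    have h1 : e * e = s * q * star s := by rw [he, ← hs]; simp only [mul_assoc]
    have := conj_mono hq1 (star s)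
    rw [star_star, mul_one] at this
    rw [h1]; exact this.trans_eq he.symm
  have hpp : p * p ≤ p := by
    rw [hp, add_mul, mul_add, mul_add, hqe, heq, add_zero, zero_add]; exact add_le_add hqq hee
  have hpn : ‖p‖ ≤ 1 := by
    have h1 : ‖p * p‖ = ‖p‖ ^ 2 := by
      have := nsq p; rwa [hps] at this
    have h2 := norm_mono (by have := star_mul_self_nonneg p; rwa [hps] at this) hpp
    rw [h1] at h2
    by_contra h; push Not at h; nlinarith
  have hp1 : p ≤ 1 := le_one_of_norm hp0 hpn
  have h1p : 0 ≤ 1 - p := sub_nonneg.2 hp1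
  have h1ps : IsSelfAdjoint (1 - p) := IsSelfAdjoint.of_nonneg h1p
  obtain ⟨Z, hZ⟩ : ∃ Z, Z = s - star s := ⟨_, rfl⟩
  have hZs : star Z = - Z := by rw [hZ]; simp
  have hZZ : Z * Z = - p := by
    rw [hZ, hp, he, ← hs, sub_mul, mul_sub, mul_sub, hss, hss']; abel
  have hpZ : p * Z = Z * p := by
    have : p = - (Z * Z) := by rw [hZZ, neg_neg]
    rw [this]; noncomm_ring
  obtain ⟨C, hC⟩ : ∃ C, C = rt (1 - p) := ⟨_, rfl⟩
  have hC0 : 0 ≤ C := hC ▸ rt_nonneg h1p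
  have hCs := nonneg_sa hC0
  have hCC : C * C = 1 - p := by rw [hC, rt_mul h1p]
  have hCZ : C * Z = Z * C := by
    rw [hC]
    exact intertwine h1ps h1ps (by rw [sub_mul, mul_sub, hpZ]; simp) Real.continuous_sqrt
  have hDp : D * p = e := by
    rw [hp, mul_add, ← hs, he, ← mul_assoc, ← mul_assoc, hsD', hDs]; simp
  have hpD : p * D = e := by
    rw [hp, add_mul, ← hs, he, mul_assoc, mul_assoc, hsD, hDs']; simp
  have hCD : C * D = D * C := by
    rw [hC]
    exact intertwine h1ps h1ps (by rw [sub_mul, mul_sub, hpD, hDp]; simp) Real.continuous_sqrt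
  have hρs : ρ * s = 0 := by rw [← hDs, ← mul_assoc, hρD, zero_mul]
  have hρC : ρ * C = 0 := by
    have h1 : ρ * C * C = 0 := by
      rw [mul_assoc, hCC, hp, mul_sub, mul_add, hρq, he, ← mul_assoc, hρs]; simp
    have h2 : (ρ * C) * star (ρ * C) = 0 := by
      rw [star_mul, hCs, ← mul_assoc, h1, zero_mul]
    exact (CStarRing.mul_star_self_eq_zero_iff _).1 h2
  obtain ⟨n, hn⟩ : ∃ n, n = (1 + ρ) * star s := ⟨_, rfl⟩
  have hnD : n * D = n := by rw [hn, mul_assoc, hDs']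
  have hDn : D * n = 0 := by rw [hn, ← mul_assoc, mul_add, hDρ, mul_one, add_zero, hsD']
  have hW1 : (C + Z) * (C - Z) = 1 := by
    rw [add_mul, mul_sub, mul_sub, hCC, hZZ, hCZ]; abel
  have hW2 : (C - Z) * (C + Z) = 1 := by
    rw [sub_mul, mul_add, mul_add, hCC, hZZ, hCZ]; abel
  have hprod : (1 - D + ρ) * (C + Z) = (1 - D) * C - n := by
    have h1 : (1 - D) * Z = - star s := by
      rw [hZ, sub_mul, one_mul, mul_sub, hsD', hDs]; abel
    have h2 : ρ * Z = - (ρ * star s) := by rw [hZ, mul_sub, hρs]; abel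
    rw [add_mul, mul_add, mul_add, h1, h2, hρC, hn, add_mul, one_mul]; abel
  have hmain : (1 - D) * C - n ∈ closure {x : M | IsUnit x} := by
    refine clos_of_approx fun ε hε => ⟨(1 - D) * C + algebraMap ℝ M ε - n, subset_closure ?_, ?_⟩
    · have hC' : 0 ≤ (1 - D) * C := by
        refine Commute.mul_nonneg (sub_nonneg.2 hD1) hC0 ?_
        show (1 - D) * C = C * (1 - D)
        rw [sub_mul, mul_sub, hCD]; simp
      obtain ⟨B, hB⟩ := pos_add_unit hC' hε
      have hBD : (B : M) * D = D * B := by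
        rw [hB, add_mul, mul_add, Algebra.commutes, mul_assoc, hCD]; congr 1; noncomm_ring
      have hBD' : D * (↑B⁻¹ : M) = ↑B⁻¹ * D := by
        calc D * (↑B⁻¹ : M) = ↑B⁻¹ * (B * D) * ↑B⁻¹ := by rw [← mul_assoc, Units.inv_mul, one_mul]
          _ = _ := by rw [hBD, mul_assoc, mul_assoc, Units.mul_inv, mul_one]
      rw [← hB]
      have h1 : (B : M) - n = B * (-(↑B⁻¹ * n) + algebraMap ℝ M 1) := by
        rw [map_one, mul_add, mul_neg, ← mul_assoc, Units.mul_inv, one_mul, mul_one]; abel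
      show IsUnit ((B : M) - n)
      rw [h1]
      refine B.isUnit.mul (nilp_unit ?_ one_ne_zero)
      rw [neg_mul_neg]
      calc (↑B⁻¹ : M) * n * (↑B⁻¹ * n) = ↑B⁻¹ * (n * D) * (↑B⁻¹ * n) := by rw [hnD]
        _ = ↑B⁻¹ * n * ((D * ↑B⁻¹) * n) := by simp only [mul_assoc]
        _ = 0 := by rw [hBD', mul_assoc (↑B⁻¹ : M) D, hDn]; simp
    · rw [show (1 - D) * C - n - ((1 - D) * C + algebraMap ℝ M ε - n) = - algebraMap ℝ M ε by abel,
        norm_neg]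
      exact norm_alg_le hε.le
  have hfin : 1 - D + ρ = ((1 - D) * C - n) * (C - Z) := by
    rw [← hprod, mul_assoc, hW1, mul_one]
  rw [hfin]
  exact clos_unit_mul hmain (subset_closure ⟨⟨_, _, hW2, hW1⟩, rfl⟩)

def kf (η : ℝ) : ℝ → ℝ := fun t => Real.sqrt (ramp (2 * η) (3 * η) t / max (t - η) η)
lemma kf_cont {η : ℝ} (hη : 0 < η) : Continuous (kf η) := by
  unfold kf
  refine Real.continuous_sqrt.comp ((ramp_cont _ _).div (by fun_prop) fun t => ?_)
  exact (lt_of_lt_of_le hη (le_max_right _ _)).ne'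

lemma kf_mul {η t : ℝ} (hη : 0 < η) : kf η t * cutf η t * kf η t = ramp (2 * η) (3 * η) t := by
  have h0 : 0 ≤ ramp (2 * η) (3 * η) t / max (t - η) η :=
    div_nonneg (ramp_nonneg _ _ _) (hη.le.trans (le_max_right _ _))
  have : kf η t * cutf η t * kf η t = (ramp (2 * η) (3 * η) t / max (t - η) η) * cutf η t := by
    unfold kf
    rw [mul_right_comm, Real.mul_self_sqrt h0]
  rw [this]
  rcases le_total t (2 * η) with h | h
  · rw [ramp_eq_zero (by linarith) h]; simp
  · rw [max_eq_left (by linarith), cutf_eq (by linarith)]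
    exact div_mul_cancel₀ _ (by linarith)

lemma absorb {G D r core : M} (hG : IsUnit G) (hD : 0 ≤ D) (hD1 : D ≤ 1) (hDG : D * G = G * D)
    (hDr : D * r = 0) (hrD : r * D = 0) (hc : 0 ≤ core) (hDc : D * core = core)
    (h : CLE (star r * r) core) : G * (1 - D) + r ∈ closure {x : M | IsUnit x} := by
  refine clos_of_approx fun ε hε => ?_
  obtain ⟨η, hη, hηε⟩ : ∃ η : ℝ, 0 < η ∧ 4 * η ≤ ε ^ 2 := ⟨ε ^ 2 / 4, by positivity, by linarith⟩
  obtain ⟨n, hn⟩ : ∃ n, n = star r * r := ⟨_, rfl⟩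
  have hn0 : 0 ≤ n := hn ▸ star_mul_self_nonneg r
  have hns := IsSelfAdjoint.of_nonneg hn0
  have hnD : n * D = 0 := by rw [hn, mul_assoc, hrD, mul_zero]
  obtain ⟨Y, hY, hYc⟩ := CLE.exact hn0 hc (hn ▸ h) hη
  have hDY : D * Y = Y := clos_one (rt_unit hc hDc) hYc
  have hk0 : kf η 0 = 0 := by
    unfold kf; rw [ramp_eq_zero (by linarith) (by linarith)]; simp
  have kc := kf_cont hη
  have hr0 : ramp (3 * η) (4 * η) 0 = 0 := ramp_eq_zero (by linarith) (by linarith)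
  have hs : star (Y * cfc (kf η) n) * (Y * cfc (kf η) n) = rmp (2 * η) (3 * η) n := by
    rw [star_mul, fc_star]
    calc _ = cfc (kf η) n * (star Y * Y) * cfc (kf η) n := by simp only [mul_assoc]
      _ = _ := by
        rw [hY, cut, fc_mul kc (cutf_cont _), fc_mul (f := fun t => kf η t * cutf η t) (kc.mul (cutf_cont _)) kc, rmp]
        congr 1; funext t; exact kf_mul hη
  obtain ⟨R, hR⟩ : ∃ R, R = rmp (3 * η) (4 * η) n := ⟨_, rfl⟩
  have hRD : R * D = 0 := hR ▸ fc_ann hns hnD (ramp_cont _ _) hr0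
  have hRq : R * rmp (2 * η) (3 * η) n = R := by
    rw [hR, rmp, rmp, fc_mul (ramp_cont _ _) (ramp_cont _ _)]
    congr 1; funext t
    rcases le_total t (3 * η) with h | h
    · rw [ramp_eq_zero (by linarith) h]; simp
    · rw [ramp_eq_one (a := 2 * η) (by linarith) h]; simp
  obtain ⟨u, rfl⟩ := hG
  have hDu : D * (↑u⁻¹ : M) = ↑u⁻¹ * D := by
    calc D * (↑u⁻¹ : M) = ↑u⁻¹ * (u * D) * ↑u⁻¹ := by rw [← mul_assoc, Units.inv_mul, one_mul]
      _ = _ := by rw [← hDG, mul_assoc, mul_assoc, Units.mul_inv, mul_one]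
  have key := absorb_core (ρ := ↑u⁻¹ * (r * R)) hD hD1 hs (rmp_le_one hn0)
    (by rw [← mul_assoc, hDY]) (by rw [mul_assoc, fc_ann hns hnD kc hk0, mul_zero])
    (by rw [← mul_assoc, hDu, mul_assoc, ← mul_assoc D, hDr]; simp)
    (by rw [mul_assoc, mul_assoc, hRD]; simp) (by rw [mul_assoc, mul_assoc, hRq])
  refine ⟨_, clos_unit_mul (subset_closure u.isUnit) key, ?_⟩
  have e : (u : M) * (1 - D) + r - u * (1 - D + ↑u⁻¹ * (r * R)) = r * (1 - R) := by
    rw [mul_add, ← mul_assoc (u : M) (↑u⁻¹ : M), Units.mul_inv, one_mul, mul_sub r, mul_one]; abel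
  rw [e]
  have h2 : ‖r * (1 - R)‖ ^ 2 ≤ ε ^ 2 := by
    rw [← nsq]
    have : star (r * (1 - R)) * (r * (1 - R)) =
        cfc (fun t => (1 - ramp (3 * η) (4 * η) t) * t * (1 - ramp (3 * η) (4 * η) t)) n := by
      have rc := ramp_cont (3 * η) (4 * η)
      rw [← fc_mul (by fun_prop) (by fun_prop), ← fc_mul (by fun_prop) (by fun_prop),
        ← fc_sub (by fun_prop) (by fun_prop), fc_one hn0, fc_id hn0, star_mul, star_sub, star_one,
        hR, rmp_star, ← rmp]
      have h9 : ∀ X : M, X * star r * (r * X) = X * n * X := fun X => by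
        rw [hn]; simp only [mul_assoc]
      exact h9 _
    rw [this]
    refine fc_norm_le hn0 (by positivity) fun t h0 h1 => ?_
    have a1 := ramp_nonneg (3 * η) (4 * η) t
    have a2 := ramp_le_one (3 * η) (4 * η) t
    rcases le_total t (4 * η) with h | h
    · have b1 : 0 ≤ 1 - ramp (3 * η) (4 * η) t := by linarith
      rw [abs_of_nonneg (by positivity)]
      calc _ ≤ 1 * t * 1 := by gcongr <;> linarith
        _ ≤ _ := by linarith
    · rw [ramp_eq_one (by linarith) h]; simp; positivity
  exact le_of_sq_le_sq h2 hε.le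
where
  le_of_sq_le_sq {a b : ℝ} (h : a ^ 2 ≤ b ^ 2) (hb : 0 ≤ b) : a ≤ b := by
    by_contra h'; push Not at h'; nlinarith

end Generic4

section Generic5
variable {M : Type*} [CStarAlgebra M] [PartialOrder M] [StarOrderedRing M]

/-! ### closed right ideals -/

def Rid (H : M) : Set M := closure (Set.range (H * ·))

lemma Rid.self (H : M) : H ∈ Rid H := subset_closure ⟨1, by simp⟩

lemma Rid.mul {H x : M} (h : x ∈ Rid H) (m : M) : x * m ∈ Rid H := by
  refine map_mem_closure (f := fun x : M => x * m) (by fun_prop) h ?_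
  rintro _ ⟨y, rfl⟩
  exact ⟨y * m, by simp [mul_assoc]⟩

lemma Rid.add {H x y : M} (h : x ∈ Rid H) (h' : y ∈ Rid H) : x + y ∈ Rid H := by
  refine map_mem_closure₂ continuous_add h h' ?_
  rintro _ ⟨a, rfl⟩ _ ⟨b, rfl⟩
  exact ⟨a + b, by simp [mul_add]⟩

lemma Rid.zero (H : M) : (0 : M) ∈ Rid H := subset_closure ⟨0, by simp⟩

lemma Rid.neg {H x : M} (h : x ∈ Rid H) : -x ∈ Rid H := by
  simpa using Rid.mul h (-1)

lemma Rid.sub {H x y : M} (h : x ∈ Rid H) (h' : y ∈ Rid H) : x - y ∈ Rid H := by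
  rw [sub_eq_add_neg]; exact Rid.add h (Rid.neg h')

lemma Rid.sum {H : M} {ι : Type*} (s : Finset ι) (f : ι → M) (h : ∀ i ∈ s, f i ∈ Rid H) :
    ∑ i ∈ s, f i ∈ Rid H := by
  classical
  induction s using Finset.induction_on with
  | empty => simpa using Rid.zero H
  | insert a s ha ih =>
    rw [Finset.sum_insert ha]
    exact Rid.add (h _ (by simp)) (ih fun i hi => h i (by simp [hi]))

lemma Rid.trans {x y z : M} (h : x ∈ Rid y) (h' : y ∈ Rid z) : x ∈ Rid z := by
  refine closure_minimal (t := Rid z) ?_ isClosed_closure h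
  rintro _ ⟨m, rfl⟩
  exact Rid.mul h' m

lemma Rid.cle {H X : M} (hH : 0 ≤ H) (hX : 0 ≤ X) (h : X ∈ Rid H) : CLE X H := by
  have h1 : CLE (X * X) H := by
    obtain ⟨g, hg, hlim⟩ := mem_closure_iff_seq_limit.1 h
    have hl : Tendsto (fun n => star (g n) * g n) atTop (𝓝 (X * X)) := by
      have := hlim.star.mul hlim
      rwa [nonneg_sa hX] at this
    refine CLE.of_approx fun ε hε => ?_
    obtain ⟨n, hn⟩ := ((tendsto_iff_norm_sub_tendsto_zero.1 hl).eventually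
      (eventually_lt_nhds hε)).exists
    refine ⟨star (g n) * g n, by rwa [norm_sub_rev], ?_⟩
    obtain ⟨m, hm⟩ := hg n
    rw [← hm]
    have : star (H * m) * (H * m) = star (rt H * m) * H * (rt H * m) := by
      rw [star_mul, star_mul, rt_star, nonneg_sa hH]
      have : rt H * H * rt H = H * H := by
        nth_rewrite 2 [← rt_mul hH]
        rw [← mul_assoc, rt_mul hH, mul_assoc, rt_mul hH]
      calc _ = star m * (H * H) * m := by simp only [mul_assoc]
        _ = _ := by rw [← this]; simp only [mul_assoc]
    show CLE (star (H * m) * (H * m)) H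
    rw [this]
    exact CLE.conj _ _
  refine CLE.of_cut hX fun ε hε => CLE.trans ?_ h1
  have : X * X = cfc (fun t : ℝ => t * t) X := by
    rw [← fc_mul continuous_id' continuous_id', fc_id hX]
  rw [this]
  refine CLE.cfc_le (C := 1 / ε) (cutf_cont _) (by fun_prop) hX (by positivity) fun t h0 _ =>
    ⟨cutf_nonneg _ _, ?_⟩
  rcases le_total t ε with h2 | h2
  · rw [cutf_eq_zero h2]; positivity
  · rw [cutf_eq h2, div_mul_eq_mul_div, one_mul, le_div_iff₀ hε]; nlinarith

/-- `p² ≤ p` gives `p ≤ 1` -/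
lemma le_one_of_sq {p : M} (hp : 0 ≤ p) (h : p * p ≤ p) : p ≤ 1 := by
  refine le_one_of_norm hp ?_
  have h1 : ‖p * p‖ = ‖p‖ ^ 2 := by
    have := nsq p; rwa [nonneg_sa hp] at this
  have h2 := norm_mono (by have := star_mul_self_nonneg p; rwa [nonneg_sa hp] at this) h
  rw [h1] at h2
  by_contra h; push Not at h; nlinarith

lemma sq_le_self {q : M} (hq0 : 0 ≤ q) (hq1 : q ≤ 1) : q * q ≤ q := by
  have h1 : q * q = cfc (fun t : ℝ => t * t) q := by
    rw [← fc_mul continuous_id' continuous_id', fc_id hq0]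
  have h2 := norm_le_one_of hq0 hq1
  rw [h1]
  nth_rewrite 2 [← fc_id hq0]
  refine fc_mono (by fun_prop) (by fun_prop) hq0 fun t h0 h3 => ?_
  nlinarith

lemma orth_comm {a b : M} (ha : 0 ≤ a) (hb : 0 ≤ b) (h : a * b = 0) : b * a = 0 := by
  have := congrArg star h
  simpa [nonneg_sa ha, nonneg_sa hb] using this

lemma orth_add_le_one {a b : M} (ha : 0 ≤ a) (hb : 0 ≤ b) (ha1 : a ≤ 1) (hb1 : b ≤ 1)
    (h : a * b = 0) : a + b ≤ 1 := by
  refine le_one_of_sq (add_nonneg ha hb) ?_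
  rw [add_mul, mul_add, mul_add, h, orth_comm ha hb h, add_zero, zero_add]
  exact add_le_add (sq_le_self ha ha1) (sq_le_self hb hb1)

lemma two_mul_le (x y : M) : star (x + y) * (x + y) ≤ (2 : ℝ) • (star x * x) + (2 : ℝ) • (star y * y) := by
  have := star_mul_self_nonneg (x - y)
  rw [← sub_nonneg]
  convert this using 1
  simp only [star_add, star_sub, add_mul, mul_add, sub_mul, mul_sub, two_smul]; abel

lemma sq_eq {a : M} (ha : 0 ≤ a) : a * a = cfc (fun t : ℝ => t * t) a := by
  rw [← fc_mul continuous_id' continuous_id', fc_id ha]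

/-! ### the abstract data -/

structure CuData (M : Type*) [CStarAlgebra M] [PartialOrder M] [StarOrderedRing M]
    (C : Type*) [AddCommMonoid C] [PartialOrder C] [IsOrderedAddMonoid C] where
  I : AddSubgroup M
  mul_left : ∀ m x : M, x ∈ I → m * x ∈ I
  mul_right : ∀ m x : M, x ∈ I → x * m ∈ I
  star_mem : ∀ x : M, x ∈ I → star x ∈ I
  closed : IsClosed (I : Set M)
  cl : M → C
  nonneg : ∀ x : C, 0 ≤ x
  cl_mono : ∀ a b : M, a ∈ I → 0 ≤ a → b ∈ I → 0 ≤ b → CLE a b → cl a ≤ cl b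
  cl_le : ∀ a b : M, a ∈ I → 0 ≤ a → b ∈ I → 0 ≤ b → cl a ≤ cl b → CLE a b
  cl_zero : cl 0 = 0
  cl_orth : ∀ a b : M, a ∈ I → 0 ≤ a → b ∈ I → 0 ≤ b → a * b = 0 → cl (a + b) = cl a + cl b
  cl_add : ∀ a b : M, a ∈ I → 0 ≤ a → b ∈ I → 0 ≤ b → cl (a + b) ≤ cl a + cl b
  AU : ∀ (k : ℕ) (x y : C), 1 ≤ k → (k + 1) • x ≤ k • y → x ≤ y
  full : ∀ a b : M, a ∈ I → 0 ≤ a → b ∈ I → 0 ≤ b → a ≠ 0 → ∀ ε : ℝ, 0 < ε →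
    ∃ m : ℕ, cl (cut ε b) ≤ m • cl a
  npi : ∃ a b : M, a ∈ I ∧ 0 ≤ a ∧ b ∈ I ∧ 0 ≤ b ∧ a ≠ 0 ∧ ¬ CLE b a
  div : ∀ a : M, a ∈ I → 0 ≤ a → ∀ ε : ℝ, 0 < ε → ∀ N : ℕ, 1 ≤ N →
    ∃ (v : ℕ → M) (β : M) (η : ℝ), 0 < η ∧ β ∈ I ∧ 0 ≤ β ∧ (∀ i, v i ∈ I) ∧
      (∀ i < N, v i ∈ Rid a) ∧ (∀ i < N, ∀ j < N, i ≠ j → star (v i) * v j = 0) ∧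
      (∀ i < N, star (v i) * v i = β) ∧ cl (cut ε a) ≤ (N + 1) • cl (cut η β)

variable {C : Type*} [AddCommMonoid C] [PartialOrder C] [IsOrderedAddMonoid C]

namespace CuData
variable (Δ : CuData M C)

lemma alg_mul_mem (r : ℝ) {x : M} (h : x ∈ Δ.I) : algebraMap ℝ M r * x ∈ Δ.I := Δ.mul_left _ _ h

lemma smul_mem (r : ℝ) {x : M} (h : x ∈ Δ.I) : r • x ∈ Δ.I := by
  rw [Algebra.smul_def]; exact Δ.alg_mul_mem r h

lemma conj_mem {x : M} (h : x ∈ Δ.I) (m : M) : star m * x * m ∈ Δ.I :=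
  Δ.mul_right _ _ (Δ.mul_left _ _ h)

lemma ss_mem {x : M} (h : x ∈ Δ.I) : star x * x ∈ Δ.I := Δ.mul_left _ _ h
lemma ss_mem' {x : M} (h : x ∈ Δ.I) : x * star x ∈ Δ.I := Δ.mul_right _ _ h

lemma Rid_mem {H x : M} (hH : H ∈ Δ.I) (h : x ∈ Rid H) : x ∈ Δ.I := by
  refine closure_minimal (t := (Δ.I : Set M)) ?_ Δ.closed h
  rintro _ ⟨m, rfl⟩
  exact Δ.mul_right _ _ hH

lemma cfc_mem {f : ℝ → ℝ} (hf : Continuous f) (h0 : f 0 = 0) {a : M} (ha : 0 ≤ a) (haI : a ∈ Δ.I) :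
    cfc f a ∈ Δ.I := by
  have : cfc f a ∈ closure (Δ.I : Set M) := by
    rw [Metric.mem_closure_iff]
    intro ε hε
    have hsa := IsSelfAdjoint.of_nonneg ha
    obtain ⟨p, hp, hp'⟩ := poly_approx hf hsa (IsSelfAdjoint.zero M) (ε := ε / 4) (by linarith)
    have e0 : Polynomial.aeval (0 : M) p = algebraMap ℝ M (p.coeff 0) := by
      conv_lhs => rw [← p.divX_mul_X_add]
      simp
    have ec : cfc f (0 : M) = 0 := by rw [cfc_apply_zero, h0, map_zero]
    rw [e0, ec, sub_zero] at hp'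
    refine ⟨Polynomial.aeval a p.divX * a, Δ.mul_left _ _ haI, ?_⟩
    have e1 : Polynomial.aeval a p.divX * a = Polynomial.aeval a p - algebraMap ℝ M (p.coeff 0) := by
      conv_rhs => rw [← p.divX_mul_X_add]
      simp
    rw [dist_eq_norm, e1]
    calc _ = ‖-(Polynomial.aeval a p - cfc f a) + algebraMap ℝ M (p.coeff 0)‖ := by congr 1; abel
      _ ≤ ‖-(Polynomial.aeval a p - cfc f a)‖ + ‖algebraMap ℝ M (p.coeff 0)‖ := norm_add_le _ _
      _ ≤ ε / 4 + ε / 4 := by rw [norm_neg]; gcongr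
      _ < ε := by linarith
  rwa [Δ.closed.closure_eq] at this

lemma cut_mem {ε : ℝ} (hε : 0 ≤ ε) {a : M} (ha : 0 ≤ a) (haI : a ∈ Δ.I) : cut ε a ∈ Δ.I :=
  Δ.cfc_mem (cutf_cont _) (cutf_eq_zero hε) ha haI

lemma rmp_mem {x y : ℝ} (hx : 0 ≤ x) (hxy : x < y) {a : M} (ha : 0 ≤ a) (haI : a ∈ Δ.I) :
    rmp x y a ∈ Δ.I :=
  Δ.cfc_mem (ramp_cont _ _) (ramp_eq_zero hxy hx) ha haI

lemma rt_mem {a : M} (ha : 0 ≤ a) (haI : a ∈ Δ.I) : rt a ∈ Δ.I :=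
  Δ.cfc_mem Real.continuous_sqrt Real.sqrt_zero ha haI

lemma cl_of_le {a b : M} (ha : 0 ≤ a) (hab : a ≤ b) (haI : a ∈ Δ.I) (hbI : b ∈ Δ.I) :
    Δ.cl a ≤ Δ.cl b := Δ.cl_mono _ _ haI ha hbI (ha.trans hab) (CLE.of_le ha hab)

lemma cl_conj {a : M} (ha : 0 ≤ a) (haI : a ∈ Δ.I) (m : M) : Δ.cl (star m * a * m) ≤ Δ.cl a :=
  Δ.cl_mono _ _ (Δ.conj_mem haI m) (conj_nonneg ha m) haI ha (CLE.conj _ _)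

lemma cl_conj' {a : M} (ha : 0 ≤ a) (haI : a ∈ Δ.I) (m : M) : Δ.cl (m * a * star m) ≤ Δ.cl a := by
  simpa using Δ.cl_conj ha haI (star m)

lemma cl_ss {x : M} (h : x ∈ Δ.I) : Δ.cl (x * star x) = Δ.cl (star x * x) :=
  le_antisymm
    (Δ.cl_mono _ _ (Δ.ss_mem' h) (mul_star_self_nonneg _) (Δ.ss_mem h) (star_mul_self_nonneg _) (CLE.ms x))
    (Δ.cl_mono _ _ (Δ.ss_mem h) (star_mul_self_nonneg _) (Δ.ss_mem' h) (mul_star_self_nonneg _) (CLE.sm x))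

lemma cl_smul_le {a : M} (ha : 0 ≤ a) (haI : a ∈ Δ.I) {r : ℝ} (hr : 0 ≤ r) :
    Δ.cl (r • a) ≤ Δ.cl a :=
  Δ.cl_mono _ _ (Δ.smul_mem r haI) (smul_nonneg hr ha) haI ha (CLE.smul_left r hr)

lemma cl_sq {a : M} (ha : 0 ≤ a) (haI : a ∈ Δ.I) : Δ.cl (a * a) ≤ Δ.cl a := by
  refine Δ.cl_mono _ _ (Δ.mul_left _ _ haI) ?_ haI ha ?_
  · have := star_mul_self_nonneg a; rwa [nonneg_sa ha] at this
  · rw [sq_eq ha]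
    exact CLE.cfc_self (by fun_prop) ha (norm_nonneg a) fun t h0 h1 => ⟨by positivity, by gcongr⟩

/-- size of an element -/
def sz (y : M) : C := Δ.cl (star y * y)

lemma sz_star {y : M} (h : y ∈ Δ.I) : Δ.sz (star y) = Δ.sz y := by
  unfold sz; rw [star_star]; exact Δ.cl_ss h

lemma sz_mul_right {y : M} (h : y ∈ Δ.I) (m : M) : Δ.sz (y * m) ≤ Δ.sz y := by
  unfold sz
  have : star (y * m) * (y * m) = star m * (star y * y) * m := by
    rw [star_mul]; simp only [mul_assoc]
  rw [this]
  exact Δ.cl_conj (star_mul_self_nonneg _) (Δ.ss_mem h) m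

lemma sz_mul_left {y : M} (h : y ∈ Δ.I) (m : M) : Δ.sz (m * y) ≤ Δ.sz y := by
  rw [← Δ.sz_star (Δ.mul_left m y h), ← Δ.sz_star h, star_mul]
  exact Δ.sz_mul_right (Δ.star_mem _ h) _

lemma sz_add {x y : M} (hx : x ∈ Δ.I) (hy : y ∈ Δ.I) : Δ.sz (x + y) ≤ Δ.sz x + Δ.sz y := by
  unfold sz
  have px := star_mul_self_nonneg x
  have py := star_mul_self_nonneg y
  refine (Δ.cl_of_le (star_mul_self_nonneg _) (two_mul_le x y) (Δ.ss_mem (Δ.I.add_mem hx hy))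
    (Δ.I.add_mem (Δ.smul_mem _ (Δ.ss_mem hx)) (Δ.smul_mem _ (Δ.ss_mem hy)))).trans ?_
  refine (Δ.cl_add _ _ (Δ.smul_mem _ (Δ.ss_mem hx)) (smul_nonneg zero_le_two px)
    (Δ.smul_mem _ (Δ.ss_mem hy)) (smul_nonneg zero_le_two py)).trans ?_
  exact add_le_add (Δ.cl_smul_le px (Δ.ss_mem hx) zero_le_two)
    (Δ.cl_smul_le py (Δ.ss_mem hy) zero_le_two)

lemma sz_pos_le {a : M} (ha : 0 ≤ a) (haI : a ∈ Δ.I) : Δ.sz a ≤ Δ.cl a := by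
  unfold sz; rw [nonneg_sa ha]; exact Δ.cl_sq ha haI

lemma cl_Rid {H X : M} (hH : 0 ≤ H) (hHI : H ∈ Δ.I) (hX : 0 ≤ X) (h : X ∈ Rid H) :
    Δ.cl X ≤ Δ.cl H :=
  Δ.cl_mono _ _ (Δ.Rid_mem hHI h) hX hHI hH (Rid.cle hH hX h)

lemma cl_sum_orth {ι : Type*} [DecidableEq ι] (s : Finset ι) (f : ι → M) (hI : ∀ i ∈ s, f i ∈ Δ.I)
    (h0 : ∀ i ∈ s, 0 ≤ f i) (ho : ∀ i ∈ s, ∀ j ∈ s, i ≠ j → f i * f j = 0) :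
    Δ.cl (∑ i ∈ s, f i) = ∑ i ∈ s, Δ.cl (f i) := by
  induction s using Finset.induction_on with
  | empty => simpa using Δ.cl_zero
  | insert a s ha ih =>
    rw [Finset.sum_insert ha, Finset.sum_insert ha, ← ih (fun i hi => hI i (by simp [hi]))
      (fun i hi => h0 i (by simp [hi])) (fun i hi j hj => ho i (by simp [hi]) j (by simp [hj]))]
    refine Δ.cl_orth _ _ (hI _ (by simp)) (h0 _ (by simp))
      (Δ.I.sum_mem fun i hi => hI i (by simp [hi])) (Finset.sum_nonneg fun i hi => h0 i (by simp [hi])) ?_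
    rw [Finset.mul_sum]
    exact Finset.sum_eq_zero fun j hj => ho _ (by simp) _ (by simp [hj]) (by rintro rfl; exact ha hj)

/-! ### arithmetic -/

lemma nsmul_le {x y : C} (n : ℕ) (h : x ≤ y) : n • x ≤ n • y := nsmul_le_nsmul_right h n

lemma nsmul_le' (Δ : CuData M C) {x : C} {m n : ℕ} (h : m ≤ n) : m • x ≤ n • x :=
  nsmul_le_nsmul_left (Δ.nonneg x) h

lemma le_add_left' (Δ : CuData M C) (x y : C) : x ≤ y + x := le_add_of_nonneg_left (Δ.nonneg y)
lemma le_add_right' (Δ : CuData M C) (x y : C) : x ≤ x + y := le_add_of_nonneg_right (Δ.nonneg y)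

def Bd (u : C) : Prop := ∀ b : M, b ∈ Δ.I → 0 ≤ b → b ≠ 0 → ∃ k : ℕ, u ≤ k • Δ.cl b

lemma Bd.mono {u v : C} (h : Δ.Bd v) (huv : u ≤ v) : Δ.Bd u := fun b hb h0 hn => by
  obtain ⟨k, hk⟩ := h b hb h0 hn
  exact ⟨k, huv.trans hk⟩

lemma Bd.add {u v : C} (h : Δ.Bd u) (h' : Δ.Bd v) : Δ.Bd (u + v) := fun b hb h0 hn => by
  obtain ⟨k, hk⟩ := h b hb h0 hn
  obtain ⟨k', hk'⟩ := h' b hb h0 hn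
  exact ⟨k + k', by rw [add_nsmul]; exact add_le_add hk hk'⟩

lemma Bd.nsmul {u : C} (h : Δ.Bd u) (n : ℕ) : Δ.Bd (n • u) := fun b hb h0 hn => by
  obtain ⟨k, hk⟩ := h b hb h0 hn
  exact ⟨n * k, by rw [mul_nsmul']; exact nsmul_le n hk⟩

lemma Bd.cut {b : M} (hb : b ∈ Δ.I) (h0 : 0 ≤ b) {ε : ℝ} (hε : 0 < ε) : Δ.Bd (Δ.cl (cut ε b)) :=
  fun a ha ha0 hn => Δ.full a b ha ha0 hb h0 hn ε hε

lemma fin {b : M} (hb : b ∈ Δ.I) (h0 : 0 ≤ b) (hB : Δ.Bd (Δ.cl b)) (h : 3 • Δ.cl b ≤ Δ.cl b) :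
    b = 0 := by
  by_contra hne
  set u := Δ.cl b
  have hj : ∀ k : ℕ, (2 * k + 1) • u ≤ u := by
    intro k
    induction k with
    | zero => simp
    | succ k ih =>
      calc (2 * (k + 1) + 1) • u = 2 • u + (2 * k + 1) • u := by rw [← add_nsmul]; congr 1; ring
        _ ≤ 2 • u + u := by gcongr
        _ = 3 • u := by rw [← succ_nsmul]
        _ ≤ u := h
  obtain ⟨a0, b0, ha, ha0, hbI, hb0, han, hnle⟩ := Δ.npi
  refine hnle (CLE.of_cut hb0 fun ε hε => ?_)
  refine Δ.cl_le _ _ (Δ.cut_mem hε.le hb0 hbI) (cut_nonneg hb0) ha ha0 ?_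
  obtain ⟨m, hm⟩ := Δ.full b b0 hb h0 hbI hb0 hne ε hε
  obtain ⟨k, hk⟩ := hB a0 ha ha0 han
  refine Δ.AU (k + 1) _ _ (by omega) ?_
  calc (k + 1 + 1) • Δ.cl (Paper.cut ε b0) ≤ (k + 1 + 1) • (m • u) := nsmul_le _ hm
    _ = ((k + 2) * m) • u := by rw [← mul_nsmul']
    _ ≤ (2 * ((k + 2) * m) + 1) • u := Δ.nsmul_le' (by omega)
    _ ≤ u := hj _
    _ ≤ k • Δ.cl a0 := hk
    _ ≤ _ := Δ.nsmul_le' (by omega)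

lemma canc {b l : M} (hb : b ∈ Δ.I) (h0 : 0 ≤ b) (hB : Δ.Bd (Δ.cl b)) (hl : l ∈ Δ.I) (hl0 : 0 ≤ l)
    (h : 3 • Δ.cl b ≤ Δ.cl l + Δ.cl b) : Δ.cl b ≤ Δ.cl l := by
  by_cases hn : l = 0
  · rw [hn, Δ.cl_zero, zero_add] at h
    rw [Δ.fin hb h0 hB h, Δ.cl_zero]; exact Δ.nonneg _
  obtain ⟨m, hm⟩ := hB l hl hl0 hn
  set u := Δ.cl b
  set v := Δ.cl l
  have hj : ∀ k : ℕ, (2 * k + 1) • u ≤ k • v + u := by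
    intro k
    induction k with
    | zero => simp
    | succ k ih =>
      calc (2 * (k + 1) + 1) • u = 2 • u + (2 * k + 1) • u := by rw [← add_nsmul]; congr 1; ring
        _ ≤ 2 • u + (k • v + u) := by gcongr
        _ = 3 • u + k • v := by
          rw [show 3 • u = 2 • u + u from succ_nsmul u 2]; abel
        _ ≤ (v + u) + k • v := by gcongr
        _ = _ := by rw [succ_nsmul]; abel
  have hm' : u ≤ (m + 1) • v := hm.trans (Δ.nsmul_le' (by omega))
  refine Δ.AU (2 * (m + 1)) _ _ (by omega) ?_
  calc (2 * (m + 1) + 1) • u ≤ (m + 1) • v + u := hj _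
    _ ≤ (m + 1) • v + (m + 1) • v := by gcongr
    _ = _ := by rw [← add_nsmul]; congr 1; ring

/-- smallness conversion -/
lemma small (Δ : CuData M C) {x y : C} {k c : ℕ} (hk : 1 ≤ k) (h : (c * (k + 1)) • x ≤ k • y) : c • x ≤ y := by
  refine Δ.AU k _ _ hk ?_
  rw [← mul_nsmul', mul_comm]; exact h

end CuData
end Generic5

section Generic6
variable {M : Type*} [CStarAlgebra M] [PartialOrder M] [StarOrderedRing M]
variable {C : Type*} [AddCommMonoid C] [PartialOrder C] [IsOrderedAddMonoid C]

lemma Rid_one {H x d : M} (hd : d * H = H) (h : x ∈ Rid H) : d * x = x := clos_one hd h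
lemma Rid_zero {H x d : M} (hd : d * H = 0) (h : x ∈ Rid H) : d * x = 0 := clos_zero hd h

lemma CuData.liftU (Δ : CuData M C) {H w Q c c2 qh p g b : M}
    (hQ : star Q = Q) (hw : ‖w‖ ≤ 1) (hwQ : w * Q = Q) (hQw : Q * w = Q)
    (hQH : Q * H = 0) (hwH : star w * w * H = H)
    (hc : 0 ≤ c) (hc1 : c ≤ 1) (hcI : c ∈ Δ.I) (hcH : c ∈ Rid H)
    (hc2 : 0 ≤ c2) (hc21 : c2 ≤ 1) (hcc : c * c2 = c2)
    (hq : 0 ≤ qh) (hq1 : qh ≤ 1) (hcq : c2 * qh = qh) (hqp : qh * p = p)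
    (hg : 0 ≤ g) (hgI : g ∈ Δ.I) (hgH : g ∈ Rid H) (hcg : c2 * g = 0)
    (hb : 0 ≤ b) (hbI : b ∈ Δ.I) (hB : Δ.Bd (Δ.cl b)) (hcb : Δ.cl c ≤ Δ.cl b)
    (hgb : 3 • Δ.cl b ≤ Δ.cl g) :
    ∃ P : M, star P * P = 1 ∧ P * star P = 1 ∧ P * Q = Q ∧ Q * P = Q ∧ P * p = w * p := by
  have hcs := nonneg_sa hc
  have hc2s := nonneg_sa hc2
  have hgs := nonneg_sa hg
  have hwc : star w * w * c = c := Rid_one hwH hcH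
  have hQc : Q * c = 0 := Rid_zero hQH hcH
  have hQg : Q * g = 0 := Rid_zero hQH hgH
  have hQc2 : Q * c2 = 0 := by rw [← hcc, ← mul_assoc, hQc, zero_mul]
  have hQqh : Q * qh = 0 := by rw [← hcq, ← mul_assoc, hQc2, zero_mul]
  have hcQ : c * Q = 0 := by have := congrArg star hQc; simpa [hQ, hcs] using this
  have hc2Q : c2 * Q = 0 := by have := congrArg star hQc2; simpa [hQ, hc2s] using this
  have hqhQ : qh * Q = 0 := by have := congrArg star hQqh; simpa [hQ, nonneg_sa hq] using this
  have hwc2 : star w * w * c2 = c2 := by rw [← hcc, ← mul_assoc, hwc]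
  have hwsQ : star w * Q = Q := by have := congrArg star hQw; simpa [hQ] using this
  obtain ⟨f, hf⟩ : ∃ f, f = w * c * star w := ⟨_, rfl⟩
  have hf0 : 0 ≤ f := by
    rw [hf]; have := conj_nonneg hc (star w); rwa [star_star] at this
  have hfs := nonneg_sa hf0
  have hfI : f ∈ Δ.I := hf ▸ Δ.mul_right _ _ (Δ.mul_left _ _ hcI)
  have hf1 : f ≤ 1 := by
    have := conj_mono hc1 (star w)
    rw [star_star, ← hf, mul_one] at this
    refine this.trans (le_one_of_norm (mul_star_self_nonneg _) ?_)
    rw [nsq']; exact pow_le_one₀ (norm_nonneg _) hw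
  have hfQ : f * Q = 0 := by rw [hf, mul_assoc, hwsQ, mul_assoc, hcQ, mul_zero]
  have hQf : Q * f = 0 := by have := congrArg star hfQ; simpa [hQ, hfs] using this
  have h1fs : star (1 - f) = 1 - f := by simp [hfs]
  have h1f0 : 0 ≤ 1 - f := sub_nonneg.2 hf1
  obtain ⟨G, hG⟩ : ∃ G, G = rt g := ⟨_, rfl⟩
  have hGs : star G = G := hG ▸ rt_star g
  have hGG : G * G = g := by rw [hG, rt_mul hg]
  have hGI : G ∈ Δ.I := hG ▸ Δ.rt_mem hg hgI
  have hQG : Q * G = 0 := hG ▸ rt_ann hg hQg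
  have hGQ : G * Q = 0 := by have := congrArg star hQG; simpa [hQ, hGs] using this
  have hc2G : c2 * G = 0 := hG ▸ rt_ann hg hcg
  obtain ⟨y, hy⟩ : ∃ y, y = G * (1 - f) := ⟨_, rfl⟩
  have hyI : y ∈ Δ.I := hy ▸ Δ.mul_right _ _ hGI
  -- comparison
  have key : Δ.cl b ≤ Δ.sz y := by
    refine Δ.canc hbI hb hB (Δ.ss_mem hyI) (star_mul_self_nonneg _) (hgb.trans ?_)
    have e : G = y + G * f := by rw [hy, mul_sub, mul_one]; abel
    have h1 : Δ.cl g = Δ.sz G := by rw [CuData.sz, hGs, hGG]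
    have h2 : Δ.sz G ≤ Δ.sz y + Δ.sz (G * f) := by
      nth_rewrite 1 [e]; exact Δ.sz_add hyI (Δ.mul_right _ _ hGI)
    have h3 : Δ.sz (G * f) ≤ Δ.cl b := by
      refine (Δ.sz_mul_left hfI G).trans ((Δ.sz_pos_le hf0 hfI).trans (le_trans ?_ hcb))
      rw [hf]; exact Δ.cl_conj' hc hcI w
    rw [h1]; exact h2.trans (by gcongr; exact le_rfl)
  have hcle : CLE c (y * star y) := by
    refine Δ.cl_le _ _ hcI hc (Δ.ss_mem' hyI) (mul_star_self_nonneg _) ?_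
    rw [Δ.cl_ss hyI]; exact hcb.trans key
  have hyy : y * star y = G * ((1 - f) * (1 - f)) * G := by
    rw [hy, star_mul, h1fs, hGs]; simp only [mul_assoc]
  have hc3 : 0 ≤ c2 * c2 * c2 := by
    have := conj_nonneg hc2 c2; rwa [hc2s] at this
  have h1fw : (1 - f) * (w * c2) = 0 := by
    have : f * (w * c2) = w * c2 := by
      calc f * (w * c2) = w * c * (star w * w * c2) := by rw [hf]; simp only [mul_assoc]
        _ = w * c2 := by rw [hwc2, mul_assoc, hcc]
    rw [sub_mul, one_mul, this, sub_self]
  have hcl : w * (c2 * c2 * c2) ∈ closure (GLQ Q) := by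
    refine clos_of_approx fun ε hε => ?_
    obtain ⟨r, hr⟩ := hcle ε hε
    obtain ⟨B, hBd⟩ : ∃ B, B = G * r * c2 := ⟨_, rfl⟩
    have hB2 : B * B = 0 := by
      rw [hBd]
      calc G * r * c2 * (G * r * c2) = G * r * (c2 * G) * r * c2 := by simp only [mul_assoc]
        _ = 0 := by rw [hc2G]; simp
    have hBQ : B * Q = 0 := by rw [hBd, mul_assoc, hc2Q, mul_zero]
    have hQB : Q * B = 0 := by rw [hBd, ← mul_assoc, ← mul_assoc, hQG]; simp
    have hQsB : star B * Q = 0 := by have := congrArg star hQB; simpa [hQ] using this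
    obtain ⟨A, hA⟩ : ∃ A, A = w * c2 * star B * (1 - f) := ⟨_, rfl⟩
    have hA2 : A * A = 0 := by
      rw [hA]
      calc _ = w * c2 * star B * ((1 - f) * (w * c2)) * star B * (1 - f) := by simp only [mul_assoc]
        _ = 0 := by rw [h1fw]; simp
    have hAQ : A * Q = 0 := by
      rw [hA, mul_assoc, sub_mul, one_mul, hfQ, sub_zero, mul_assoc, hQsB, mul_zero]
    have hQA : Q * A = 0 := by
      rw [hA, ← mul_assoc, ← mul_assoc, ← mul_assoc, hQw, hQc2]; simp
    refine ⟨A * (1 - f) * B, clos_GLQ_mul (clos_GLQ_mul (clos_GLQ_nilp hA2 hAQ hQA)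
      (clos_GLQ_pos h1f0 zero_le_one ?_ ?_)) (clos_GLQ_nilp hB2 hBQ hQB), ?_⟩
    · rw [sub_mul, hfQ]; simp
    · rw [mul_sub, hQf]; simp
    · have e : w * (c2 * c2 * c2) - A * (1 - f) * B =
          w * c2 * c2 * (c - star r * (y * star y) * r) * c2 := by
        rw [hyy, mul_sub (w * c2 * c2), sub_mul (w * c2 * c2 * c)]
        congr 1
        · rw [mul_assoc _ c c2, hcc]; simp only [mul_assoc]
        · rw [hA, hBd, star_mul, star_mul, hGs, hc2s]; simp only [mul_assoc]
      rw [e]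
      have n2 := norm_le_one_of hc2 hc21
      calc _ ≤ ‖w * c2 * c2 * (c - star r * (y * star y) * r)‖ * ‖c2‖ := norm_mul_le _ _
        _ ≤ (‖w * c2 * c2‖ * ‖c - star r * (y * star y) * r‖) * ‖c2‖ := by
            gcongr; exact norm_mul_le _ _
        _ ≤ ((‖w * c2‖ * ‖c2‖) * ‖c - star r * (y * star y) * r‖) * ‖c2‖ := by
            gcongr; exact norm_mul_le _ _
        _ ≤ (((‖w‖ * ‖c2‖) * ‖c2‖) * ‖c - star r * (y * star y) * r‖) * ‖c2‖ := by
            gcongr; exact norm_mul_le _ _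
        _ ≤ (((1 * 1) * 1) * ε) * 1 := by gcongr
        _ = ε := by ring
  refine lemmaExact hQ hw hwQ hQw hc3 hq hq1 hqhQ ?_ ?_ hqp hcl
  · rw [← mul_assoc, ← mul_assoc, hwc2]
  · rw [mul_assoc, hcq, mul_assoc, hcq, hcq]

/-! ### the elements `Ξ` -/

def Xi (v : ℕ → M) (β : M) (δ : ℝ) (n : ℕ) (f : ℕ → ℝ → ℝ) : M :=
  ∑ i ∈ Finset.range n, v i * cfc (fun t => f i t / max t δ) β * star (v i)

lemma divmax_cont {δ : ℝ} (hδ : 0 < δ) {f : ℝ → ℝ} (hf : Continuous f) :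
    Continuous fun t => f t / max t δ :=
  hf.div (by fun_prop) fun t => (lt_of_lt_of_le hδ (le_max_right _ _)).ne'

section
variable {v : ℕ → M} {β : M} {δ : ℝ} {n : ℕ} {f g : ℕ → ℝ → ℝ}

lemma Xi_mul_v (hβ : 0 ≤ β) (ho : ∀ i < n, ∀ j < n, i ≠ j → star (v i) * v j = 0)
    (hv : ∀ i < n, star (v i) * v i = β) (hδ : 0 < δ) (hf : ∀ i, Continuous (f i))
    (hf0 : ∀ i t, t ≤ δ → f i t = 0) {j : ℕ} (hj : j < n) :
    Xi v β δ n f * v j = v j * cfc (f j) β := by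
  unfold Xi
  rw [Finset.sum_mul, Finset.sum_eq_single j]
  · rw [mul_assoc, hv j hj, mul_assoc]
    congr 1
    have e : cfc (fun t => f j t / max t δ) β * β =
        cfc (fun t => f j t / max t δ) β * cfc (fun t : ℝ => t) β := by rw [fc_id hβ]
    rw [e, fc_mul (divmax_cont hδ (hf j)) continuous_id']
    congr 1
    funext t
    rcases le_total t δ with h | h
    · rw [hf0 j t h]; simp
    · rw [max_eq_left h, div_mul_cancel₀ _ (by linarith)]
  · intro i hi hij
    rw [mul_assoc, ho i (Finset.mem_range.1 hi) j hj hij, mul_zero]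
  · intro h; exact absurd (Finset.mem_range.2 hj) h

lemma Xi_mul (hβ : 0 ≤ β) (ho : ∀ i < n, ∀ j < n, i ≠ j → star (v i) * v j = 0)
    (hv : ∀ i < n, star (v i) * v i = β) (hδ : 0 < δ) (hf : ∀ i, Continuous (f i))
    (hg : ∀ i, Continuous (g i))
    (hf0 : ∀ i t, t ≤ δ → f i t = 0) :
    Xi v β δ n f * Xi v β δ n g = Xi v β δ n (fun i t => f i t * g i t) := by
  conv_lhs => rw [Xi.eq_def v β δ n g]
  rw [Finset.mul_sum, Xi.eq_def v β δ n (fun i t => f i t * g i t)]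
  refine Finset.sum_congr rfl fun i hi => ?_
  rw [← mul_assoc, ← mul_assoc, Xi_mul_v hβ ho hv hδ hf hf0 (Finset.mem_range.1 hi), mul_assoc (v i),
    fc_mul (hf i) (divmax_cont hδ (hg i))]
  congr 3; funext t; ring

lemma Xi_nonneg (hβ : 0 ≤ β) (hδ : 0 < δ) (h : ∀ i t, 0 ≤ f i t) : 0 ≤ Xi v β δ n f := by
  refine Finset.sum_nonneg fun i _ => ?_
  have := conj_nonneg (a := cfc (fun t => f i t / max t δ) β)
    (fc_nonneg hβ fun t _ => div_nonneg (h i t) (hδ.le.trans (le_max_right _ _))) (star (v i))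
  rwa [star_star] at this

lemma Xi_sub (hδ : 0 < δ) (hf : ∀ i, Continuous (f i)) (hg : ∀ i, Continuous (g i)) :
    Xi v β δ n f - Xi v β δ n g = Xi v β δ n (fun i t => f i t - g i t) := by
  unfold Xi
  rw [← Finset.sum_sub_distrib]
  refine Finset.sum_congr rfl fun i _ => ?_
  rw [← sub_mul, ← mul_sub, fc_sub (divmax_cont hδ (hf i)) (divmax_cont hδ (hg i))]
  congr 3; funext t; ring

lemma Xi_le (hβ : 0 ≤ β) (hδ : 0 < δ) (hf : ∀ i, Continuous (f i)) (hg : ∀ i, Continuous (g i))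
    (h : ∀ i t, f i t ≤ g i t) : Xi v β δ n f ≤ Xi v β δ n g := by
  rw [← sub_nonneg, Xi_sub hδ hg hf]
  exact Xi_nonneg hβ hδ fun i t => sub_nonneg.2 (h i t)

lemma Xi_le_one (hβ : 0 ≤ β) (ho : ∀ i < n, ∀ j < n, i ≠ j → star (v i) * v j = 0)
    (hv : ∀ i < n, star (v i) * v i = β) (hδ : 0 < δ) (hf : ∀ i, Continuous (f i))
    (hf0 : ∀ i t, t ≤ δ → f i t = 0) (h0 : ∀ i t, 0 ≤ f i t) (h1 : ∀ i t, f i t ≤ 1) :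
    Xi v β δ n f ≤ 1 := by
  refine le_one_of_sq (Xi_nonneg hβ hδ h0) ?_
  rw [Xi_mul hβ ho hv hδ hf hf hf0]
  exact Xi_le hβ hδ (fun i => (hf i).mul (hf i)) hf fun i t => mul_le_of_le_one_left (h0 i t) (h1 i t)

lemma Xi_Rid {H : M} (hv : ∀ i < n, v i ∈ Rid H) : Xi v β δ n f ∈ Rid H :=
  Rid.sum _ _ fun i hi => Rid.mul (Rid.mul (hv i (Finset.mem_range.1 hi)) _) _

lemma Xi_mul_zero {x : M} (h : ∀ i < n, star (v i) * x = 0) : Xi v β δ n f * x = 0 := by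
  unfold Xi
  rw [Finset.sum_mul]
  refine Finset.sum_eq_zero fun i hi => ?_
  rw [mul_assoc, h i (Finset.mem_range.1 hi), mul_zero]

lemma Xi_cl (Δ : CuData M C) (hβ : 0 ≤ β) (hvI : ∀ i, v i ∈ Δ.I)
    (ho : ∀ i < n, ∀ j < n, i ≠ j → star (v i) * v j = 0)
    (hv : ∀ i < n, star (v i) * v i = β) (hδ : 0 < δ) (hf : ∀ i, Continuous (f i))
    (hf0 : ∀ i t, t ≤ δ → f i t = 0) (h0 : ∀ i t, 0 ≤ f i t) :
    Δ.cl (Xi v β δ n f) = ∑ i ∈ Finset.range n, Δ.cl (cfc (f i) β) := by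
  have hpos : ∀ i, 0 ≤ cfc (fun t => f i t / max t δ) β := fun i =>
    fc_nonneg hβ fun t _ => div_nonneg (h0 i t) (hδ.le.trans (le_max_right _ _))
  unfold Xi
  rw [Δ.cl_sum_orth]
  · refine Finset.sum_congr rfl fun i hi => ?_
    obtain ⟨s, hs⟩ : ∃ s, s = rt (cfc (fun t => f i t / max t δ) β) := ⟨_, rfl⟩
    have hss : s * s = cfc (fun t => f i t / max t δ) β := by rw [hs, rt_mul (hpos i)]
    have hst : star s = s := hs ▸ rt_star _
    have hcomm : s * β = β * s := by
      rw [hs, rt, ← intertwine (S := cfc (fun t => f i t / max t δ) β) (fc_sa _ _) (fc_sa _ _) _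
        Real.continuous_sqrt]
      nth_rewrite 2 [← fc_id hβ]; nth_rewrite 3 [← fc_id hβ]
      exact fc_comm _ _ _
    have e1 : v i * cfc (fun t => f i t / max t δ) β * star (v i) = (v i * s) * star (v i * s) := by
      rw [star_mul, hst, ← hss]; simp only [mul_assoc]
    have e2 : star (v i * s) * (v i * s) = cfc (f i) β := by
      rw [star_mul, hst]
      calc _ = s * (star (v i) * v i) * s := by simp only [mul_assoc]
        _ = β * (s * s) := by rw [hv i (Finset.mem_range.1 hi), hcomm, mul_assoc]
        _ = _ := by
          rw [hss]; nth_rewrite 1 [← fc_id hβ]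
          rw [fc_mul continuous_id' (divmax_cont hδ (hf i))]
          congr 1; funext t
          rcases le_total t δ with h | h
          · rw [hf0 i t h]; simp
          · rw [max_eq_left h, mul_div_cancel₀ _ (by linarith)]
    rw [e1, Δ.cl_ss (Δ.mul_right _ _ (hvI i)), e2]
  · exact fun i _ => Δ.mul_right _ _ (Δ.mul_right _ _ (hvI i))
  · intro i _
    have := conj_nonneg (hpos i) (star (v i))
    rwa [star_star] at this
  · intro i hi j hj hij
    rw [mul_assoc, ← mul_assoc (star (v i)), ← mul_assoc (star (v i)),
      ho i (Finset.mem_range.1 hi) j (Finset.mem_range.1 hj) hij]; simp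

end

end Generic6

section Generic7
variable {M : Type*} [CStarAlgebra M] [PartialOrder M] [StarOrderedRing M]
variable {C : Type*} [AddCommMonoid C] [PartialOrder C] [IsOrderedAddMonoid C]

lemma ramp_mul_ramp {x y d t : ℝ} (hd : 0 < d) (h : x + d ≤ y) :
    ramp x (x + d) t * ramp y (y + d) t = ramp y (y + d) t := by
  rcases le_total t y with h1 | h1
  · rw [ramp_eq_zero (by linarith) h1, mul_zero]
  · rw [ramp_eq_one (by linarith) (by linarith), one_mul]

lemma ramp_anti {x y d t : ℝ} (hd : 0 < d) (h : x ≤ y) :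
    ramp y (y + d) t ≤ ramp x (x + d) t := by
  unfold ramp
  refine max_le_max le_rfl (min_le_min le_rfl ?_)
  rw [show x + d - x = d by ring, show y + d - y = d by ring]
  gcongr

lemma fc_Rid {f : ℝ → ℝ} {δ : ℝ} (hδ : 0 < δ) (hf : Continuous f) (h0 : ∀ t, t ≤ δ → f t = 0) {β : M}
    (hβ : 0 ≤ β) : cfc f β ∈ Rid β := by
  refine subset_closure ⟨cfc (fun t => f t / max t δ) β, ?_⟩
  have e : β * cfc (fun t => f t / max t δ) β =
        cfc (fun t : ℝ => t) β * cfc (fun t => f t / max t δ) β := by rw [fc_id hβ]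
  show β * cfc (fun t => f t / max t δ) β = _
  rw [e, fc_mul continuous_id' (divmax_cont hδ hf)]
  congr 1
  funext t
  rcases le_total t δ with h | h
  · rw [h0 t h]; simp
  · rw [max_eq_left h, mul_div_cancel₀ _ (by linarith)]

lemma CuData.stage (Δ : CuData M C) {n : ℕ} (hn : 1 ≤ n) {ε : ℝ} (hε : 0 < ε) {H w Q : M}
    (hH : 0 ≤ H) (hHI : H ∈ Δ.I) (hB : Δ.Bd (Δ.cl H))
    (hQ : star Q = Q) (hw : ‖w‖ ≤ 1) (hwQ : w * Q = Q) (hQw : Q * w = Q)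
    (hQH : Q * H = 0) (hwH : star w * w * H = H) :
    ∃ P p q q' q'' : M, star P * P = 1 ∧ P * star P = 1 ∧ P * Q = Q ∧ Q * P = Q ∧ P * p = w * p ∧
      0 ≤ p ∧ p ≤ 1 ∧ 0 ≤ q ∧ q ≤ 1 ∧ 0 ≤ q' ∧ q' ≤ 1 ∧ 0 ≤ q'' ∧ q'' ≤ 1 ∧
      p * q = q ∧ q * q' = q' ∧ q' * q'' = q'' ∧ p ∈ Rid H ∧
      (4 * n) • Δ.cl (p - q'') ≤ Δ.cl H ∧ Δ.cl (cut ε H) ≤ 5 • Δ.cl q'' ∧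
      0 ≤ p - q'' ∧ 0 ≤ q - q' ∧ q - q' ≤ p - q'' := by
  obtain ⟨v, β, η, hη, hβI, hβ, hvI, hvH, ho, hv, hcut⟩ := Δ.div H hHI hH ε hε (4 * n) (by omega)
  obtain ⟨δ, hδ⟩ : ∃ δ : ℝ, δ = η / (4 * n + 4) := ⟨_, rfl⟩
  have hδ0 : 0 < δ := by rw [hδ]; positivity
  have hδη : (4 * n + 4) * δ = η := by rw [hδ]; field_simp
  obtain ⟨R, hR⟩ : ∃ R : ℝ → ℝ → ℝ, R = fun x => ramp x (x + δ) := ⟨_, rfl⟩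
  have Rc : ∀ x, Continuous (R x) := fun x => by rw [hR]; exact ramp_cont _ _
  have R0 : ∀ x t, 0 ≤ R x t := fun x t => by rw [hR]; exact ramp_nonneg _ _ _
  have R1 : ∀ x t, R x t ≤ 1 := fun x t => by rw [hR]; exact ramp_le_one _ _ _
  have Rz : ∀ x t, t ≤ x → R x t = 0 := fun x t h => by rw [hR]; exact ramp_eq_zero (by linarith) h
  have Ro : ∀ x t, x + δ ≤ t → R x t = 1 := fun x t h => by rw [hR]; exact ramp_eq_one (by linarith) h
  have Rm : ∀ x y t, x + δ ≤ y → R x t * R y t = R y t := fun x y t h => by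
    rw [hR]; exact ramp_mul_ramp hδ0 h
  have Ra : ∀ x y t, x ≤ y → R y t ≤ R x t := fun x y t h => by
    rw [hR]; exact ramp_anti hδ0 h
  have ho' : ∀ i < n, ∀ j < n, i ≠ j → star (v i) * v j = 0 := fun i hi j hj =>
    ho i (by omega) j (by omega)
  have hv' : ∀ i < n, star (v i) * v i = β := fun i hi => hv i (by omega)
  have hvH' : ∀ i < n, v i ∈ Rid H := fun i hi => hvH i (by omega)
  -- the general element
  obtain ⟨X, hX⟩ : ∃ X : (ℕ → ℝ) → M, X = fun x => Xi v β δ n (fun i => R (x i)) := ⟨_, rfl⟩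
  have Xz : ∀ x : ℕ → ℝ, (∀ i, δ ≤ x i) → ∀ i t, t ≤ δ → R (x i) t = 0 := fun x h i t ht =>
    Rz _ _ (ht.trans (h i))
  have X0 : ∀ x, 0 ≤ X x := fun x => by rw [hX]; exact Xi_nonneg hβ hδ0 fun i t => R0 _ _
  have X1 : ∀ x : ℕ → ℝ, (∀ i, δ ≤ x i) → X x ≤ 1 := fun x h => by
    rw [hX]; exact Xi_le_one hβ ho' hv' hδ0 (fun i => Rc _) (Xz x h) (fun i t => R0 _ _) fun i t => R1 _ _
  have Xm : ∀ x y : ℕ → ℝ, (∀ i, δ ≤ x i) → (∀ i, x i + δ ≤ y i) → X x * X y = X y := fun x y h h' => by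
    rw [hX]
    show Xi v β δ n _ * Xi v β δ n _ = Xi v β δ n _
    rw [Xi_mul hβ ho' hv' hδ0 (fun i => Rc _) (fun i => Rc _) (Xz x h)]
    congr 1; funext i t; exact Rm _ _ _ (h' i)
  have XR : ∀ x, X x ∈ Rid H := fun x => by rw [hX]; exact Xi_Rid hvH'
  have XI : ∀ x, X x ∈ Δ.I := fun x => Δ.Rid_mem hHI (XR x)
  obtain ⟨a, ha⟩ : ∃ a : ℕ → ℝ, a = fun i : ℕ => (4 * (i : ℝ) + 4) * δ := ⟨_, rfl⟩
  have ha4 : ∀ i, 4 * δ ≤ a i := fun i => by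
    rw [ha]; show 4 * δ ≤ (4 * (i : ℝ) + 4) * δ
    have : 0 ≤ (i : ℝ) * δ := by positivity
    linarith
  obtain ⟨V, hV⟩ : ∃ V : Finset ℕ → M, V = fun s => ∑ i ∈ s, v i * star (v i) := ⟨_, rfl⟩
  have V0 : ∀ s, 0 ≤ V s := fun s => by
    rw [hV]; exact Finset.sum_nonneg fun i _ => mul_star_self_nonneg _
  have VR : ∀ s ⊆ Finset.range (4 * n), V s ∈ Rid H := fun s hs => by
    rw [hV]; exact Rid.sum _ _ fun i hi => Rid.mul (hvH i (Finset.mem_range.1 (hs hi))) _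
  have VI : ∀ s, V s ∈ Δ.I := fun s => by
    rw [hV]; exact Δ.I.sum_mem fun i _ => Δ.ss_mem' (hvI i)
  have Vcl : ∀ s ⊆ Finset.range (4 * n), Δ.cl (V s) = s.card • Δ.cl β := fun s hs => by
    rw [hV]
    show Δ.cl (∑ i ∈ s, v i * star (v i)) = _
    rw [Δ.cl_sum_orth _ _ (fun i _ => Δ.ss_mem' (hvI i)) (fun i _ => mul_star_self_nonneg _)]
    · rw [Finset.sum_congr rfl (g := fun _ => Δ.cl β), Finset.sum_const]
      intro i hi
      rw [Δ.cl_ss (hvI i), hv i (Finset.mem_range.1 (hs hi))]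
    · intro i hi j hj hij
      rw [mul_assoc, ← mul_assoc (star (v i)), ho i (Finset.mem_range.1 (hs hi)) j
        (Finset.mem_range.1 (hs hj)) hij]; simp
  have s1 : Finset.Ico n (4 * n) ⊆ Finset.range (4 * n) := fun i hi => by
    simp only [Finset.mem_Ico, Finset.mem_range] at *; omega
  have s2 : Finset.range n ⊆ Finset.range (4 * n) := fun i hi => by
    simp only [Finset.mem_range] at *; omega
  have hbcl : Δ.cl (V (Finset.range n)) = n • Δ.cl β := by rw [Vcl _ s2, Finset.card_range]
  have Rβ : ∀ x, δ ≤ x → Δ.cl (cfc (R x) β) ≤ Δ.cl β := fun x hx =>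
    Δ.cl_Rid hβ hβI (fc_nonneg hβ fun t _ => R0 _ _) (fc_Rid hδ0 (Rc x) (fun t ht => Rz _ _ (ht.trans hx)) hβ)
  obtain ⟨P, hP1, hP2, hPQ, hQP, hPp⟩ := Δ.liftU (H := H) (w := w) (Q := Q) (c := X fun _ => δ)
    (c2 := X fun _ => 2 * δ) (qh := X fun _ => 3 * δ) (p := X a) (g := V (Finset.Ico n (4 * n)))
    (b := V (Finset.range n)) hQ hw hwQ hQw hQH hwH (X0 _) (X1 _ fun _ => le_rfl) (XI _) (XR _)
    (X0 _) (X1 _ fun _ => by linarith) (Xm _ _ (fun _ => le_rfl) fun _ => by linarith)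
    (X0 _) (X1 _ fun _ => by linarith) (Xm _ _ (fun _ => by linarith) fun _ => by linarith)
    (Xm _ _ (fun _ => by linarith) fun i => by have := ha4 i; linarith)
    (V0 _) (VI _) (VR _ s1) (by
      rw [hX]
      refine Xi_mul_zero fun i hi => ?_
      rw [hV]
      show star (v i) * ∑ i ∈ Finset.Ico n (4 * n), v i * star (v i) = 0
      rw [Finset.mul_sum]
      refine Finset.sum_eq_zero fun j hj => ?_
      rw [Finset.mem_Ico] at hj
      rw [← mul_assoc, ho i (by omega) j (by omega) (by omega), zero_mul])
    (V0 _) (VI _) (CuData.Bd.mono Δ hB (Δ.cl_Rid hH hHI (V0 _) (VR _ s2))) (by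
      rw [hbcl, hX, Xi_cl Δ hβ hvI ho' hv' hδ0 (fun i => Rc _) (Xz _ fun _ => le_rfl) fun i t => R0 _ _]
      calc _ ≤ ∑ i ∈ Finset.range n, Δ.cl β := Finset.sum_le_sum fun i _ => Rβ _ le_rfl
        _ = _ := by rw [Finset.sum_const, Finset.card_range])
    (by
      rw [hbcl, Vcl _ s1, Nat.card_Ico, ← mul_nsmul']
      exact Δ.nsmul_le' (by omega))
  have hd : ∀ i, δ ≤ a i := fun i => by have := ha4 i; linarith
  have hpq : X a - X (fun i => a i + 3 * δ) = Xi v β δ n (fun i t => R (a i) t - R (a i + 3 * δ) t) := by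
    rw [hX]
    exact Xi_sub hδ0 (fun i => Rc _) fun i => Rc _
  have hqq : X (fun i => a i + δ) - X (fun i => a i + 2 * δ) =
      Xi v β δ n (fun i t => R (a i + δ) t - R (a i + 2 * δ) t) := by
    rw [hX]
    exact Xi_sub hδ0 (fun i => Rc _) fun i => Rc _
  refine ⟨P, X a, X (fun i => a i + δ), X (fun i => a i + 2 * δ), X (fun i => a i + 3 * δ), hP1, hP2, hPQ, hQP,
    hPp, X0 _, X1 _ hd, X0 _, X1 _ fun i => ?_, X0 _, X1 _ fun i => ?_, X0 _, X1 _ fun i => ?_,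
    Xm _ _ hd fun i => le_rfl, Xm _ _ (fun i => ?_) fun i => ?_, Xm _ _ (fun i => ?_) fun i => ?_, XR _,
    ?_, ?_, ?_, ?_, ?_⟩
  any_goals first | (have := hd i; linarith) | skip
  · -- smallness
    have h1 : Δ.cl (X a - X (fun i => a i + 3 * δ)) ≤ Δ.cl β := by
      have hc : ∀ i, Continuous fun t => R (a i) t - R (a i + 3 * δ) t := fun i => (Rc _).sub (Rc _)
      have hnn : ∀ i t, 0 ≤ R (a i) t - R (a i + 3 * δ) t := fun i t => sub_nonneg.2 (Ra _ _ _ (by linarith))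
      have hzz : ∀ i t, t ≤ δ → R (a i) t - R (a i + 3 * δ) t = 0 := fun i t ht => by
        have := hd i
        rw [Rz _ _ (by linarith), Rz _ _ (by linarith), sub_zero]
      have hRR : ∀ i, cfc (fun t => R (a i) t - R (a i + 3 * δ) t) β ∈ Rid β := fun i =>
        fc_Rid hδ0 (hc i) (hzz i) hβ
      rw [hpq, Xi_cl Δ hβ hvI ho' hv' hδ0 hc hzz hnn, ← Δ.cl_sum_orth]
      · exact Δ.cl_Rid hβ hβI (Finset.sum_nonneg fun i _ => fc_nonneg hβ fun t _ => hnn i t)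
          (Rid.sum _ _ fun i _ => hRR i)
      · exact fun i _ => Δ.Rid_mem hβI (hRR i)
      · exact fun i _ => fc_nonneg hβ fun t _ => hnn i t
      · intro i _ j _ hij
        rw [fc_mul (hc i) (hc j)]
        refine fc_zero hβ fun t _ _ => ?_
        have haa : ∀ i j : ℕ, i < j → a i + 4 * δ ≤ a j := fun i j h => by
          rw [ha]
          have : (i : ℝ) + 1 ≤ j := by exact_mod_cast h
          show (4 * (i : ℝ) + 4) * δ + 4 * δ ≤ (4 * j + 4) * δ
          nlinarith
        have aux : ∀ i j : ℕ, i < j →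
            (R (a i) t - R (a i + 3 * δ) t) * (R (a j) t - R (a j + 3 * δ) t) = 0 := fun i j h => by
          have := haa i j h
          rcases le_total t (a j) with h1 | h1
          · rw [Rz (a j) t h1, Rz (a j + 3 * δ) t (by linarith)]; simp
          · rw [Ro (a i) t (by linarith), Ro (a i + 3 * δ) t (by linarith)]; simp
        rcases lt_or_gt_of_ne hij with h | h
        · exact aux i j h
        · rw [mul_comm]; exact aux j i h
    calc _ ≤ (4 * n) • Δ.cl β := CuData.nsmul_le _ h1
      _ = Δ.cl (V (Finset.range (4 * n))) := by rw [Vcl _ (Finset.Subset.refl _), Finset.card_range]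
      _ ≤ _ := Δ.cl_Rid hH hHI (V0 _) (VR _ (Finset.Subset.refl _))
  · have h2 : n • Δ.cl (cut η β) ≤ Δ.cl (X (fun i => a i + 3 * δ)) := by
      rw [hX, Xi_cl Δ hβ hvI ho' hv' hδ0 (fun i => Rc _) (Xz _ fun i => by have := hd i; linarith)
        fun i t => R0 _ _]
      rw [show n • Δ.cl (cut η β) = ∑ i ∈ Finset.range n, Δ.cl (cut η β) by
        rw [Finset.sum_const, Finset.card_range]]
      refine Finset.sum_le_sum fun i hi => ?_
      refine Δ.cl_mono _ _ (Δ.cut_mem hη.le hβ hβI) (cut_nonneg hβ) ?_ (fc_nonneg hβ fun t _ => R0 _ _) ?_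
      · exact Δ.cfc_mem (Rc _) (Rz _ _ (by have := hd i; linarith)) hβ hβI
      · refine CLE.cfc_le (cutf_cont _) (Rc _) hβ (norm_nonneg β) fun t h0 h1 => ⟨cutf_nonneg _ _, ?_⟩
        rcases le_total t η with h | h
        · rw [cutf_eq_zero h]; exact mul_nonneg (norm_nonneg _) (R0 _ _)
        · rw [cutf_eq h, Ro]
          · linarith
          · refine le_trans ?_ h
            rw [← hδη, ha]
            have : (i : ℝ) + 1 ≤ n := by exact_mod_cast Finset.mem_range.1 hi
            show (4 * (i : ℝ) + 4) * δ + 3 * δ + δ ≤ _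
            nlinarith
    calc _ ≤ (4 * n + 1) • Δ.cl (cut η β) := hcut
      _ ≤ (5 * n) • Δ.cl (cut η β) := Δ.nsmul_le' (by omega)
      _ = 5 • (n • Δ.cl (cut η β)) := by rw [mul_nsmul']
      _ ≤ _ := CuData.nsmul_le _ h2
  · rw [hpq]; exact Xi_nonneg hβ hδ0 fun i t => sub_nonneg.2 (Ra _ _ _ (by linarith))
  · rw [hqq]; exact Xi_nonneg hβ hδ0 fun i t => sub_nonneg.2 (Ra _ _ _ (by linarith))
  · rw [hqq, hpq]
    refine Xi_le hβ hδ0 (fun i => (Rc _).sub (Rc _)) (fun i => (Rc _).sub (Rc _)) fun i t => ?_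
    exact sub_le_sub (Ra _ _ _ (by linarith)) (Ra _ _ _ (by linarith))

end Generic7

section Generic8
variable {M : Type*} [CStarAlgebra M] [PartialOrder M] [StarOrderedRing M]
variable {C : Type*} [AddCommMonoid C] [PartialOrder C] [IsOrderedAddMonoid C]

lemma norm_one_sub_le {p : M} (h0 : 0 ≤ p) (h1 : p ≤ 1) : ‖1 - p‖ ≤ 1 :=
  norm_le_one_of (sub_nonneg.2 h1) (by rw [sub_le_self_iff]; exact h0)

lemma norm_uni_mul_le {P w : M} (hP : P * star P = 1) (hw : ‖w‖ ≤ 1) : ‖star P * w‖ ≤ 1 := by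
  have : ‖star P‖ ≤ 1 := unitary_norm (by rwa [star_star])
  exact (norm_mul_le _ _).trans (mul_le_one₀ this (norm_nonneg _) hw)

lemma CuData.SL (Δ : CuData M C) {n : ℕ} (hn : 1 ≤ n) {ε : ℝ} (hε : 0 < ε) {H w Q : M}
    (hH : 0 ≤ H) (hHI : H ∈ Δ.I) (hB : Δ.Bd (Δ.cl H))
    (hQ : star Q = Q) (hw : ‖w‖ ≤ 1) (hwQ : w * Q = Q) (hQw : Q * w = Q)
    (hQH : Q * H = 0) (hwH : star w * w * H = H) (K : ℕ) :
    ∃ P T E2 E1 E : M, star P * P = 1 ∧ P * star P = 1 ∧ P * Q = Q ∧ Q * P = Q ∧ ‖T‖ ≤ 1 ∧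
      (0 ≤ E2 ∧ E2 ≤ 1) ∧ (0 ≤ E1 ∧ E1 ≤ 1) ∧ (0 ≤ E ∧ E ≤ 1) ∧ E2 ∈ Rid H ∧ E2 * E1 = E1 ∧ E1 * E = E ∧
      star P * w * E2 = E2 ∧ E2 * (star P * w) = E2 ∧
      Q * (T * H * star T) = 0 ∧ E2 * (T * H * star T) = 0 ∧ T * H * star T ∈ Rid H ∧
      1 - E - T ∈ Δ.I ∧ (4 * n) • Δ.sz (1 - E - T) ≤ K • Δ.cl H ∧
      0 ≤ E2 - E1 ∧ (4 * n) • Δ.cl (E2 - E1) ≤ K • Δ.cl H ∧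
      K • Δ.cl (cut ε (T * H * star T)) + 5 • Δ.cl (T * H * star T) ≤ 5 • Δ.cl H := by
  induction K with
  | zero =>
    refine ⟨1, 1, 0, 0, 0, ?_⟩
    have h1 : ‖(1 : M)‖ ≤ 1 := norm_le_one_of zero_le_one le_rfl
    simp [h1, hQH, Rid.zero, Rid.self, CuData.sz, Δ.cl_zero]
  | succ K ih =>
    obtain ⟨P, T, E2, E1, E, hP1, hP2, hPQ, hQP, hT, ⟨h20, h21⟩, ⟨h10, h11⟩, ⟨h00, h01⟩, hE2H, h2E1, h1E,
      hwE, hEw, hQHK, hEHK, hHKR, hYI, hYs, hE0, hEs, hcnt⟩ := ih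
    obtain ⟨HK, hHK⟩ : ∃ HK, HK = T * H * star T := ⟨_, rfl⟩
    rw [← hHK] at hQHK hEHK hHKR hcnt
    have hHK0 : 0 ≤ HK := by
      rw [hHK]; have := conj_nonneg hH (star T); rwa [star_star] at this
    have hHKI : HK ∈ Δ.I := Δ.Rid_mem hHI hHKR
    have hclHK : Δ.cl HK ≤ Δ.cl H := Δ.cl_Rid hH hHI hHK0 hHKR
    have hQE2 : Q * E2 = 0 := Rid_zero hQH hE2H
    have hE2Q : E2 * Q = 0 := by have := congrArg star hQE2; simpa [hQ, nonneg_sa h20] using this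
    obtain ⟨W, hW⟩ : ∃ W, W = star P * w := ⟨_, rfl⟩
    have hWn : ‖W‖ ≤ 1 := hW ▸ norm_uni_mul_le hP2 hw
    have hsPQ : star P * Q = Q := by have := congrArg star hQP; simpa [hQ] using this
    have hWQ : W * Q = Q := by rw [hW, mul_assoc, hwQ, hsPQ]
    have hQsP : Q * star P = Q := by have := congrArg star hPQ; simpa [hQ] using this
    have hQW : Q * W = Q := by rw [hW, ← mul_assoc, hQsP, hQw]
    have hWW : star W * W = star w * w := by
      rw [hW, star_mul, star_star, mul_assoc, ← mul_assoc P, hP2, one_mul]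
    rw [← hW] at hwE hEw
    obtain ⟨P', p, q, q', q'', hP'1, hP'2, hP'Q, hQP', hP'p, hp0, hp1, hq0, hq1, hq'0, hq'1, hq''0, hq''1,
      hpq, hqq', hq'q'', hpR, hps, hcs, hpq0, hqq0, hqqpq⟩ := Δ.stage hn hε (H := HK) (w := W) (Q := Q + E2)
        hHK0 hHKI (CuData.Bd.mono Δ hB hclHK) (by simp [hQ, nonneg_sa h20]) hWn
        (by rw [mul_add, hWQ, hwE]) (by rw [add_mul, hQW, hEw]) (by rw [add_mul, hQHK, hEHK, add_zero])
        (by rw [hWW]; exact Rid_one hwH hHKR)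
    have hpI : p ∈ Δ.I := Δ.Rid_mem hHKI hpR
    have hqR : q ∈ Rid HK := by rw [← hpq]; exact Rid.mul hpR _
    have hq'R : q' ∈ Rid HK := by rw [← hqq']; exact Rid.mul hqR _
    have hq''R : q'' ∈ Rid HK := by rw [← hq'q'']; exact Rid.mul hq'R _
    have hqI : q ∈ Δ.I := Δ.Rid_mem hHKI hqR
    have hq'I : q' ∈ Δ.I := Δ.Rid_mem hHKI hq'R
    have hq''I : q'' ∈ Δ.I := Δ.Rid_mem hHKI hq''R
    have hps' := nonneg_sa hp0
    have hQp : Q * p = 0 := Rid_zero hQHK hpR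
    have hE2p : E2 * p = 0 := Rid_zero hEHK hpR
    have hE2q : E2 * q = 0 := Rid_zero hEHK hqR
    have hE2q' : E2 * q' = 0 := Rid_zero hEHK hq'R
    have hE2q'' : E2 * q'' = 0 := Rid_zero hEHK hq''R
    have hqE2 := orth_comm h20 hq0 hE2q
    have hE1E2 : E1 * E2 = E1 := by
      have := congrArg star h2E1; simpa [nonneg_sa h20, nonneg_sa h10] using this
    have hE2E : E2 * E = E := by rw [← h1E, ← mul_assoc, h2E1]
    have hEE2 : E * E2 = E := by
      have := congrArg star hE2E; simpa [nonneg_sa h20, nonneg_sa h00] using this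
    have hE1q' : E1 * q' = 0 := by rw [← hE1E2, mul_assoc, hE2q', mul_zero]
    have hE1q'' : E1 * q'' = 0 := by rw [← hE1E2, mul_assoc, hE2q'', mul_zero]
    have hEp : E * p = 0 := by rw [← hEE2, mul_assoc, hE2p, mul_zero]
    have hpE : p * E = 0 := orth_comm h00 hp0 hEp
    have hEq'' : E * q'' = 0 := by rw [← hEE2, mul_assoc, hE2q'', mul_zero]
    have hqE1 : q * E1 = 0 := by rw [← h2E1, ← mul_assoc, hqE2, zero_mul]
    have hq'E : q' * E = 0 := by
      rw [← h1E, ← mul_assoc, orth_comm h10 hq'0 hE1q', zero_mul]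
    have hqp : q * p = q := by
      have := congrArg star hpq; simpa [nonneg_sa hq0, hps'] using this
    have hpq' : p * q' = q' := by rw [← hqq', ← mul_assoc, hpq]
    have hpq'' : p * q'' = q'' := by rw [← hq'q'', ← mul_assoc, hpq']
    have hq''p : q'' * p = q'' := by
      have := congrArg star hpq''; simpa [nonneg_sa hq''0, hps'] using this
    have hPQ' : P' * Q = Q ∧ P' * E2 = E2 := by
      have e1 : (Q + E2) * E2 = E2 * E2 := by rw [add_mul, hQE2, zero_add]
      have hE22 : P' * (E2 * E2) = E2 * E2 := by rw [← e1, ← mul_assoc, hP'Q]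
      have hsub : (P' - 1) * E2 = 0 := by
        have : (P' - 1) * (E2 * E2) = 0 := by rw [sub_mul, hE22, one_mul, sub_self]
        have h2 : ((P' - 1) * E2) * star ((P' - 1) * E2) = 0 := by
          rw [star_mul, nonneg_sa h20]
          calc _ = (P' - 1) * (E2 * E2) * star (P' - 1) := by simp only [mul_assoc]
            _ = 0 := by rw [this, zero_mul]
        exact (CStarRing.mul_star_self_eq_zero_iff _).1 h2
      have h3 : P' * E2 = E2 := by
        rw [sub_mul, one_mul, sub_eq_zero] at hsub; exact hsub
      refine ⟨?_, h3⟩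
      rw [mul_add, h3] at hP'Q
      exact add_right_cancel hP'Q
    obtain ⟨hPQ1, hPE2⟩ := hPQ'
    have hP'n : ‖P'‖ ≤ 1 := unitary_norm hP'1
    have hsP'Q : star P' * Q = Q := by
      calc star P' * Q = star P' * (P' * Q) := by rw [hPQ1]
        _ = Q := by rw [← mul_assoc, hP'1, one_mul]
    have hQP1 : Q * P' = Q := by have := congrArg star hsP'Q; simpa [hQ] using this
    have hsP'E2 : star P' * E2 = E2 := by
      calc star P' * E2 = star P' * (P' * E2) := by rw [hPE2]
        _ = E2 := by rw [← mul_assoc, hP'1, one_mul]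
    have hW'p : star P' * W * p = p := by
      rw [mul_assoc, ← hP'p, ← mul_assoc, hP'1, one_mul]
    have hW'q : star P' * W * q = q := by rw [← hpq, ← mul_assoc, hW'p]
    have hW'n : ‖star P' * W‖ ≤ 1 := norm_uni_mul_le hP'2 hWn
    have e0 : star (P * P') * w = star P' * W := by rw [hW, star_mul, mul_assoc]
    have hE2' : 0 ≤ E2 + q := add_nonneg h20 hq0
    have hfix : star P' * W * (E2 + q) = E2 + q := by
      rw [mul_add, hW'q, mul_assoc, hwE, hsP'E2]
    have hHK' : (1 - p) * T * H * star ((1 - p) * T) = (1 - p) * HK * (1 - p) := by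
      rw [star_mul, star_sub, star_one, hps', hHK]; simp only [mul_assoc]
    have hR' : (1 - p) * HK * (1 - p) ∈ Rid HK := by
      refine Rid.mul ?_ _
      rw [sub_mul, one_mul]; exact Rid.sub (Rid.self _) (Rid.mul hpR _)
    have hHK'0 : 0 ≤ (1 - p) * HK * (1 - p) := by
      have := conj_nonneg hHK0 (1 - p); rwa [star_sub, star_one, hps'] at this
    have hHK'I := Δ.Rid_mem hHKI hR'
    have hY' : 1 - (E + q'') - (1 - p) * T = (1 - p) * (1 - E - T) + (p - q'') := by
      have : (1 - p) * (1 - E - T) = 1 - E - p + p * E - (1 - p) * T := by noncomm_ring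
      rw [this, hpE]; abel
    have hE' : (E2 + q) - (E1 + q') = (E2 - E1) + (q - q') := by abel
    refine ⟨P * P', (1 - p) * T, E2 + q, E1 + q', E + q'', ?_, ?_, ?_, ?_, ?_,
      ⟨hE2', orth_add_le_one h20 hq0 h21 hq1 hE2q⟩,
      ⟨add_nonneg h10 hq'0, orth_add_le_one h10 hq'0 h11 hq'1 hE1q'⟩,
      ⟨add_nonneg h00 hq''0, orth_add_le_one h00 hq''0 h01 hq''1 hEq''⟩,
      Rid.add hE2H (Rid.trans hqR hHKR), ?_, ?_, ?_, ?_, ?_, ?_, ?_, ?_, ?_, ?_, ?_, ?_⟩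
    · rw [star_mul, mul_assoc, ← mul_assoc (star P), hP1, one_mul, hP'1]
    · rw [star_mul, mul_assoc, ← mul_assoc P', hP'2, one_mul, hP2]
    · rw [mul_assoc, hPQ1, hPQ]
    · rw [← mul_assoc, hQP, hQP1]
    · exact (norm_mul_le _ _).trans (mul_le_one₀ (norm_one_sub_le hp0 hp1) (norm_nonneg _) hT)
    · rw [add_mul, mul_add, mul_add, h2E1, hE2q', hqE1, hqq']; abel
    · rw [add_mul, mul_add, mul_add, h1E, hE1q'', hq'E, hq'q'']; abel
    · rw [e0, hfix]
    · rw [e0]; exact contr_fix' hW'n hfix (nonneg_sa hE2')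
    · rw [hHK']; exact Rid_zero hQHK hR'
    · rw [hHK', add_mul, Rid_zero hEHK hR', zero_add, ← mul_assoc, ← mul_assoc, mul_sub q, mul_one, hqp]; simp
    · rw [hHK']; exact Rid.trans hR' hHKR
    · rw [hY']; exact Δ.I.add_mem (Δ.mul_left _ _ hYI) (Δ.I.sub_mem hpI hq''I)
    · have hpqI := Δ.I.sub_mem hpI hq''I
      have h1 : Δ.sz (1 - (E + q'') - (1 - p) * T) ≤ Δ.sz (1 - E - T) + Δ.cl (p - q'') := by
        rw [hY']
        exact (Δ.sz_add (Δ.mul_left _ _ hYI) hpqI).trans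
          (add_le_add (Δ.sz_mul_left hYI _) (Δ.sz_pos_le hpq0 hpqI))
      calc _ ≤ (4 * n) • (Δ.sz (1 - E - T) + Δ.cl (p - q'')) := CuData.nsmul_le _ h1
        _ = (4 * n) • Δ.sz (1 - E - T) + (4 * n) • Δ.cl (p - q'') := nsmul_add _ _ _
        _ ≤ K • Δ.cl H + Δ.cl H := add_le_add hYs (hps.trans hclHK)
        _ = _ := (succ_nsmul _ _).symm
    · rw [hE']; exact add_nonneg hE0 hqq0
    · have hpqI := Δ.I.sub_mem hpI hq''I
      have hqqI := Δ.I.sub_mem hqI hq'I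
      have hE1I : E1 ∈ Δ.I := by rw [← h2E1]; exact Δ.mul_right _ _ (Δ.Rid_mem hHI hE2H)
      have h1 : Δ.cl ((E2 + q) - (E1 + q')) ≤ Δ.cl (E2 - E1) + Δ.cl (p - q'') := by
        rw [hE']
        exact (Δ.cl_add _ _ (Δ.I.sub_mem (Δ.Rid_mem hHI hE2H) hE1I) hE0 hqqI hqq0).trans
          (add_le_add le_rfl (Δ.cl_of_le hqq0 hqqpq hqqI hpqI))
      calc _ ≤ (4 * n) • (Δ.cl (E2 - E1) + Δ.cl (p - q'')) := CuData.nsmul_le _ h1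
        _ = (4 * n) • Δ.cl (E2 - E1) + (4 * n) • Δ.cl (p - q'') := nsmul_add _ _ _
        _ ≤ K • Δ.cl H + Δ.cl H := add_le_add hEs (hps.trans hclHK)
        _ = _ := (succ_nsmul _ _).symm
    · rw [hHK']
      have h1 : Δ.cl ((1 - p) * HK * (1 - p)) + Δ.cl q'' ≤ Δ.cl HK := by
        rw [← Δ.cl_orth _ _ hHK'I hHK'0 hq''I hq''0
          (by rw [mul_assoc, sub_mul 1 p q'', one_mul, hpq'', sub_self, mul_zero])]
        exact Δ.cl_Rid hHK0 hHKI (add_nonneg hHK'0 hq''0) (Rid.add hR' hq''R)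
      have h2 : Δ.cl (cut ε ((1 - p) * HK * (1 - p))) ≤ Δ.cl (cut ε HK) := by
        refine Δ.cl_mono _ _ (Δ.cut_mem hε.le hHK'0 hHK'I) (cut_nonneg hHK'0)
          (Δ.cut_mem hε.le hHK0 hHKI) (cut_nonneg hHK0) ?_
        have := CLE.cut_conj hHK0 (norm_one_sub_le hp0 hp1) hε.le
        rwa [star_sub, star_one, hps'] at this
      calc _ ≤ (K + 1) • Δ.cl (cut ε HK) + 5 • Δ.cl ((1 - p) * HK * (1 - p)) := by
            gcongr
        _ = K • Δ.cl (cut ε HK) + (Δ.cl (cut ε HK) + 5 • Δ.cl ((1 - p) * HK * (1 - p))) := by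
            rw [succ_nsmul, add_assoc]
        _ ≤ K • Δ.cl (cut ε HK) + (5 • Δ.cl q'' + 5 • Δ.cl ((1 - p) * HK * (1 - p))) := by
            gcongr
        _ = K • Δ.cl (cut ε HK) + 5 • (Δ.cl ((1 - p) * HK * (1 - p)) + Δ.cl q'') := by
            rw [nsmul_add, add_comm (5 • Δ.cl q'')]
        _ ≤ K • Δ.cl (cut ε HK) + 5 • Δ.cl HK := by gcongr
        _ ≤ _ := hcnt

lemma CuData.SL' (Δ : CuData M C) {N : ℕ} (hN : 1 ≤ N) {ε : ℝ} (hε : 0 < ε) {h w Q : M}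
    (hHI : h * star h ∈ Δ.I) (hB : Δ.Bd (Δ.cl (h * star h)))
    (hQ : star Q = Q) (hw : ‖w‖ ≤ 1) (hwQ : w * Q = Q) (hQw : Q * w = Q)
    (hQH : Q * (h * star h) = 0) (hwH : star w * w * (h * star h) = h * star h) :
    ∃ P E2 E1 E y : M, star P * P = 1 ∧ P * star P = 1 ∧ P * Q = Q ∧ Q * P = Q ∧
      (0 ≤ E2 ∧ E2 ≤ 1) ∧ (0 ≤ E1 ∧ E1 ≤ 1) ∧ (0 ≤ E ∧ E ≤ 1) ∧ E2 ∈ Rid (h * star h) ∧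
      E2 * E1 = E1 ∧ E1 * E = E ∧ star P * w * E2 = E2 ∧ E2 * (star P * w) = E2 ∧
      y ∈ Δ.I ∧ ‖(1 - E) * h - y‖ ≤ ε ∧ N • Δ.sz y ≤ 10 • Δ.cl (h * star h) ∧
      0 ≤ E2 - E1 ∧ N • Δ.cl (E2 - E1) ≤ 10 • Δ.cl (h * star h) := by
  obtain ⟨ε', hε'⟩ : ∃ ε' : ℝ, ε' = ε ^ 2 / 2 := ⟨_, rfl⟩
  have hε'0 : 0 < ε' := by rw [hε']; positivity
  have hH : 0 ≤ h * star h := mul_star_self_nonneg _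
  obtain ⟨P, T, E2, E1, E, hP1, hP2, hPQ, hQP, hT, h2, h1, h0, hE2H, h2E1, h1E,
      hwE, hEw, hQHK, hEHK, hHKR, hYI, hYs, hE0, hEs, hcnt⟩ :=
    Δ.SL (n := N * N) (Nat.mul_pos hN hN) hε'0 hH hHI hB hQ hw hwQ hQw hQH hwH N
  obtain ⟨HK, hHK⟩ : ∃ HK, HK = T * (h * star h) * star T := ⟨_, rfl⟩
  rw [← hHK] at hHKR hcnt
  have hHKe : HK = (T * h) * star (T * h) := by rw [hHK, star_mul]; simp only [mul_assoc]
  have hHK0 : 0 ≤ HK := by rw [hHKe]; exact mul_star_self_nonneg _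
  have hHKI : HK ∈ Δ.I := Δ.Rid_mem hHI hHKR
  have key : ∀ {x : C}, (4 * (N * N)) • x ≤ N • Δ.cl (h * star h) → N • x ≤ Δ.cl (h * star h) := fun {x} hx =>
    Δ.small hN ((Δ.nsmul_le' (by nlinarith)).trans hx)
  have hYI' : (1 - E - T) * h ∈ Δ.I := Δ.mul_right _ _ hYI
  have hrI : rmp ε' (2 * ε') HK ∈ Δ.I := Δ.rmp_mem hε'0.le (by linarith) hHK0 hHKI
  refine ⟨P, E2, E1, E, rmp ε' (2 * ε') HK * (T * h) + (1 - E - T) * h, hP1, hP2, hPQ, hQP, h2, h1, h0, hE2H,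
    h2E1, h1E, hwE, hEw, Δ.I.add_mem (Δ.mul_right _ _ hrI) hYI', ?_, ?_, hE0, ?_⟩
  · have e : (1 - E) * h - (rmp ε' (2 * ε') HK * (T * h) + (1 - E - T) * h) =
        (1 - rmp ε' (2 * ε') HK) * (T * h) := by noncomm_ring
    rw [e]
    have e2 : ((1 - rmp ε' (2 * ε') HK) * (T * h)) * star ((1 - rmp ε' (2 * ε') HK) * (T * h)) =
        cfc (fun t => (1 - ramp ε' (2 * ε') t) * t * (1 - ramp ε' (2 * ε') t)) HK := by
      rw [star_mul, star_sub, star_one, rmp_star]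
      have r1 : (1 : M) - rmp ε' (2 * ε') HK = cfc (fun t => 1 - ramp ε' (2 * ε') t) HK := by
        rw [← fc_sub continuous_const (ramp_cont _ _), fc_one hHK0, rmp]
      have hc : Continuous fun t => 1 - ramp ε' (2 * ε') t := continuous_const.sub (ramp_cont _ _)
      have hc2 : Continuous fun t => (1 - ramp ε' (2 * ε') t) * t := hc.mul continuous_id'
      rw [r1, ← fc_mul hc2 hc, ← fc_mul hc continuous_id', fc_id hHK0, mul_assoc, ← mul_assoc (T * h),
        ← hHKe, mul_assoc]
    have h3 := nsq' ((1 - rmp ε' (2 * ε') HK) * (T * h))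
    rw [e2] at h3
    have h4 : ‖cfc (fun t => (1 - ramp ε' (2 * ε') t) * t * (1 - ramp ε' (2 * ε') t)) HK‖ ≤ 2 * ε' := by
      refine fc_norm_le hHK0 (by linarith) fun t ht0 _ => ?_
      have r0 := ramp_nonneg ε' (2 * ε') t
      have r1 := ramp_le_one ε' (2 * ε') t
      rcases le_total t (2 * ε') with h5 | h5
      · rw [abs_of_nonneg (mul_nonneg (mul_nonneg (by linarith) ht0) (by linarith))]
        calc _ ≤ 1 * (2 * ε') * 1 := by gcongr <;> linarith
          _ = _ := by ring
      · rw [ramp_eq_one (by linarith) h5]; simp; linarith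
    rw [h3, hε'] at h4
    have : 0 ≤ ‖(1 - rmp ε' (2 * ε') HK) * (T * h)‖ := norm_nonneg _
    rw [hε'] at this ⊢
    nlinarith
  · have h5 : Δ.sz (rmp ε' (2 * ε') HK * (T * h)) ≤ Δ.cl (cut ε' HK) := by
      refine (Δ.sz_mul_right hrI _).trans ((Δ.sz_pos_le (rmp_nonneg hHK0) hrI).trans ?_)
      refine Δ.cl_mono _ _ hrI (rmp_nonneg hHK0) (Δ.cut_mem hε'0.le hHK0 hHKI) (cut_nonneg hHK0) ?_
      refine CLE.cfc_le (C := 1 / ε') (ramp_cont _ _) (cutf_cont _) hHK0 (by positivity) fun t _ _ =>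
        ⟨ramp_nonneg _ _ _, ?_⟩
      rcases le_total t ε' with h6 | h6
      · rw [ramp_eq_zero (by linarith) h6, cutf_eq_zero h6, mul_zero]
      · rw [cutf_eq h6, ramp]
        refine max_le (mul_nonneg (by positivity) (by linarith)) ((min_le_right _ _).trans ?_)
        rw [show 2 * ε' - ε' = ε' by ring, one_div, inv_mul_eq_div]
    have h6 : N • Δ.cl (cut ε' HK) ≤ 5 • Δ.cl (h * star h) := (Δ.le_add_right' _ _).trans hcnt
    have h7 : Δ.sz ((1 - E - T) * h) ≤ Δ.sz (1 - E - T) := Δ.sz_mul_right hYI _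
    calc _ ≤ N • (Δ.cl (cut ε' HK) + Δ.sz (1 - E - T)) :=
          CuData.nsmul_le _ ((Δ.sz_add (Δ.mul_right _ _ hrI) hYI').trans (add_le_add h5 h7))
      _ = N • Δ.cl (cut ε' HK) + N • Δ.sz (1 - E - T) := nsmul_add _ _ _
      _ ≤ 5 • Δ.cl (h * star h) + 1 • Δ.cl (h * star h) :=
          add_le_add h6 (by rw [one_nsmul]; exact key hYs)
      _ = 6 • Δ.cl (h * star h) := by rw [← add_nsmul]
      _ ≤ _ := Δ.nsmul_le' (by norm_num)
  · refine (key hEs).trans ?_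
    have := Δ.nsmul_le' (x := Δ.cl (h * star h)) (show 1 ≤ 10 by norm_num)
    rwa [one_nsmul] at this

end Generic8

section Generic9
variable {M : Type*} [CStarAlgebra M] [PartialOrder M] [StarOrderedRing M]
variable {C : Type*} [AddCommMonoid C] [PartialOrder C] [IsOrderedAddMonoid C]

lemma CLE.rmp_cut {ε : ℝ} (hε : 0 < ε) {a : M} (ha : 0 ≤ a) : CLE (rmp ε (2 * ε) a) (cut ε a) := by
  refine CLE.cfc_le (C := 1 / ε) (ramp_cont _ _) (cutf_cont _) ha (by positivity) fun t _ _ =>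
    ⟨ramp_nonneg _ _ _, ?_⟩
  rcases le_total t ε with h6 | h6
  · rw [ramp_eq_zero (by linarith) h6, cutf_eq_zero h6, mul_zero]
  · rw [cutf_eq h6, ramp]
    refine max_le (mul_nonneg (by positivity) (by linarith)) ((min_le_right _ _).trans ?_)
    rw [show 2 * ε - ε = ε by ring, one_div, inv_mul_eq_div]

lemma one_sub_rmp {x y : ℝ} {a : M} (ha : 0 ≤ a) : (1 : M) - rmp x y a = cfc (fun t => 1 - ramp x y t) a := by
  rw [← fc_sub continuous_const (ramp_cont _ _), fc_one ha, rmp]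

lemma one_sub_rmp_conj {ε : ℝ} (hε : 0 < ε) {a : M} (ha : 0 ≤ a) :
    ‖(1 - rmp ε (2 * ε) a) * a * (1 - rmp ε (2 * ε) a)‖ ≤ 2 * ε := by
  have hc : Continuous fun t => 1 - ramp ε (2 * ε) t := continuous_const.sub (ramp_cont _ _)
  have hc2 : Continuous fun t => (1 - ramp ε (2 * ε) t) * t := hc.mul continuous_id'
  have e : (1 - rmp ε (2 * ε) a) * a * (1 - rmp ε (2 * ε) a) =
      cfc (fun t => (1 - ramp ε (2 * ε) t) * t * (1 - ramp ε (2 * ε) t)) a := by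
    rw [← fc_mul hc2 hc, ← fc_mul hc continuous_id', fc_id ha, one_sub_rmp ha]
  rw [e]
  refine fc_norm_le ha (by linarith) fun t ht0 _ => ?_
  have r0 := ramp_nonneg ε (2 * ε) t
  have r1 := ramp_le_one ε (2 * ε) t
  rcases le_total t (2 * ε) with h5 | h5
  · rw [abs_of_nonneg (mul_nonneg (mul_nonneg (by linarith) ht0) (by linarith))]
    calc _ ≤ 1 * (2 * ε) * 1 := by gcongr <;> linarith
      _ = _ := by ring
  · rw [ramp_eq_one (by linarith) h5]; simp; linarith

lemma CuData.step67 (Δ : CuData M C) {hd r D y : M} {τ τ' ε : ℝ} (hτ : 0 < τ) (hτ' : 0 < τ') (hε : 0 < ε)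
    (hd0 : 0 ≤ hd) (hr : r ∈ Δ.I) (hDI : D ∈ Δ.I) (hD0 : 0 ≤ D) (hD1 : D ≤ 1) (hyI : y ∈ Δ.I)
    (hy : D * (hd * hd) * D ≤ (2 : ℝ) • (star y * y) + algebraMap ℝ M τ')
    (hB : Δ.Bd (Δ.sz y + 2 • Δ.sz r))
    (hs : 3 • (Δ.sz y + 2 • Δ.sz r) ≤ Δ.cl (cut τ (D * D))) :
    ∃ g ∈ closure {x : M | IsUnit x}, ‖hd + algebraMap ℝ M ε + r - g‖ ≤ ε + 16 / τ * √(2 * τ') := by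
  obtain ⟨ρ, hρ⟩ : ∃ ρ, ρ = Δ.sz y + 2 • Δ.sz r := ⟨_, rfl⟩
  rw [← hρ] at hB hs
  have hDs := nonneg_sa hD0
  have hds := nonneg_sa hd0
  have hDn := norm_le_one_of hD0 hD1
  obtain ⟨n, hn⟩ : ∃ n, n = hd * hd + star r * r + r * star r := ⟨_, rfl⟩
  have hdd : 0 ≤ hd * hd := by have := star_mul_self_nonneg hd; rwa [hds] at this
  have hn0 : 0 ≤ n := by
    rw [hn]; exact add_nonneg (add_nonneg hdd (star_mul_self_nonneg _)) (mul_star_self_nonneg _)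
  obtain ⟨Θ, hΘ⟩ : ∃ Θ, Θ = D * n * D := ⟨_, rfl⟩
  have hΘ0 : 0 ≤ Θ := by have := conj_nonneg hn0 D; rwa [hDs, ← hΘ] at this
  have hΘI : Θ ∈ Δ.I := by rw [hΘ]; exact Δ.mul_left _ _ hDI
  have hcutΘ : Δ.cl (cut τ' Θ) ≤ ρ := by
    have hA : 0 ≤ (2 : ℝ) • (star y * y) := smul_nonneg zero_le_two (star_mul_self_nonneg _)
    have hAI : (2 : ℝ) • (star y * y) ∈ Δ.I := Δ.smul_mem _ (Δ.ss_mem hyI)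
    have hrD : r * D ∈ Δ.I := Δ.mul_left _ _ hDI
    have hrD' : star r * D ∈ Δ.I := Δ.mul_left _ _ hDI
    have b0 := star_mul_self_nonneg (r * D)
    have c0 := star_mul_self_nonneg (star r * D)
    have h1 : Θ ≤ ((2 : ℝ) • (star y * y) + star (r * D) * (r * D) + star (star r * D) * (star r * D)) +
        algebraMap ℝ M τ' := by
      have e : Θ = D * (hd * hd) * D + star (r * D) * (r * D) + star (star r * D) * (star r * D) := by
        rw [hΘ, hn, star_mul, star_mul, star_star, hDs]; noncomm_ring
      rw [e]
      calc _ ≤ ((2 : ℝ) • (star y * y) + algebraMap ℝ M τ') + star (r * D) * (r * D) +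
            star (star r * D) * (star r * D) := by gcongr
        _ = _ := by abel
    have h2 := CLE.cut_of_le hΘ0 h1
    have hbI := Δ.ss_mem hrD
    have hcI := Δ.ss_mem hrD'
    refine (Δ.cl_mono _ _ (Δ.cut_mem hτ'.le hΘ0 hΘI) (cut_nonneg hΘ0) (Δ.I.add_mem (Δ.I.add_mem hAI hbI) hcI)
      (add_nonneg (add_nonneg hA b0) c0) h2).trans ?_
    refine (Δ.cl_add _ _ (Δ.I.add_mem hAI hbI) (add_nonneg hA b0) hcI c0).trans ?_
    have h3 := Δ.cl_add _ _ hAI hA hbI b0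
    have h4 : Δ.cl ((2 : ℝ) • (star y * y)) ≤ Δ.sz y :=
      Δ.cl_smul_le (star_mul_self_nonneg _) (Δ.ss_mem hyI) zero_le_two
    have h5 : Δ.cl (star (r * D) * (r * D)) ≤ Δ.sz r := Δ.sz_mul_right hr D
    have h6 : Δ.cl (star (star r * D) * (star r * D)) ≤ Δ.sz r := by
      rw [← Δ.sz_star hr]; exact Δ.sz_mul_right (Δ.star_mem _ hr) D
    rw [hρ, two_nsmul, ← add_assoc]
    exact add_le_add (h3.trans (add_le_add h4 h5)) h6
  obtain ⟨g, hg⟩ : ∃ g, g = rmp τ' (2 * τ') Θ := ⟨_, rfl⟩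
  have hg0 : 0 ≤ g := hg ▸ rmp_nonneg hΘ0
  have hg1 : g ≤ 1 := hg ▸ rmp_le_one hΘ0
  have hgI : g ∈ Δ.I := hg ▸ Δ.rmp_mem hτ'.le (by linarith) hΘ0 hΘI
  have h1g : 0 ≤ 1 - g := sub_nonneg.2 hg1
  have h1gs := nonneg_sa h1g
  obtain ⟨D2, hD2⟩ : ∃ D2, D2 = D * (1 - g) * D := ⟨_, rfl⟩
  have hD20 : 0 ≤ D2 := by have := conj_nonneg h1g D; rwa [hDs, ← hD2] at this
  have hD2I : D2 ∈ Δ.I := hD2 ▸ Δ.mul_left _ _ hDI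
  have hDgD : 0 ≤ D * g * D := by have := conj_nonneg hg0 D; rwa [hDs] at this
  have hDgI : D * g * D ∈ Δ.I := Δ.mul_left _ _ hDI
  have hcutI : cut τ' Θ ∈ Δ.I := Δ.cut_mem hτ'.le hΘ0 hΘI
  have hρa : Δ.cl (D * g * D) ≤ Δ.cl (cut τ' Θ) := by
    have h1 := Δ.cl_conj hg0 hgI D
    rw [hDs] at h1
    refine h1.trans (Δ.cl_mono _ _ hgI hg0 hcutI (cut_nonneg hΘ0) ?_)
    rw [hg]; exact CLE.rmp_cut hτ' hΘ0
  obtain ⟨core, hcore⟩ : ∃ core, core = cut τ D2 := ⟨_, rfl⟩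
  have hcore0 : 0 ≤ core := hcore ▸ cut_nonneg hD20
  have hcoreI : core ∈ Δ.I := hcore ▸ Δ.cut_mem hτ.le hD20 hD2I
  have hDD0 : 0 ≤ D * D := by have := star_mul_self_nonneg D; rwa [hDs] at this
  have ht : Δ.cl (cut τ (D * D)) ≤ Δ.cl core + Δ.cl (cut τ' Θ) := by
    have e : D * D = D2 + D * g * D := by rw [hD2]; noncomm_ring
    have h1 := CLE.cut_add hD20 hDgD hτ.le
    rw [← e, ← hcore] at h1
    refine (Δ.cl_mono _ _ (Δ.cut_mem hτ.le hDD0 (Δ.mul_left _ _ hDI)) (cut_nonneg hDD0)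
      (Δ.I.add_mem hcoreI hDgI) (add_nonneg hcore0 hDgD) h1).trans ?_
    exact (Δ.cl_add _ _ hcoreI hcore0 hDgI hDgD).trans (add_le_add le_rfl hρa)
  have hρa2 : Δ.cl (cut τ' Θ) ≤ Δ.cl core := by
    refine Δ.canc hcutI (cut_nonneg hΘ0) (CuData.Bd.mono Δ hB hcutΘ) hcoreI hcore0 ?_
    exact (CuData.nsmul_le 3 hcutΘ).trans (hs.trans ht)
  have hρcore : ρ ≤ Δ.cl core := by
    refine Δ.AU 2 _ _ (by norm_num) ?_
    refine hs.trans (ht.trans ?_)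
    rw [two_nsmul]; exact add_le_add le_rfl hρa2
  -- small norms
  have hsm : ∀ x : M, star x * x ≤ n → ‖x * D2‖ ≤ √(2 * τ') := by
    intro x hx
    have h1 : ‖x * (D * (1 - g))‖ ^ 2 ≤ 2 * τ' := by
      rw [← nsq]
      have e : star (x * (D * (1 - g))) * (x * (D * (1 - g))) = (1 - g) * (D * (star x * x) * D) * (1 - g) := by
        rw [star_mul, star_mul, hDs, h1gs]; simp only [mul_assoc]
      rw [e]
      have h2 : D * (star x * x) * D ≤ Θ := by have := conj_mono hx D; rwa [hDs, ← hΘ] at this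
      have h20 : 0 ≤ D * (star x * x) * D := by
        have := conj_nonneg (star_mul_self_nonneg x) D; rwa [hDs] at this
      have h3 := conj_mono h2 (1 - g)
      have h30 := conj_nonneg h20 (1 - g)
      rw [h1gs] at h3 h30
      refine (norm_mono h30 h3).trans ?_
      rw [hg]; exact one_sub_rmp_conj hτ' hΘ0
    have h4 : x * D2 = x * (D * (1 - g)) * D := by rw [hD2]; simp only [mul_assoc]
    rw [h4]
    refine (norm_mul_le _ _).trans ((mul_le_of_le_one_right (norm_nonneg _) hDn).trans ?_)
    exact Real.le_sqrt_of_sq_le h1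
  obtain ⟨D', hD'⟩ : ∃ D', D' = rmp (τ / 4) (τ / 2) D2 := ⟨_, rfl⟩
  have hD'0 : 0 ≤ D' := hD' ▸ rmp_nonneg hD20
  have hD'1 : D' ≤ 1 := hD' ▸ rmp_le_one hD20
  have hD's := nonneg_sa hD'0
  have h1D' : 0 ≤ 1 - D' := sub_nonneg.2 hD'1
  have h1D's := nonneg_sa h1D'
  have h1D'n : ‖1 - D'‖ ≤ 1 := norm_one_sub_le hD'0 hD'1
  obtain ⟨s, hsd⟩ : ∃ s, s = 4 / τ * √(2 * τ') := ⟨_, rfl⟩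
  have hs0 : 0 ≤ s := by rw [hsd]; positivity
  have hsm' : ∀ x : M, star x * x ≤ n → ‖x * D'‖ ≤ s := by
    intro x hx
    have hτ4 : 0 < τ / 4 := by positivity
    have e : D' = D2 * cfc (fun t => ramp (τ / 4) (τ / 2) t / max t (τ / 4)) D2 := by
      have e1 : D2 * cfc (fun t => ramp (τ / 4) (τ / 2) t / max t (τ / 4)) D2 =
        cfc (fun t : ℝ => t) D2 * cfc (fun t => ramp (τ / 4) (τ / 2) t / max t (τ / 4)) D2 := by rw [fc_id hD20]
      rw [e1, fc_mul continuous_id' (divmax_cont hτ4 (ramp_cont _ _)), hD', rmp]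
      congr 1
      funext t
      rcases le_total t (τ / 4) with h | h
      · rw [ramp_eq_zero (by linarith) h]; simp
      · rw [max_eq_left h, mul_div_cancel₀ _ (by linarith)]
    have h2 : ‖cfc (fun t => ramp (τ / 4) (τ / 2) t / max t (τ / 4)) D2‖ ≤ 4 / τ := by
      refine fc_norm_le hD20 (by positivity) fun t _ _ => ?_
      have hm : τ / 4 ≤ max t (τ / 4) := le_max_right _ _
      rw [abs_div, abs_of_pos (hτ4.trans_le hm), div_le_div_iff₀ (hτ4.trans_le hm) hτ]
      have := ramp_abs_le (τ / 4) (τ / 2) t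
      nlinarith
    rw [e, ← mul_assoc]
    refine (norm_mul_le _ _).trans ?_
    rw [hsd, mul_comm (4 / τ)]
    exact mul_le_mul (hsm x hx) h2 (norm_nonneg _) (Real.sqrt_nonneg _)
  have hcomp : ∀ x : M, star x * x ≤ n → x * star x ≤ n → ‖x - (1 - D') * x * (1 - D')‖ ≤ 2 * s := by
    intro x h1 h2
    have e : x - (1 - D') * x * (1 - D') = x * D' + D' * x * (1 - D') := by noncomm_ring
    rw [e]
    have h3 : ‖D' * x‖ ≤ s := by
      rw [← norm_star, star_mul, hD's]; exact hsm' _ (by rwa [star_star])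
    calc _ ≤ ‖x * D'‖ + ‖D' * x * (1 - D')‖ := norm_add_le _ _
      _ ≤ s + s := add_le_add (hsm' x h1) ((norm_mul_le _ _).trans
          ((mul_le_of_le_one_right (norm_nonneg _) h1D'n).trans h3))
      _ = _ := by ring
  have c1 : hd * hd ≤ n := by
    rw [hn, add_assoc]; exact le_add_of_nonneg_right (add_nonneg (star_mul_self_nonneg _) (mul_star_self_nonneg _))
  have c2 : star r * r ≤ n := by
    rw [hn]; exact (le_add_of_nonneg_left hdd).trans (le_add_of_nonneg_right (mul_star_self_nonneg _))
  have c3 : r * star r ≤ n := by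
    rw [hn]; exact le_add_of_nonneg_left (add_nonneg hdd (star_mul_self_nonneg _))
  obtain ⟨D3, hD3⟩ : ∃ D3, D3 = rmp (τ / 2) τ D2 := ⟨_, rfl⟩
  have hD30 : 0 ≤ D3 := hD3 ▸ rmp_nonneg hD20
  have hD31 : D3 ≤ 1 := hD3 ▸ rmp_le_one hD20
  have hD3s := nonneg_sa hD30
  have hD3D' : D3 * D' = D3 := by
    rw [hD3, hD', rmp, rmp, fc_mul (ramp_cont _ _) (ramp_cont _ _)]
    congr 1; funext t
    rcases le_total t (τ / 2) with h | h
    · rw [ramp_eq_zero (by linarith) h, zero_mul]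
    · rw [ramp_eq_one (a := τ / 4) (by linarith) h, mul_one]
  have hz : D3 * (1 - D') = 0 := by rw [mul_sub, mul_one, hD3D', sub_self]
  have hz' : (1 - D') * D3 = 0 := by
    have := congrArg star hz
    rwa [star_mul, h1D's, hD3s, star_zero] at this
  have hDc : D3 * core = core := by
    rw [hD3, hcore, rmp, cut, fc_mul (ramp_cont _ _) (cutf_cont _)]
    congr 1; funext t
    rcases le_total t τ with h | h
    · rw [cutf_eq_zero h, mul_zero]
    · rw [ramp_eq_one (by linarith) h, one_mul]
  obtain ⟨h', hh'⟩ : ∃ h', h' = (1 - D') * hd * (1 - D') := ⟨_, rfl⟩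
  obtain ⟨r', hr'⟩ : ∃ r', r' = (1 - D') * r * (1 - D') := ⟨_, rfl⟩
  have hh'0 : 0 ≤ h' := by have := conj_nonneg hd0 (1 - D'); rwa [h1D's, ← hh'] at this
  have hr'I : r' ∈ Δ.I := by rw [hr']; exact Δ.mul_right _ _ (Δ.mul_left _ _ hr)
  have e1 : D3 * h' = 0 := by rw [hh', ← mul_assoc, ← mul_assoc, hz]; simp
  have e2 : h' * D3 = 0 := by rw [hh', mul_assoc, hz', mul_zero]
  have e3 : D3 * r' = 0 := by rw [hr', ← mul_assoc, ← mul_assoc, hz]; simp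
  have e4 : r' * D3 = 0 := by rw [hr', mul_assoc, hz', mul_zero]
  have hsr : Δ.sz r' ≤ Δ.cl core := by
    refine le_trans ?_ hρcore
    calc Δ.sz r' ≤ Δ.sz r := by
          rw [hr']; exact (Δ.sz_mul_right (Δ.mul_left _ _ hr) _).trans (Δ.sz_mul_left hr _)
      _ ≤ 2 • Δ.sz r := by rw [two_nsmul]; exact Δ.le_add_right' _ _
      _ ≤ ρ := by rw [hρ]; exact Δ.le_add_left' _ _
  have hab := absorb (G := h' + algebraMap ℝ M ε) (D := D3) (r := r') (core := core) (pos_add_unit hh'0 hε)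
    hD30 hD31 (by rw [mul_add, add_mul, e1, e2, (Algebra.commutes ε D3)]) e3 e4 hcore0 hDc
    (Δ.cl_le _ _ (Δ.ss_mem hr'I) (star_mul_self_nonneg _) hcoreI hcore0 hsr)
  refine ⟨_, hab, ?_⟩
  have e : hd + algebraMap ℝ M ε + r - ((h' + algebraMap ℝ M ε) * (1 - D3) + r') =
      (hd - h') + (r - r') + algebraMap ℝ M ε * D3 := by
    rw [add_mul, mul_sub h', e2]; noncomm_ring
  rw [e]
  calc _ ≤ ‖hd - h'‖ + ‖r - r'‖ + ‖algebraMap ℝ M ε * D3‖ := norm_add₃_le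
    _ ≤ 2 * s + 2 * s + ε := by
      gcongr
      · rw [hh']; exact hcomp hd (by rwa [hds]) (by rwa [hds])
      · rw [hr']; exact hcomp r c2 c3
      · rw [← Algebra.smul_def, norm_smul, Real.norm_of_nonneg hε.le]
        exact mul_le_of_le_one_right hε.le (norm_le_one_of hD30 hD31)
    _ = _ := by rw [hsd]; ring

end Generic9

section Generic10
variable {M : Type*} [CStarAlgebra M] [PartialOrder M] [StarOrderedRing M]
variable {C : Type*} [AddCommMonoid C] [PartialOrder C] [IsOrderedAddMonoid C]

/-- approximate polar decomposition -/
lemma approx_polar (x : M) {s : ℝ} (hs : 0 < s) (hs1 : s ≤ 1) :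
    ∃ w h : M, ‖w‖ ≤ 1 ∧ 0 ≤ h ∧ ‖x - w * h‖ ≤ s ∧ star w * w * h = h ∧ h * h ≤ star x * x ∧
      ‖h‖ ≤ ‖x‖ ∧ ∀ Q : M, x * Q = Q → star x * Q = Q → w * Q = Q := by
  obtain ⟨k, hk⟩ : ∃ k, k = star x * x := ⟨_, rfl⟩
  have hk0 : 0 ≤ k := hk ▸ star_mul_self_nonneg _
  obtain ⟨u, hu⟩ : ∃ u : ℝ → ℝ, u = fun t => 1 / max (√t) s := ⟨_, rfl⟩
  have mpos : ∀ t : ℝ, 0 < max (√t) s := fun t => lt_of_lt_of_le hs (le_max_right _ _)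
  have huc : Continuous u := by
    rw [hu]
    exact continuous_const.div (Real.continuous_sqrt.max continuous_const) fun t => (mpos t).ne'
  obtain ⟨v, hv⟩ : ∃ v : ℝ → ℝ, v = fun t => max (√t - s) 0 := ⟨_, rfl⟩
  have hvc : Continuous v := by rw [hv]; fun_prop
  have huu : ∀ t : ℝ, u t = 1 / max (√t) s := fun t => by rw [hu]
  have hvv : ∀ t : ℝ, v t = max (√t - s) 0 := fun t => by rw [hv]
  have hww : ∀ f : ℝ → ℝ, Continuous f → star (x * cfc f k) * (x * cfc f k) = cfc (fun t => f t * t * f t) k := by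
    intro f hf
    have hc2 : Continuous fun t => f t * t := hf.mul continuous_id'
    rw [star_mul, fc_star, ← fc_mul hc2 hf, ← fc_mul hf continuous_id', fc_id hk0]
    nth_rewrite 4 [hk]; simp only [mul_assoc]
  have huv : Continuous fun t => u t * v t := huc.mul hvc
  have hcase : ∀ t : ℝ, 0 ≤ t → (√t ≤ s ∧ v t = 0 ∧ t ≤ s ^ 2) ∨
      (s ≤ √t ∧ v t = √t - s ∧ u t = 1 / √t ∧ 0 < √t ∧ √t * √t = t) := by
    intro t ht
    have hq := Real.mul_self_sqrt ht
    have hq0 := Real.sqrt_nonneg t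
    rcases le_total (√t) s with h | h
    · left; refine ⟨h, by rw [hvv]; exact max_eq_right (by linarith), by nlinarith⟩
    · right
      exact ⟨h, by rw [hvv]; exact max_eq_left (by linarith), by rw [huu, max_eq_left h], by linarith, hq⟩
  refine ⟨x * cfc u k, cfc v k, ?_, fc_nonneg hk0 fun t _ => by rw [hvv]; exact le_max_right _ _, ?_, ?_, ?_, ?_,
    ?_⟩
  · have h1 := nsq (x * cfc u k)
    rw [hww u huc] at h1
    have h2 : ‖cfc (fun t => u t * t * u t) k‖ ≤ 1 := by
      refine fc_norm_le hk0 zero_le_one fun t ht _ => ?_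
      have hm := mpos t
      have h3 : √t ≤ max (√t) s := le_max_left _ _
      have hq := Real.mul_self_sqrt ht
      have hq0 := Real.sqrt_nonneg t
      rw [huu, abs_of_nonneg (by positivity)]
      rw [show 1 / max (√t) s * t * (1 / max (√t) s) = t / (max (√t) s * max (√t) s) by field_simp]
      rw [div_le_one (by positivity)]; nlinarith
    rw [h1] at h2
    have := norm_nonneg (x * cfc u k)
    nlinarith
  · have e : x - x * cfc u k * cfc v k = x * cfc (fun t => 1 - u t * v t) k := by
      rw [mul_assoc, fc_mul huc hvc, ← fc_sub continuous_const huv, fc_one hk0, mul_sub, mul_one]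
    rw [e]
    have h1 := nsq (x * cfc (fun t => 1 - u t * v t) k)
    have hc1 : Continuous fun t => 1 - u t * v t := continuous_const.sub huv
    rw [hww _ hc1] at h1
    have h2 : ‖cfc (fun t => (1 - u t * v t) * t * (1 - u t * v t)) k‖ ≤ s ^ 2 := by
      refine fc_norm_le hk0 (by positivity) fun t ht _ => ?_
      rcases hcase t ht with ⟨h3, h4, h5⟩ | ⟨h3, h4, h5, h6, h7⟩
      · rw [h4]; simpa [abs_of_nonneg ht] using h5
      · have e2 : 1 - u t * v t = s / √t := by rw [h5, h4]; field_simp; ring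
        rw [e2]
        nth_rewrite 2 [← h7]
        rw [show s / √t * (√t * √t) * (s / √t) = s ^ 2 by field_simp, abs_of_nonneg (by positivity)]
    rw [h1] at h2
    exact le_of_sq_le_sq h2 hs.le
  · have hc2 : Continuous fun t => u t * t * u t := (huc.mul continuous_id').mul huc
    rw [hww u huc, fc_mul hc2 hvc]
    refine fc_congr hk0 fun t ht => ?_
    rcases hcase t ht with ⟨h3, h4, h5⟩ | ⟨h3, h4, h5, h6, h7⟩
    · rw [h4, mul_zero]
    · have : 1 / √t * t * (1 / √t) = 1 := by
        nth_rewrite 2 [← h7]; field_simp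
      rw [h5, this, one_mul]
  · rw [fc_mul hvc hvc, ← hk]
    conv_rhs => rw [← fc_id hk0]
    have hc3 : Continuous fun t => v t * v t := hvc.mul hvc
    refine fc_mono hc3 continuous_id' hk0 fun t ht _ => ?_
    rcases hcase t ht with ⟨h3, h4, h5⟩ | ⟨h3, h4, h5, h6, h7⟩
    · rw [h4]; simpa using ht
    · rw [h4]; nlinarith
  · refine fc_norm_le hk0 (norm_nonneg _) fun t ht ht' => ?_
    have h0 : √t ≤ ‖x‖ := by
      rw [hk, nsq] at ht'
      exact (Real.sqrt_le_left (norm_nonneg _)).2 ht'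
    rw [hvv, abs_of_nonneg (le_max_right _ _)]
    exact max_le (by linarith) (norm_nonneg _)
  · intro Q h1 h2
    have h3 : k * Q = (1 : ℝ) • Q := by rw [hk, mul_assoc, h1, h2, one_smul]
    rw [mul_assoc, fc_eig (IsSelfAdjoint.of_nonneg hk0) h3 huc, huu, Real.sqrt_one, max_eq_left hs1, div_one,
      one_smul, h1]

end Generic10

section Generic11
variable {M : Type*} [CStarAlgebra M] [PartialOrder M] [StarOrderedRing M]
variable {C : Type*} [AddCommMonoid C] [PartialOrder C] [IsOrderedAddMonoid C]

lemma mul_le_of {a b : M} {α β : ℝ} (h : ‖a‖ ≤ α) (h' : ‖b‖ ≤ β) : ‖a * b‖ ≤ α * β :=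
  (norm_mul_le _ _).trans (mul_le_mul h h' (norm_nonneg _) ((norm_nonneg _).trans h))

/-- near-kernel element -/
lemma kerD {x e : M} {s : ℝ} (hs : 0 < s) (hs1 : s ≤ 1) (hn : ¬ IsUnit (star x * x))
    (hxe : star x * x * (1 - e) = 1 - e) :
    ∃ D : M, 0 ≤ D ∧ D ≤ 1 ∧ D * e = D ∧ ‖x * D‖ ≤ s ∧ cut (1 / 2) (D * D) ≠ 0 := by
  obtain ⟨k, hk⟩ : ∃ k, k = star x * x := ⟨_, rfl⟩
  have hk0 : 0 ≤ k := hk ▸ star_mul_self_nonneg _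
  obtain ⟨κ, hκ⟩ : ∃ κ : ℝ → ℝ, κ = fun t => max (1 - t / s ^ 2) 0 := ⟨_, rfl⟩
  have hκc : Continuous κ := by rw [hκ]; fun_prop
  have hκv : ∀ t, κ t = max (1 - t / s ^ 2) 0 := fun t => by rw [hκ]
  have hs2 : 0 < s ^ 2 := by positivity
  have hκ0 : ∀ t, 0 ≤ κ t := fun t => by rw [hκv]; exact le_max_right _ _
  have hκ1 : ∀ t, 0 ≤ t → κ t ≤ 1 := fun t ht => by
    rw [hκv]; exact max_le (by have : 0 ≤ t / s ^ 2 := by positivity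
                               linarith) zero_le_one
  have hκz : ∀ t, s ^ 2 ≤ t → κ t = 0 := fun t ht => by
    rw [hκv]; refine max_eq_right ?_
    have : 1 ≤ t / s ^ 2 := by rwa [one_le_div hs2]
    linarith
  have hκκ : Continuous fun t => κ t * κ t := hκc.mul hκc
  refine ⟨cfc κ k, fc_nonneg hk0 fun t _ => hκ0 t, fc_le_one hκc hk0 fun t ht _ => hκ1 t ht, ?_, ?_, ?_⟩
  · have h1 : k * (1 - e) = (1 : ℝ) • (1 - e) := by rw [hk, hxe, one_smul]
    have h2 := fc_eig (IsSelfAdjoint.of_nonneg hk0) h1 hκc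
    rw [hκz 1 (by nlinarith), zero_smul, mul_sub, mul_one, sub_eq_zero] at h2
    exact h2.symm
  · have h1 := nsq (x * cfc κ k)
    have e1 : star (x * cfc κ k) * (x * cfc κ k) = cfc (fun t => κ t * t * κ t) k := by
      have hc2 : Continuous fun t => κ t * t := hκc.mul continuous_id'
      rw [star_mul, fc_star, ← fc_mul hc2 hκc, ← fc_mul hκc continuous_id', fc_id hk0]
      nth_rewrite 4 [hk]; simp only [mul_assoc]
    rw [e1] at h1
    have h2 : ‖cfc (fun t => κ t * t * κ t) k‖ ≤ s ^ 2 := by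
      refine fc_norm_le hk0 hs2.le fun t ht _ => ?_
      have a1 := hκ0 t
      have a2 := hκ1 t ht
      rw [abs_of_nonneg (by positivity)]
      rcases le_total t (s ^ 2) with h | h
      · have : κ t * t ≤ t := by nlinarith
        have : κ t * t * κ t ≤ κ t * t := by
          have : 0 ≤ κ t * t := by positivity
          nlinarith
        linarith
      · rw [hκz t h]; simpa using hs2.le
    rw [h1] at h2
    exact le_of_sq_le_sq h2 hs.le
  · intro h0
    have h1 : cut (1 / 2) (cfc κ k * cfc κ k) = cfc (fun t => cutf (1 / 2) (κ t * κ t)) k := by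
      rw [fc_mul hκc hκc, cut, fc_comp hκκ (cutf_cont _) hk0]
    rw [h1] at h0
    have h2 : (0 : ℝ) ∈ spectrum ℝ k := by
      rw [spectrum.zero_mem_iff, hk]; exact hn
    have hc : Continuous fun t => cutf (1 / 2) (κ t * κ t) := (cutf_cont _).comp hκκ
    have h3 := cfc_map_spectrum (R := ℝ) (fun t => cutf (1 / 2) (κ t * κ t)) k (IsSelfAdjoint.of_nonneg hk0)
      hc.continuousOn
    have h4 : (1 / 2 : ℝ) ∈ spectrum ℝ (cfc (fun t => cutf (1 / 2) (κ t * κ t)) k) := by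
      rw [h3]; refine ⟨0, h2, ?_⟩
      have : κ 0 = 1 := by rw [hκv]; simp
      simp only [this, cutf]; norm_num
    rw [h0, spectrum.mem_iff, sub_zero] at h4
    exact h4 ((isUnit_iff_ne_zero.2 (by norm_num)).map (algebraMap ℝ M))

lemma CuData.topcore (Δ : CuData M C) {a e x : M} {s : ℝ} (hs : 0 < s) (hs1 : s ≤ 1)
    (haI : a ∈ Δ.I) (heI : e ∈ Δ.I) (he0 : 0 ≤ e) (he1 : e ≤ 1) (hea : e * a = a) (hae : a * e = a)
    (hB : Δ.Bd (Δ.cl e)) (hx : x = 1 + a) (hn : ¬ IsUnit (star x * x)) :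
    ∃ g ∈ closure {x : M | IsUnit x}, ‖x - g‖ ≤ s * (200 + 300 * ‖a‖) := by
  have hes := nonneg_sa he0
  have hsae : star a * e = star a := by rw [← hes, ← star_mul, hea]
  have hna := norm_nonneg a
  obtain ⟨D, hD0, hD1, hDe, hxD, hT⟩ := kerD (x := x) (e := e) hs hs1 hn (by
    rw [hx, star_add, star_one, mul_assoc]
    have h1 : (1 + a) * (1 - e) = 1 - e := by
      rw [mul_sub, add_mul _ _ e, hae]; noncomm_ring
    rw [h1, mul_sub, add_mul _ _ e, hsae]; noncomm_ring)
  have hDI : D ∈ Δ.I := hDe ▸ Δ.mul_left _ _ heI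
  have hDn := norm_le_one_of hD0 hD1
  have hDD0 : 0 ≤ D * D := by have := star_mul_self_nonneg D; rwa [nonneg_sa hD0] at this
  obtain ⟨m, hm⟩ := hB _ (Δ.cut_mem (by norm_num : (0:ℝ) ≤ 1 / 2) hDD0 (Δ.mul_left _ _ hDI))
    (cut_nonneg hDD0) hT
  obtain ⟨T, hTd⟩ : ∃ T, T = Δ.cl (cut (1 / 2) (D * D)) := ⟨_, rfl⟩
  rw [← hTd] at hm
  obtain ⟨k, hk⟩ : ∃ k, k = 100 * m + 1 := ⟨_, rfl⟩
  obtain ⟨N, hN⟩ : ∃ N, N = 3 * (k + 1) := ⟨_, rfl⟩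
  have hN1 : 1 ≤ N := by omega
  have hcee : Δ.cl (e * star e) ≤ Δ.cl e := by rw [hes]; exact Δ.cl_sq he0 heI
  obtain ⟨-, E2, E1, E, y1, -, -, -, -, ⟨hE20, hE21⟩, ⟨hE10, hE11⟩, ⟨hE0, hE1'⟩, hE2R, hE2E1, hE1E, -, -, hy1I,
    hy1, hy1s, hdE0, hdEs⟩ := Δ.SL' hN1 hs (h := e) (w := 1) (Q := 0) (Δ.mul_right _ _ heI)
      (CuData.Bd.mono Δ hB hcee) (star_zero _) (norm_le_one_of zero_le_one le_rfl) (by simp) (by simp) (by simp)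
      (by simp)
  have sE2 := nonneg_sa hE20
  have sE1 := nonneg_sa hE10
  have sE := nonneg_sa hE0
  have hE1E2 : E1 * E2 = E1 := by rw [← sE1, ← sE2, ← star_mul, hE2E1]
  have hEE1 : E * E1 = E := by
    have := congrArg star hE1E; rwa [star_mul, sE, sE1] at this
  have hE2I : E2 ∈ Δ.I := Δ.Rid_mem (Δ.mul_right _ _ heI) hE2R
  have hE1I : E1 ∈ Δ.I := hE2E1 ▸ Δ.mul_right _ _ hE2I
  have hEn := norm_le_one_of hE0 hE1'
  obtain ⟨x1, hx1⟩ : ∃ x1, x1 = 1 + E * a * E := ⟨_, rfl⟩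
  obtain ⟨z', hz'⟩ : ∃ z', z' = y1 * a + E * a * star y1 := ⟨_, rfl⟩
  have hz'I : z' ∈ Δ.I := by
    rw [hz']; exact Δ.I.add_mem (Δ.mul_right _ _ hy1I) (Δ.mul_left _ _ (Δ.star_mem _ hy1I))
  have hz's : Δ.sz z' ≤ 2 • Δ.sz y1 := by
    rw [hz', two_nsmul]
    refine (Δ.sz_add (Δ.mul_right _ _ hy1I) (Δ.mul_left _ _ (Δ.star_mem _ hy1I))).trans ?_
    refine add_le_add (Δ.sz_mul_right hy1I a) ((Δ.sz_mul_left (Δ.star_mem _ hy1I) _).trans ?_)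
    rw [Δ.sz_star hy1I]
  have hzz : ‖(x - x1) - z'‖ ≤ 2 * ‖a‖ * s := by
    have e1 : (x - x1) - z' = ((1 - E) * e - y1) * a + E * a * star ((1 - E) * e - y1) := by
      rw [hx, hx1, hz', star_sub, star_mul, star_sub, hes, star_one, sE]
      have e2 : ((1 - E) * e - y1) * a = a - E * a - y1 * a := by
        rw [sub_mul, mul_assoc, hea]; noncomm_ring
      have e3 : E * a * (e * (1 - E) - star y1) = E * a - E * a * E - E * a * star y1 := by
        rw [mul_sub, mul_assoc, ← mul_assoc a e, hae]; noncomm_ring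
      rw [e2, e3]; abel
    rw [e1]
    have b1 : ‖((1 - E) * e - y1) * a‖ ≤ s * ‖a‖ := mul_le_of hy1 le_rfl
    have b2 : ‖E * a * star ((1 - E) * e - y1)‖ ≤ (1 * ‖a‖) * s :=
      mul_le_of (mul_le_of hEn le_rfl) (by rw [norm_star]; exact hy1)
    refine (norm_add_le _ _).trans (by linarith)
  -- polar decomposition
  obtain ⟨w, h, hw, hh0, hxwh, hwwh, hhx, hhn, hfix⟩ := approx_polar x1 hs hs1
  have hEQ : E * (1 - E1) = 0 := by rw [mul_sub, mul_one, hEE1, sub_self]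
  have hwQ1 : w * (1 - E1) = 1 - E1 := by
    refine hfix _ ?_ ?_
    · rw [hx1, add_mul, one_mul, mul_assoc, hEQ, mul_zero, add_zero]
    · rw [hx1, star_add, star_mul, star_mul, sE, star_one, add_mul, one_mul, mul_assoc, mul_assoc, hEQ, mul_zero,
        mul_zero, add_zero]
  have hwsQ1 := contr_fix hw hwQ1
  have hQQ : (1 - E1) * (1 - E2) = 1 - E2 := by
    rw [mul_sub, mul_one, sub_mul, one_mul, hE1E2]; abel
  have hwQ0 : w * (1 - E2) = 1 - E2 := by rw [← hQQ, ← mul_assoc, hwQ1]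
  have hsQ0 : star (1 - E2) = 1 - E2 := by rw [star_sub, star_one, sE2]
  have hQ0w := contr_fix' hw hwQ0 hsQ0
  have hszE1 : Δ.sz (E1 * h) ≤ Δ.cl e := by
    refine (Δ.sz_mul_right hE1I h).trans ?_
    rw [← hE2E1]
    refine (Δ.sz_mul_right hE2I _).trans ((Δ.sz_pos_le hE20 hE2I).trans ?_)
    exact (Δ.cl_Rid (mul_star_self_nonneg _) (Δ.mul_right _ _ heI) hE20 hE2R).trans hcee
  have hH0 : Δ.cl (E1 * h * star (E1 * h)) ≤ Δ.cl e := by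
    have : E1 * h ∈ Δ.I := Δ.mul_right _ _ hE1I
    rw [Δ.cl_ss this]; exact hszE1
  have hwwE : star w * w * (E1 * h) = E1 * h := by
    have e1 : E1 * h = h - (1 - E1) * h := by noncomm_ring
    rw [e1, mul_sub, hwwh, ← mul_assoc, mul_assoc (star w) w, hwQ1, hwsQ1]
  obtain ⟨P, F2, F1, F, y2, hPP, hPP', hPQ, hQP, ⟨hF20, hF21⟩, ⟨hF10, hF11⟩, ⟨hF0, hF1'⟩, hF2R, hF2F1, hF1F, hPwF, -,
    hy2I, hy2, hy2s, -, -⟩ := Δ.SL' hN1 hs (h := E1 * h) (w := w) (Q := 1 - E2)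
      (Δ.mul_right _ _ (Δ.mul_right _ _ hE1I)) (CuData.Bd.mono Δ hB hH0) hsQ0 hw hwQ0 hQ0w (by
        rw [← mul_assoc, ← mul_assoc, sub_mul, one_mul, hE2E1]; simp) (by
        rw [← mul_assoc, hwwE])
  have sF := nonneg_sa hF0
  have hF2F : F2 * F = F := by rw [← hF1F, ← mul_assoc, hF2F1]
  have hE2F2 : E2 * F2 = F2 := Rid_one (by
    rw [← mul_assoc, ← mul_assoc, hE2E1]) hF2R
  have hE2F : E2 * F = F := by rw [← hF2F, ← mul_assoc, hE2F2]
  have hFE2 : F * E2 = F := by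
    have := congrArg star hE2F; rwa [star_mul, sF, sE2] at this
  obtain ⟨w', hw'⟩ : ∃ w', w' = star P * w := ⟨_, rfl⟩
  have hw'n : ‖w'‖ ≤ 1 := hw' ▸ norm_uni_mul_le hPP' hw
  have hsPQ : star P * (1 - E2) = 1 - E2 := by
    nth_rewrite 1 [← hPQ]; rw [← mul_assoc, hPP, one_mul]
  obtain ⟨Q, hQ⟩ : ∃ Q, Q = 1 - E2 + F := ⟨_, rfl⟩
  have hw'Q : w' * Q = Q := by
    rw [hQ, mul_add, hw', mul_assoc, hwQ0, hsPQ]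
    congr 1
    rw [← hF2F, ← mul_assoc, hPwF]
  have hQ0 : 0 ≤ Q := by rw [hQ]; exact add_nonneg (sub_nonneg.2 hE21) hF0
  have hFle : F ≤ E2 := by
    have h1 := conj_mono hF1' E2
    rw [sE2, hE2F, hFE2, mul_one] at h1
    exact h1.trans (sq_le_self hE20 hE21)
  have hQ1 : Q ≤ 1 := by
    rw [hQ, ← sub_nonneg]
    have : 0 ≤ E2 - F := sub_nonneg.2 hFle
    convert this using 1; abel
  have h1Q : 1 - Q = (1 - F) * E2 := by rw [hQ, sub_mul, hFE2]; noncomm_ring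
  obtain ⟨r, hr⟩ : ∃ r, r = w' * y2 + w' * (1 - F) * (E2 - E1) * h + star P * z' := ⟨_, rfl⟩
  have hdEI : E2 - E1 ∈ Δ.I := Δ.I.sub_mem hE2I hE1I
  have hr1I : w' * y2 ∈ Δ.I := Δ.mul_left _ _ hy2I
  have hr2I : w' * (1 - F) * (E2 - E1) * h ∈ Δ.I := Δ.mul_right _ _ (Δ.mul_left _ _ hdEI)
  have hr3I : star P * z' ∈ Δ.I := Δ.mul_left _ _ hz'I
  have hrI : r ∈ Δ.I := by rw [hr]; exact Δ.I.add_mem (Δ.I.add_mem hr1I hr2I) hr3I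
  have hrs : Δ.sz r ≤ Δ.sz y2 + Δ.cl (E2 - E1) + 2 • Δ.sz y1 := by
    rw [hr]
    refine (Δ.sz_add (Δ.I.add_mem hr1I hr2I) hr3I).trans ?_
    refine add_le_add ((Δ.sz_add hr1I hr2I).trans (add_le_add (Δ.sz_mul_left hy2I _) ?_))
      ((Δ.sz_mul_left hz'I _).trans hz's)
    refine (Δ.sz_mul_right (Δ.mul_left _ _ hdEI) _).trans ((Δ.sz_mul_left hdEI _).trans ?_)
    exact Δ.sz_pos_le hdE0 hdEI
  have hPs : ‖star P‖ ≤ 1 := unitary_norm (by rwa [star_star])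
  have happ : ‖star P * x - (Q * h + r)‖ ≤ 2 * s + 2 * ‖a‖ * s := by
    have e1 : star P * x - (Q * h + r) = star P * (x1 - w * h) + w' * ((1 - F) * (E1 * h) - y2)
        + star P * ((x - x1) - z') := by
      have e2 : Q * h = w' * h - w' * ((1 - F) * E2) * h := by
        rw [← h1Q, mul_sub, mul_one, hw'Q]; noncomm_ring
      rw [hr, e2, hw']; noncomm_ring
    rw [e1]
    have b1 : ‖star P * (x1 - w * h)‖ ≤ 1 * s := mul_le_of hPs hxwh
    have b2 : ‖w' * ((1 - F) * (E1 * h) - y2)‖ ≤ 1 * s := mul_le_of hw'n hy2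
    have b3 : ‖star P * ((x - x1) - z')‖ ≤ 1 * (2 * ‖a‖ * s) := mul_le_of hPs hzz
    refine (norm_add₃_le).trans (by linarith)
  -- invert Q + s
  have hGu : IsUnit (Q + algebraMap ℝ M s) := pos_add_unit hQ0 hs
  obtain ⟨G, hG⟩ := hGu
  obtain ⟨r2, hr2⟩ : ∃ r2, r2 = (↑G⁻¹ : M) * r := ⟨_, rfl⟩
  have hGr : (G : M) * r2 = r := by rw [hr2, ← mul_assoc, Units.mul_inv, one_mul]
  have hr2I : r2 ∈ Δ.I := hr2 ▸ Δ.mul_left _ _ hrI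
  have hr2s : Δ.sz r2 ≤ Δ.sz r := hr2 ▸ Δ.sz_mul_left hrI _
  obtain ⟨y, hy⟩ : ∃ y, y = z' * (-D) := ⟨_, rfl⟩
  have hyI : y ∈ Δ.I := hy ▸ Δ.mul_right _ _ hz'I
  have hys : Δ.sz y ≤ 2 • Δ.sz y1 := by rw [hy]; exact (Δ.sz_mul_right hz'I _).trans hz's
  have hρ : Δ.sz y + 2 • Δ.sz r2 ≤ 6 • Δ.sz y1 + 2 • Δ.sz y2 + 2 • Δ.cl (E2 - E1) := by
    calc Δ.sz y + 2 • Δ.sz r2 ≤ 2 • Δ.sz y1 + 2 • (Δ.sz y2 + Δ.cl (E2 - E1) + 2 • Δ.sz y1) :=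
          add_le_add hys (CuData.nsmul_le _ (hr2s.trans hrs))
      _ = _ := by
        simp only [nsmul_add, ← mul_nsmul']
        rw [show 6 = 2 + 2 * 2 from rfl, add_nsmul]; abel
  have hNρ : N • (Δ.sz y + 2 • Δ.sz r2) ≤ 100 • Δ.cl e := by
    refine (CuData.nsmul_le N hρ).trans ?_
    have b1 := hy1s.trans (CuData.nsmul_le 10 hcee)
    have b2 := hy2s.trans (CuData.nsmul_le 10 hH0)
    have b3 := hdEs.trans (CuData.nsmul_le 10 hcee)
    calc N • (6 • Δ.sz y1 + 2 • Δ.sz y2 + 2 • Δ.cl (E2 - E1))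
        = 6 • (N • Δ.sz y1) + 2 • (N • Δ.sz y2) + 2 • (N • Δ.cl (E2 - E1)) := by
          simp only [nsmul_add, ← mul_nsmul', mul_comm N]
      _ ≤ 6 • (10 • Δ.cl e) + 2 • (10 • Δ.cl e) + 2 • (10 • Δ.cl e) :=
          add_le_add (add_le_add (CuData.nsmul_le _ b1) (CuData.nsmul_le _ b2)) (CuData.nsmul_le _ b3)
      _ = 100 • Δ.cl e := by simp only [← mul_nsmul', ← add_nsmul]
  have h3ρ : 3 • (Δ.sz y + 2 • Δ.sz r2) ≤ T := by
    refine Δ.small (k := k) (by omega) ?_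
    rw [← hN]
    refine hNρ.trans ((CuData.nsmul_le _ hm).trans ?_)
    rw [← mul_nsmul']
    exact Δ.nsmul_le' (by omega)
  have hBρ : Δ.Bd (Δ.sz y + 2 • Δ.sz r2) := by
    refine CuData.Bd.mono Δ (CuData.Bd.nsmul Δ hB 100) (le_trans ?_ hNρ)
    nth_rewrite 1 [← one_nsmul (Δ.sz y + 2 • Δ.sz r2)]
    exact Δ.nsmul_le' hN1
  have hb0 : 0 ≤ s + 2 * ‖a‖ * s := by positivity
  obtain ⟨g, hg, hgn⟩ := Δ.step67 (hd := h) (r := r2) (D := D) (y := y) (τ := 1 / 2)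
    (τ' := 2 * (s + 2 * ‖a‖ * s) ^ 2) (ε := s) (by norm_num) (by positivity) hs hh0 hr2I hDI hD0 hD1 hyI (by
      have h1 := conj_mono hhx D
      rw [nonneg_sa hD0] at h1
      refine h1.trans ?_
      obtain ⟨p, hp⟩ : ∃ p, p = x * D - ((x - x1) - z') * D := ⟨_, rfl⟩
      have e1 : D * (star x1 * x1) * D = star (p + y) * (p + y) := by
        have : p + y = x1 * D := by rw [hp, hy]; noncomm_ring
        rw [this, star_mul, nonneg_sa hD0]; simp only [mul_assoc]
      have hpn : ‖p‖ ≤ s + 2 * ‖a‖ * s := by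
        rw [hp]
        have : ‖((x - x1) - z') * D‖ ≤ (2 * ‖a‖ * s) * 1 := mul_le_of hzz hDn
        exact (norm_sub_le _ _).trans (by linarith)
      have hpp : star p * p ≤ algebraMap ℝ M ((s + 2 * ‖a‖ * s) ^ 2) := by
        refine (sa_le_norm (IsSelfAdjoint.of_nonneg (star_mul_self_nonneg p))).trans ?_
        refine algebraMap_mono M ?_
        rw [nsq]; gcongr
      rw [e1]
      refine (two_mul_le p y).trans ?_
      rw [add_comm]
      refine add_le_add le_rfl ?_
      rw [map_mul, ← Algebra.smul_def]
      exact smul_le_smul_of_nonneg_left hpp zero_le_two) hBρ (hTd ▸ h3ρ)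
  have hsq : √(2 * (2 * (s + 2 * ‖a‖ * s) ^ 2)) = 2 * (s + 2 * ‖a‖ * s) := by
    rw [show 2 * (2 * (s + 2 * ‖a‖ * s) ^ 2) = (2 * (s + 2 * ‖a‖ * s)) ^ 2 by ring, Real.sqrt_sq (by positivity)]
  rw [hsq] at hgn
  have hPu : IsUnit P := unit_star_mul_star hPP' hPP
  refine ⟨P * (G * g), clos_unit_mul (subset_closure hPu) (clos_unit_mul (subset_closure G.isUnit) hg), ?_⟩
  have hPn : ‖P‖ ≤ 1 := unitary_norm hPP
  have hsn : ‖algebraMap ℝ M s‖ ≤ s := norm_alg_le hs.le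
  have hQn := norm_le_one_of hQ0 hQ1
  have hGn : ‖(G : M)‖ ≤ 2 := by
    rw [hG]; exact (norm_add_le _ _).trans (by linarith)
  have hx1n : ‖x1‖ ≤ 1 + ‖a‖ := by
    rw [hx1]
    have h1 : ‖(1 : M)‖ ≤ 1 := norm_le_one_of zero_le_one le_rfl
    have h2 : ‖E * a * E‖ ≤ 1 * ‖a‖ * 1 := mul_le_of (mul_le_of hEn le_rfl) hEn
    exact (norm_add_le _ _).trans (by linarith)
  have e1 : x - P * (G * g) = P * ((star P * x - (Q * h + r)) - algebraMap ℝ M s * h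
      - G * algebraMap ℝ M s + G * (h + algebraMap ℝ M s + r2 - g)) := by
    have e2 : x = P * (star P * x) := by rw [← mul_assoc, hPP', one_mul]
    have e3 : (Q + algebraMap ℝ M s) * r2 = r := hG ▸ hGr
    nth_rewrite 1 [e2]
    rw [← mul_sub]
    congr 1
    rw [mul_sub (G : M), mul_add (G : M), mul_add (G : M), hGr, hG, add_mul Q _ h]; abel
  rw [e1]
  have c1 : ‖algebraMap ℝ M s * h‖ ≤ s * (1 + ‖a‖) := mul_le_of hsn (hhn.trans hx1n)
  have c2 : ‖(G : M) * algebraMap ℝ M s‖ ≤ 2 * s := mul_le_of hGn hsn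
  have c3 := mul_le_of hGn hgn
  have c4 := norm_add_le ((star P * x - (Q * h + r)) - algebraMap ℝ M s * h
      - G * algebraMap ℝ M s) (G * (h + algebraMap ℝ M s + r2 - g))
  have c5 := norm_sub_le ((star P * x - (Q * h + r)) - algebraMap ℝ M s * h) (G * algebraMap ℝ M s)
  have c6 := norm_sub_le (star P * x - (Q * h + r)) (algebraMap ℝ M s * h)
  have hsa : 0 ≤ s * ‖a‖ := by positivity
  refine (mul_le_of hPn (c4.trans (add_le_add (c5.trans (add_le_add (c6.trans (add_le_add happ c1)) c2)) c3))).trans ?_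
  nlinarith

end Generic11

section Generic12
variable {M : Type*} [CStarAlgebra M] [PartialOrder M] [StarOrderedRing M]
variable {C : Type*} [AddCommMonoid C] [PartialOrder C] [IsOrderedAddMonoid C]

lemma unit_of_both {x : M} (h1 : IsUnit (star x * x)) (h2 : IsUnit (x * star x)) : IsUnit x := by
  obtain ⟨u, hu⟩ := h1
  obtain ⟨v, hv⟩ := h2
  have hl : (↑u⁻¹ * star x) * x = 1 := by rw [mul_assoc, ← hu, Units.inv_mul]
  have hr : x * (star x * ↑v⁻¹) = 1 := by rw [← mul_assoc, ← hv, Units.mul_inv]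
  exact isUnit_iff_exists_and_exists.2 ⟨⟨_, hr⟩, ⟨_, hl⟩⟩

theorem CuData.core (Δ : CuData M C) {a : M} (haI : a ∈ Δ.I) : 1 + a ∈ closure {x : M | IsUnit x} := by
  refine clos_of_approx fun ε hε => ?_
  obtain ⟨δ, hδ⟩ : ∃ δ, δ = (ε / 4) ^ 2 / 2 := ⟨_, rfl⟩
  have hδ0 : 0 < δ := by rw [hδ]; positivity
  obtain ⟨k, hk⟩ : ∃ k, k = star a * a + a * star a := ⟨_, rfl⟩
  have hk0 : 0 ≤ k := by rw [hk]; exact add_nonneg (star_mul_self_nonneg _) (mul_star_self_nonneg _)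
  have hkI : k ∈ Δ.I := by rw [hk]; exact Δ.I.add_mem (Δ.mul_left _ _ haI) (Δ.mul_right _ _ haI)
  obtain ⟨u, hu⟩ : ∃ u, u = rmp δ (2 * δ) k := ⟨_, rfl⟩
  have hu0 : 0 ≤ u := hu ▸ rmp_nonneg hk0
  have hu1 : u ≤ 1 := hu ▸ rmp_le_one hk0
  have hun := norm_le_one_of hu0 hu1
  have su := nonneg_sa hu0
  have hc := one_sub_rmp_conj hδ0 hk0
  rw [← hu] at hc
  have s1u : star (1 - u) = 1 - u := by rw [star_sub, star_one, su]
  have key : ∀ b : M, b * star b ≤ k → ‖(1 - u) * b‖ ≤ ε / 4 := by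
    intro b hb
    have h1 := conj_mono hb (1 - u)
    rw [s1u] at h1
    have e1 : (1 - u) * (b * star b) * (1 - u) = ((1 - u) * b) * star ((1 - u) * b) := by
      rw [star_mul, s1u]; simp only [mul_assoc]
    rw [e1] at h1
    have h2 := (norm_mono (mul_star_self_nonneg _) h1).trans hc
    rw [nsq'] at h2
    refine le_of_sq_le_sq (h2.trans (le_of_eq ?_)) (by positivity)
    rw [hδ]; ring
  have k1 : ‖(1 - u) * a‖ ≤ ε / 4 := key a (by rw [hk]; exact le_add_of_nonneg_left (star_mul_self_nonneg _))
  have k2 : ‖a * (1 - u)‖ ≤ ε / 4 := by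
    have := key (star a) (by rw [hk, star_star]; exact le_add_of_nonneg_right (mul_star_self_nonneg _))
    rwa [← norm_star, star_mul, star_star, s1u] at this
  obtain ⟨a', ha'⟩ : ∃ a', a' = u * a * u := ⟨_, rfl⟩
  have haa : ‖a - a'‖ ≤ ε / 2 := by
    have e1 : a - a' = (1 - u) * a + u * (a * (1 - u)) := by rw [ha']; noncomm_ring
    have := mul_le_of hun k2
    rw [e1]; exact (norm_add_le _ _).trans (by linarith)
  have ha'I : a' ∈ Δ.I := by rw [ha']; exact Δ.mul_right _ _ (Δ.mul_left _ _ haI)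
  have ha'n : ‖a'‖ ≤ ‖a‖ := by
    rw [ha']; refine (mul_le_of (mul_le_of hun le_rfl) hun).trans (by linarith)
  obtain ⟨e, he⟩ : ∃ e, e = rmp (δ / 2) (2 * (δ / 2)) k := ⟨_, rfl⟩
  have heI : e ∈ Δ.I := he ▸ Δ.rmp_mem (by positivity) (by linarith) hk0 hkI
  have he0 : 0 ≤ e := he ▸ rmp_nonneg hk0
  have he1 : e ≤ 1 := he ▸ rmp_le_one hk0
  have hB : Δ.Bd (Δ.cl e) := by
    refine CuData.Bd.mono Δ (CuData.Bd.cut Δ hkI hk0 (half_pos hδ0)) ?_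
    refine Δ.cl_mono _ _ heI he0 (Δ.cut_mem (by positivity) hk0 hkI) (cut_nonneg hk0) ?_
    rw [he]; exact CLE.rmp_cut (half_pos hδ0) hk0
  have heu : e * u = u := by
    rw [he, hu, rmp, rmp, fc_mul (ramp_cont _ _) (ramp_cont _ _)]
    refine fc_congr hk0 fun t _ => ?_
    rcases le_total t δ with h | h
    · rw [ramp_eq_zero (by linarith) h, mul_zero]
    · rw [ramp_eq_one (by linarith) (by linarith), one_mul]
  have hue : u * e = u := by
    have := congrArg star heu; rwa [star_mul, su, nonneg_sa he0] at this
  obtain ⟨s, hs⟩ : ∃ s, s = min 1 (ε / (2 * (200 + 300 * ‖a‖))) := ⟨_, rfl⟩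
  have hL : 0 < 200 + 300 * ‖a‖ := by positivity
  have hs0 : 0 < s := by rw [hs]; exact lt_min one_pos (by positivity)
  have hs1 : s ≤ 1 := by rw [hs]; exact min_le_left _ _
  have hsL : s * (200 + 300 * ‖a'‖) ≤ ε / 2 := by
    have h1 : s ≤ ε / (2 * (200 + 300 * ‖a‖)) := by rw [hs]; exact min_le_right _ _
    calc s * (200 + 300 * ‖a'‖) ≤ ε / (2 * (200 + 300 * ‖a‖)) * (200 + 300 * ‖a‖) := by gcongr
      _ = ε / 2 := by field_simp
  have fin : ∀ g : M, ‖(1 + a') - g‖ ≤ s * (200 + 300 * ‖a'‖) → ‖1 + a - g‖ ≤ ε := by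
    intro g hg
    have e1 : 1 + a - g = (a - a') + ((1 + a') - g) := by abel
    rw [e1]; exact (norm_add_le _ _).trans (by linarith)
  have hea : e * a' = a' := by rw [ha', ← mul_assoc, ← mul_assoc, heu]
  have hae : a' * e = a' := by rw [ha', mul_assoc, hue]
  by_cases h1 : IsUnit (star (1 + a') * (1 + a'))
  · by_cases h2 : IsUnit ((1 + a') * star (1 + a'))
    · exact ⟨1 + a', subset_closure (unit_of_both h1 h2), fin _ (by rw [sub_self, norm_zero]; positivity)⟩
    · obtain ⟨g, hg, hgn⟩ := Δ.topcore (a := star a') (e := e) (x := star (1 + a')) hs0 hs1 (Δ.star_mem _ ha'I) heI he0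
        he1 (by have := congrArg star hae; rwa [star_mul, nonneg_sa he0] at this)
        (by have := congrArg star hea; rwa [star_mul, nonneg_sa he0] at this) hB (by rw [star_add, star_one])
        (by rwa [star_star])
      refine ⟨star g, clos_unit_star hg, fin _ ?_⟩
      rwa [← norm_star, star_sub, star_star, norm_star a'] at hgn
  · obtain ⟨g, hg, hgn⟩ := Δ.topcore (a := a') (e := e) (x := 1 + a') hs0 hs1 ha'I heI he0 he1 hea hae hB rfl h1
    exact ⟨g, hg, fin g hgn⟩

end Generic12

section Ran
variable {R : Type*} [NonUnitalCStarAlgebra R] [PartialOrder R] [StarOrderedRing R]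

variable (R) in
/-- the ideal `R` of its unitization -/
def ran : AddSubgroup (Unitization ℂ R) where
  carrier := {x | x.fst = 0}
  zero_mem' := by simp
  add_mem' := by
    intro a b ha hb
    simp only [Set.mem_ofPred_eq] at *
    simp [ha, hb]
  neg_mem' := by
    intro a ha
    simp only [Set.mem_ofPred_eq] at *
    simp [ha]

lemma mem_ran {x : Unitization ℂ R} : x ∈ ran R ↔ x.fst = 0 := Iff.rfl

lemma inr_mem (r : R) : (r : Unitization ℂ R) ∈ ran R := by simp [mem_ran]

lemma ran_eq {x : Unitization ℂ R} (h : x ∈ ran R) : x = (x.snd : Unitization ℂ R) := by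
  ext
  · simpa using mem_ran.1 h
  · simp

lemma ran_exists {x : Unitization ℂ R} (h : x ∈ ran R) : ∃ r : R, x = (r : Unitization ℂ R) :=
  ⟨_, ran_eq h⟩

lemma ran_mul_left (m : Unitization ℂ R) {x : Unitization ℂ R} (h : x ∈ ran R) : m * x ∈ ran R := by
  rw [mem_ran] at *; simp [h]

lemma ran_mul_right (m : Unitization ℂ R) {x : Unitization ℂ R} (h : x ∈ ran R) : x * m ∈ ran R := by
  rw [mem_ran] at *; simp [h]

lemma ran_star {x : Unitization ℂ R} (h : x ∈ ran R) : star x ∈ ran R := by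
  rw [mem_ran] at *; simp [h]

lemma ran_smul (r : ℝ) {x : Unitization ℂ R} (h : x ∈ ran R) : r • x ∈ ran R := by
  rw [mem_ran] at *; simp [h]

variable (R) in
/-- the character of the unitization -/
def chi : Unitization ℂ R →⋆ₐ[ℂ] ℂ := Unitization.starLift (0 : R →⋆ₙₐ[ℂ] ℂ)

lemma chi_apply (x : Unitization ℂ R) : chi R x = x.fst := by
  show x.fst + (0 : R →⋆ₙₐ[ℂ] ℂ) x.snd = x.fst
  simp

lemma chi_cont : Continuous (chi R) :=
  AddMonoidHomClass.continuous_of_bound (chi R) 1 fun x => by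
    simpa using NonUnitalStarAlgHom.norm_apply_le (chi R) x

lemma ran_closed : IsClosed (ran R : Set (Unitization ℂ R)) := by
  have : (ran R : Set (Unitization ℂ R)) = (chi R) ⁻¹' {0} := by
    ext x; simp [mem_ran, chi_apply]
  rw [this]
  exact isClosed_singleton.preimage chi_cont

lemma ran_cfc {f : ℝ → ℝ} (hf : Continuous f) (h0 : f 0 = 0) {x : Unitization ℂ R} (hx0 : 0 ≤ x)
    (hx : x ∈ ran R) : cfc f x ∈ ran R := by
  rw [mem_ran, ← chi_apply]
  rw [StarAlgHomClass.map_cfc (chi R) f x (hf.continuousOn) chi_cont (IsSelfAdjoint.of_nonneg hx0)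
    ((IsSelfAdjoint.of_nonneg hx0).map (chi R)), chi_apply, mem_ran.1 hx]
  simp [h0]

lemma ran_cut {ε : ℝ} (hε : 0 ≤ ε) {x : Unitization ℂ R} (hx0 : 0 ≤ x)
    (hx : x ∈ ran R) : cut ε x ∈ ran R := ran_cfc (cutf_cont _) (cutf_eq_zero hε) hx0 hx

lemma ran_rt {x : Unitization ℂ R} (hx0 : 0 ≤ x)
    (hx : x ∈ ran R) : rt x ∈ ran R := ran_cfc Real.continuous_sqrt Real.sqrt_zero hx0 hx

lemma ran_rmp {ε : ℝ} (hε : 0 < ε) {x : Unitization ℂ R} (hx0 : 0 ≤ x)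
    (hx : x ∈ ran R) : rmp ε (2 * ε) x ∈ ran R :=
  ran_cfc (ramp_cont _ _) (ramp_eq_zero (by linarith) hε.le) hx0 hx

/-- `a ≈ u a u`, with `u = rmp` -/
lemma rmp_mul_approx {M : Type*} [CStarAlgebra M] [PartialOrder M] [StarOrderedRing M]
    {ε : ℝ} (hε : 0 < ε) {a : M} (ha : 0 ≤ a) :
    ‖a - rmp ε (2 * ε) a * a * rmp ε (2 * ε) a‖ ≤ 2 * ε := by
  have hr := ramp_cont ε (2 * ε)
  have hc2 : Continuous fun t => ramp ε (2 * ε) t * t := hr.mul continuous_id'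
  have hc3 : Continuous fun t => ramp ε (2 * ε) t * t * ramp ε (2 * ε) t := hc2.mul hr
  have e : a - rmp ε (2 * ε) a * a * rmp ε (2 * ε) a =
      cfc (fun t => t - ramp ε (2 * ε) t * t * ramp ε (2 * ε) t) a := by
    rw [← fc_sub continuous_id' hc3, ← fc_mul hc2 hr, ← fc_mul hr continuous_id', fc_id ha, rmp]
  rw [e]
  refine fc_norm_le ha (by linarith) fun t ht0 _ => ?_
  have r0 := ramp_nonneg ε (2 * ε) t
  have r1 := ramp_le_one ε (2 * ε) t
  rcases le_total t (2 * ε) with h5 | h5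
  · have h6 : ramp ε (2 * ε) t * t * ramp ε (2 * ε) t ≤ t := by
      calc _ ≤ 1 * t * 1 := by gcongr
        _ = t := by ring
    have h7 : 0 ≤ ramp ε (2 * ε) t * t * ramp ε (2 * ε) t := by positivity
    rw [abs_of_nonneg (by linarith)]; linarith
  · rw [ramp_eq_one (by linarith) h5]; simp; linarith

/-- `a ≈ u a`, with `u = rmp` -/
lemma rmp_mul_approx' {M : Type*} [CStarAlgebra M] [PartialOrder M] [StarOrderedRing M]
    {ε : ℝ} (hε : 0 < ε) {a : M} (ha : 0 ≤ a) :
    ‖a - rmp ε (2 * ε) a * a‖ ≤ 2 * ε := by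
  have hr := ramp_cont ε (2 * ε)
  have hc2 : Continuous fun t => ramp ε (2 * ε) t * t := hr.mul continuous_id'
  have e : a - rmp ε (2 * ε) a * a = cfc (fun t => t - ramp ε (2 * ε) t * t) a := by
    rw [← fc_sub continuous_id' hc2, ← fc_mul hr continuous_id', fc_id ha, rmp]
  rw [e]
  refine fc_norm_le ha (by linarith) fun t ht0 _ => ?_
  have r0 := ramp_nonneg ε (2 * ε) t
  have r1 := ramp_le_one ε (2 * ε) t
  rcases le_total t (2 * ε) with h5 | h5
  · rw [abs_of_nonneg (by nlinarith)]; nlinarith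
  · rw [ramp_eq_one (by linarith) h5]; simp; linarith

lemma cle_ran {a b : Unitization ℂ R} (ha0 : 0 ≤ a) (ha : a ∈ ran R) (h : CLE a b) {ε : ℝ} (hε : 0 < ε) :
    ∃ x : Unitization ℂ R, x ∈ ran R ∧ ‖a - star x * b * x‖ < ε := by
  obtain ⟨x, hx⟩ := h (ε / 4) (by linarith)
  obtain ⟨u, hu⟩ : ∃ u, u = rmp (ε / 4) (2 * (ε / 4)) a := ⟨_, rfl⟩
  have hur : u ∈ ran R := by rw [hu]; exact ran_rmp (by linarith) ha0 ha
  have hus : star u = u := by rw [hu]; exact rmp_star _ _ _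
  have hun : ‖u‖ ≤ 1 := by rw [hu]; exact rmp_norm ha0
  have h1 : ‖a - u * a * u‖ ≤ 2 * (ε / 4) := by rw [hu]; exact rmp_mul_approx (by linarith) ha0
  refine ⟨x * u, ran_mul_left _ hur, ?_⟩
  have e : a - star (x * u) * b * (x * u) = (a - u * a * u) + star u * (a - star x * b * x) * u := by
    rw [star_mul, hus]; noncomm_ring
  rw [e]
  have h2 := norm_conj_le u (a - star x * b * x)
  have h3 : ‖a - star x * b * x‖ * ‖u‖ ^ 2 ≤ ‖a - star x * b * x‖ * 1 := by
    gcongr; exact pow_le_one₀ (norm_nonneg _) hun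
  calc _ ≤ ‖a - u * a * u‖ + ‖star u * (a - star x * b * x) * u‖ := norm_add_le _ _
    _ < ε := by linarith

lemma cuntzLE_iff {a b : R} (ha : 0 ≤ a) :
    CuntzLE a b ↔ CLE (a : Unitization ℂ R) (b : Unitization ℂ R) := by
  have hn : ∀ x : R, (‖a - star x * b * x‖ : ℝ) =
      ‖(a : Unitization ℂ R) - star (x : Unitization ℂ R) * b * x‖ := by
    intro x
    rw [← Unitization.norm_inr (𝕜 := ℂ)]
    simp
  have ha' : (0 : Unitization ℂ R) ≤ a := Unitization.inr_nonneg_iff.2 ha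
  constructor
  · rintro ⟨x, hx⟩ ε hε
    obtain ⟨n, hn'⟩ := (hx.eventually (eventually_lt_nhds hε)).exists
    exact ⟨x n, by rw [← hn]; exact hn'⟩
  · intro h
    have : ∀ n : ℕ, ∃ x : R, ‖a - star x * b * x‖ < 1 / ((n : ℝ) + 1) := by
      intro n
      obtain ⟨x, hx, hx'⟩ := cle_ran ha' (inr_mem a) h (ε := 1 / ((n : ℝ) + 1)) (by positivity)
      obtain ⟨r, rfl⟩ := ran_exists hx
      exact ⟨r, by rw [hn]; exact hx'⟩
    choose x hx using this
    refine ⟨x, squeeze_zero (fun _ => norm_nonneg _) (fun n => (hx n).le)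
      tendsto_one_div_add_atTop_nhds_zero_nat⟩

end Ran

section Shift
variable {A W : Type*} [NonUnitalCStarAlgebra A] [PartialOrder A] [StarOrderedRing A]
  [NonUnitalCStarAlgebra W] [PartialOrder W] [StarOrderedRing W]

/-- matrix with row-reindexing -/
def Lg (SB : Stabilization A W) (φ : ℕ → ℕ) : (ℕ × ℕ →₀ A) →ₗ[ℂ] W :=
  Finsupp.lsum ℂ fun p => SB.emb (φ p.1) p.2

lemma Lg_single (SB : Stabilization A W) (φ : ℕ → ℕ) (p : ℕ × ℕ) (a : A) :
    Lg SB φ (Finsupp.single p a) = SB.emb (φ p.1) p.2 a := by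
  simp [Lg]

lemma Lg_dense (SB : Stabilization A W) : DenseRange (Lg SB id) := by
  refine SB.dense_span.mono ?_
  have : Submodule.span ℂ {w | ∃ i j a, w = SB.emb i j a} ≤ LinearMap.range (Lg SB id) := by
    rw [Submodule.span_le]
    rintro _ ⟨i, j, a, rfl⟩
    exact ⟨Finsupp.single (i, j) a, by rw [Lg_single]; rfl⟩
  exact this

lemma Lg_inner (SB : Stabilization A W) {φ : ℕ → ℕ} (hφ : Function.Injective φ) (x y : ℕ × ℕ →₀ A) :
    star (Lg SB φ x) * Lg SB φ y = star (Lg SB id x) * Lg SB id y := by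
  induction x using Finsupp.induction_linear with
  | zero => simp
  | add x x' h h' => simp only [map_add, star_add, add_mul, h, h']
  | single p a =>
    induction y using Finsupp.induction_linear with
    | zero => simp
    | add x x' h h' => simp only [map_add, mul_add, h, h']
    | single q b =>
      simp only [Lg_single, SB.emb_star, SB.emb_mul, id, hφ.eq_iff]

lemma Lg_orth (SB : Stabilization A W) {φ ψ : ℕ → ℕ} (h : ∀ i k, φ i ≠ ψ k) (x y : ℕ × ℕ →₀ A) :
    star (Lg SB φ x) * Lg SB ψ y = 0 := by
  induction x using Finsupp.induction_linear with
  | zero => simp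
  | add x x' h h' => simp only [map_add, star_add, add_mul, h, h', add_zero]
  | single p a =>
    induction y using Finsupp.induction_linear with
    | zero => simp
    | add x x' h h' => simp only [map_add, mul_add, h, h', add_zero]
    | single q b =>
      simp only [Lg_single, SB.emb_star, SB.emb_mul, if_neg (h _ _)]

lemma Lg_norm (SB : Stabilization A W) {φ : ℕ → ℕ} (hφ : Function.Injective φ) (x : ℕ × ℕ →₀ A) :
    ‖Lg SB φ x‖ = ‖Lg SB id x‖ := by
  have h1 := CStarRing.norm_star_mul_self (x := Lg SB φ x)
  have h2 := CStarRing.norm_star_mul_self (x := Lg SB id x)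
  rw [Lg_inner SB hφ, h2] at h1
  nlinarith [norm_nonneg (Lg SB φ x), norm_nonneg (Lg SB id x)]

/-- the isometry of `W` (as a right module) shifting rows by `φ` -/
def Sh (SB : Stabilization A W) (φ : ℕ → ℕ) : W →L[ℂ] W :=
  (Lg SB φ).extendOfNorm (Lg SB id)

lemma Sh_eq (SB : Stabilization A W) {φ : ℕ → ℕ} (hφ : Function.Injective φ) (x : ℕ × ℕ →₀ A) :
    Sh SB φ (Lg SB id x) = Lg SB φ x :=
  LinearMap.extendOfNorm_eq (Lg_dense SB) ⟨1, fun x => by rw [Lg_norm SB hφ, one_mul]⟩ x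

lemma Sh_inner (SB : Stabilization A W) {φ : ℕ → ℕ} (hφ : Function.Injective φ) (x y : W) :
    star (Sh SB φ x) * Sh SB φ y = star x * y := by
  refine (Lg_dense SB).induction_on₂ (p := fun x y => star (Sh SB φ x) * Sh SB φ y = star x * y)
    (isClosed_eq (by fun_prop) (by fun_prop)) ?_ x y
  intro x y
  rw [Sh_eq SB hφ, Sh_eq SB hφ, Lg_inner SB hφ]

lemma Sh_orth (SB : Stabilization A W) {φ ψ : ℕ → ℕ} (hφ : Function.Injective φ)
    (hψ : Function.Injective ψ) (h : ∀ i k, φ i ≠ ψ k) (x y : W) :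
    star (Sh SB φ x) * Sh SB ψ y = 0 := by
  refine (Lg_dense SB).induction_on₂ (p := fun x y => star (Sh SB φ x) * Sh SB ψ y = 0)
    (isClosed_eq (by fun_prop) (by fun_prop)) ?_ x y
  intro x y
  rw [Sh_eq SB hφ, Sh_eq SB hψ, Lg_orth SB h]

lemma Sh_emb (SB : Stabilization A W) {φ : ℕ → ℕ} (hφ : Function.Injective φ) (x : W) {i j : ℕ} {a : A}
    (h : ∀ k, φ k ≠ i) : star (Sh SB φ x) * SB.emb i j a = 0 := by
  refine (Lg_dense SB).induction_on (p := fun x => star (Sh SB φ x) * SB.emb i j a = 0) x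
    (isClosed_eq (by fun_prop) (by fun_prop)) ?_
  intro x
  rw [Sh_eq SB hφ]
  induction x using Finsupp.induction_linear with
  | zero => simp
  | add x x' h h' => simp only [map_add, star_add, add_mul, h, h', add_zero]
  | single p a =>
    simp only [Lg_single, SB.emb_star, SB.emb_mul, if_neg (h _)]

lemma shift_inj (N : ℕ) : Function.Injective fun j : ℕ => j + N := fun a b h => by simpa using h

lemma Sh_far (SB : Stabilization A W) (z : W) {ε : ℝ} (hε : 0 < ε) :
    ∃ (z' : W) (N : ℕ), ‖z - z'‖ < ε ∧ ∀ y, star (Sh SB (fun j => j + N) y) * z' = 0 := by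
  obtain ⟨z', hz', hd⟩ := Metric.mem_closure_iff.1 (SB.dense_span z) ε hε
  have : ∃ N : ℕ, ∀ N', N ≤ N' → ∀ y, star (Sh SB (fun j => j + N') y) * z' = 0 := by
    refine Submodule.span_induction
      (p := fun z' _ => ∃ N : ℕ, ∀ N', N ≤ N' → ∀ y, star (Sh SB (fun j => j + N') y) * z' = 0)
      ?_ ?_ ?_ ?_ hz'
    · rintro _ ⟨i, j, a, rfl⟩
      exact ⟨i + 1, fun N' hN' y => Sh_emb SB (shift_inj N') y fun k => by omega⟩
    · exact ⟨0, fun _ _ _ => mul_zero _⟩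
    · rintro x y _ _ ⟨N, hN⟩ ⟨N', hN'⟩
      exact ⟨max N N', fun K hK z => by
        rw [mul_add, hN _ (le_trans (le_max_left _ _) hK), hN' _ (le_trans (le_max_right _ _) hK), add_zero]⟩
    · rintro c x _ ⟨N, hN⟩
      exact ⟨N, fun K hK z => by rw [mul_smul_comm, hN _ hK, smul_zero]⟩
  obtain ⟨N, hN⟩ := this
  exact ⟨z', N, by rwa [dist_eq_norm] at hd, hN N le_rfl⟩

/-! ### in the unitization -/

/-- `T` with `T* T = a`, with rows in the range of `φ` -/
def mv (SB : Stabilization A W) (φ : ℕ → ℕ) (a : Unitization ℂ W) : Unitization ℂ W :=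
  ((Sh SB φ (rt a).snd : W) : Unitization ℂ W)

lemma mv_mem (SB : Stabilization A W) (φ : ℕ → ℕ) (a : Unitization ℂ W) : mv SB φ a ∈ ran W :=
  inr_mem _

lemma mv_inner (SB : Stabilization A W) {φ : ℕ → ℕ} (hφ : Function.Injective φ) {a : Unitization ℂ W}
    (ha0 : 0 ≤ a) (ha : a ∈ ran W) : star (mv SB φ a) * mv SB φ a = a := by
  have h := ran_eq (ran_rt ha0 ha)
  rw [mv, ← Unitization.inr_star, ← Unitization.inr_mul, Sh_inner SB hφ, Unitization.inr_mul,
    Unitization.inr_star, ← h, rt_star, rt_mul ha0]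

lemma mv_orth (SB : Stabilization A W) {φ ψ : ℕ → ℕ} (hφ : Function.Injective φ)
    (hψ : Function.Injective ψ) (h : ∀ i k, φ i ≠ ψ k) (a b : Unitization ℂ W) :
    star (mv SB φ a) * mv SB ψ b = 0 := by
  rw [mv, mv, ← Unitization.inr_star, ← Unitization.inr_mul, Sh_orth SB hφ hψ h, Unitization.inr_zero]

lemma mv_far (SB : Stabilization A W) {z : Unitization ℂ W} (hz : z ∈ ran W) {ε : ℝ} (hε : 0 < ε) :
    ∃ (z' : Unitization ℂ W) (N : ℕ), z' ∈ ran W ∧ ‖z - z'‖ < ε ∧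
      ∀ a, star (mv SB (fun j => j + N) a) * z' = 0 := by
  obtain ⟨w, rfl⟩ := ran_exists hz
  obtain ⟨z', N, h1, h2⟩ := Sh_far SB w hε
  refine ⟨z', N, inr_mem _, ?_, fun a => ?_⟩
  · rw [← Unitization.inr_sub, Unitization.norm_inr]; exact h1
  · rw [mv, ← Unitization.inr_star, ← Unitization.inr_mul, h2, Unitization.inr_zero]

/-- copy of `a` in rows in the range of `φ` -/
def cpy (SB : Stabilization A W) (φ : ℕ → ℕ) (a : Unitization ℂ W) : Unitization ℂ W :=
  mv SB φ a * star (mv SB φ a)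

lemma cpy_nonneg (SB : Stabilization A W) (φ : ℕ → ℕ) (a : Unitization ℂ W) : 0 ≤ cpy SB φ a :=
  mul_star_self_nonneg _

lemma cpy_mem (SB : Stabilization A W) (φ : ℕ → ℕ) (a : Unitization ℂ W) : cpy SB φ a ∈ ran W :=
  ran_mul_right _ (mv_mem _ _ _)

lemma cpy_le (SB : Stabilization A W) {φ : ℕ → ℕ} (hφ : Function.Injective φ) {a : Unitization ℂ W}
    (ha0 : 0 ≤ a) (ha : a ∈ ran W) : CLE (cpy SB φ a) a := by
  have := CLE.ms (mv SB φ a)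
  rwa [mv_inner SB hφ ha0 ha] at this

lemma le_cpy (SB : Stabilization A W) {φ : ℕ → ℕ} (hφ : Function.Injective φ) {a : Unitization ℂ W}
    (ha0 : 0 ≤ a) (ha : a ∈ ran W) : CLE a (cpy SB φ a) := by
  have := CLE.sm (mv SB φ a)
  rwa [mv_inner SB hφ ha0 ha] at this

lemma cpy_orth (SB : Stabilization A W) {φ ψ : ℕ → ℕ} (hφ : Function.Injective φ)
    (hψ : Function.Injective ψ) (h : ∀ i k, φ i ≠ ψ k) (a b : Unitization ℂ W) :
    cpy SB φ a * cpy SB ψ b = 0 := by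
  rw [cpy, cpy, mul_assoc, ← mul_assoc (star _), mv_orth SB hφ hψ h, zero_mul, mul_zero]

def pr (i : ℕ) : ℕ → ℕ := fun j => Nat.pair i j
lemma pr_inj (i : ℕ) : Function.Injective (pr i) := fun a b h => (Nat.pair_eq_pair.1 h).2
lemma pr_ne {i j : ℕ} (h : i ≠ j) (a b : ℕ) : pr i a ≠ pr j b := fun h' => h (Nat.pair_eq_pair.1 h').1

end Shift

section CuSemi
variable {A W : Type*} [NonUnitalCStarAlgebra A] [PartialOrder A] [StarOrderedRing A]
  [NonUnitalCStarAlgebra W] [PartialOrder W] [StarOrderedRing W]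

/-- positive elements, to be preordered by Cuntz subequivalence -/
def PosT (SB : Stabilization A W) : Type _ := {x : Unitization ℂ W // 0 ≤ x ∧ x ∈ ran W}

def PosT.of (SB : Stabilization A W) (a : Unitization ℂ W) (h : 0 ≤ a ∧ a ∈ ran W) : PosT SB := ⟨a, h⟩

instance instPreorderPosT (SB : Stabilization A W) : Preorder (PosT SB) where
  le x y := CLE x.1 y.1
  le_refl x := CLE.refl _
  le_trans x y z h h' := CLE.trans h h'

/-- the Cuntz semigroup -/
def CuT (SB : Stabilization A W) : Type _ := Antisymmetrization (PosT SB) (· ≤ ·)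

instance instPartialOrderCuT (SB : Stabilization A W) : PartialOrder (CuT SB) :=
  inferInstanceAs (PartialOrder (Antisymmetrization (PosT SB) (· ≤ ·)))

def CuT.of (SB : Stabilization A W) (p : PosT SB) : CuT SB := toAntisymmetrization (α := PosT SB) (· ≤ ·) p

open Classical in
def cu (SB : Stabilization A W) (a : Unitization ℂ W) : CuT SB :=
  if h : 0 ≤ a ∧ a ∈ ran W then CuT.of SB (PosT.of SB a h)
  else CuT.of SB (PosT.of SB 0 ⟨le_rfl, (ran W).zero_mem⟩)

lemma cu_def (SB : Stabilization A W) {a : Unitization ℂ W} (ha : 0 ≤ a) (har : a ∈ ran W) :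
    cu SB a = CuT.of SB (PosT.of SB a ⟨ha, har⟩) := by
  rw [cu, dif_pos ⟨ha, har⟩]

lemma cu_le_iff (SB : Stabilization A W) {a b : Unitization ℂ W} (ha : 0 ≤ a) (har : a ∈ ran W)
    (hb : 0 ≤ b) (hbr : b ∈ ran W) : cu SB a ≤ cu SB b ↔ CLE a b := by
  rw [cu_def SB ha har, cu_def SB hb hbr]
  exact toAntisymmetrization_le_toAntisymmetrization_iff

lemma cu_eq (SB : Stabilization A W) {a b : Unitization ℂ W} (ha : 0 ≤ a) (har : a ∈ ran W)
    (hb : 0 ≤ b) (hbr : b ∈ ran W) (h : CLE a b) (h' : CLE b a) : cu SB a = cu SB b :=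
  le_antisymm ((cu_le_iff SB ha har hb hbr).2 h) ((cu_le_iff SB hb hbr ha har).2 h')

lemma cu_surj (SB : Stabilization A W) (x : CuT SB) :
    ∃ a : Unitization ℂ W, 0 ≤ a ∧ a ∈ ran W ∧ cu SB a = x := by
  have h := toAntisymmetrization_ofAntisymmetrization (α := PosT SB) (· ≤ ·) x
  refine ⟨(ofAntisymmetrization (α := PosT SB) (· ≤ ·) x).1,
    (ofAntisymmetrization (α := PosT SB) (· ≤ ·) x).2.1,
    (ofAntisymmetrization (α := PosT SB) (· ≤ ·) x).2.2, ?_⟩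
  rw [cu_def SB (ofAntisymmetrization (α := PosT SB) (· ≤ ·) x).2.1
    (ofAntisymmetrization (α := PosT SB) (· ≤ ·) x).2.2]
  exact h

def rep (SB : Stabilization A W) (x : CuT SB) : Unitization ℂ W := (cu_surj SB x).choose
lemma rep_nonneg (SB : Stabilization A W) (x : CuT SB) : 0 ≤ rep SB x := (cu_surj SB x).choose_spec.1
lemma rep_mem (SB : Stabilization A W) (x : CuT SB) : rep SB x ∈ ran W := (cu_surj SB x).choose_spec.2.1
lemma cu_rep (SB : Stabilization A W) (x : CuT SB) : cu SB (rep SB x) = x := (cu_surj SB x).choose_spec.2.2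

lemma cu_cpy (SB : Stabilization A W) {φ : ℕ → ℕ} (hφ : Function.Injective φ) {a : Unitization ℂ W}
    (ha : 0 ≤ a) (har : a ∈ ran W) : cu SB (cpy SB φ a) = cu SB a :=
  cu_eq SB (cpy_nonneg _ _ _) (cpy_mem _ _ _) ha har (cpy_le SB hφ ha har) (le_cpy SB hφ ha har)

instance instZeroCuT (SB : Stabilization A W) : Zero (CuT SB) := ⟨cu SB 0⟩
instance instAddCuT (SB : Stabilization A W) : Add (CuT SB) :=
  ⟨fun x y => cu SB (cpy SB (pr 0) (rep SB x) + cpy SB (pr 1) (rep SB y))⟩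

lemma cu_zero (SB : Stabilization A W) : cu SB 0 = 0 := rfl

lemma cu_orth_le (SB : Stabilization A W) {a b a' b' : Unitization ℂ W}
    (ha : 0 ≤ a) (har : a ∈ ran W) (hb : 0 ≤ b) (hbr : b ∈ ran W)
    (ha' : 0 ≤ a') (har' : a' ∈ ran W) (hb' : 0 ≤ b') (hbr' : b' ∈ ran W) (h : a' * b' = 0)
    (h1 : cu SB a ≤ cu SB a') (h2 : cu SB b ≤ cu SB b') : cu SB (a + b) ≤ cu SB (a' + b') := by
  rw [cu_le_iff SB (add_nonneg ha hb) ((ran W).add_mem har hbr) (add_nonneg ha' hb')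
    ((ran W).add_mem har' hbr')]
  exact CLE.add_orth ha' hb' h ((cu_le_iff SB ha har ha' har').1 h1) ((cu_le_iff SB hb hbr hb' hbr').1 h2)

lemma cu_orth (SB : Stabilization A W) {a b : Unitization ℂ W}
    (ha : 0 ≤ a) (har : a ∈ ran W) (hb : 0 ≤ b) (hbr : b ∈ ran W) (h : a * b = 0) :
    cu SB (a + b) = cu SB a + cu SB b := by
  have e0 : cu SB (cpy SB (pr 0) (rep SB (cu SB a))) = cu SB a := by
    rw [cu_cpy SB (pr_inj 0) (rep_nonneg _ _) (rep_mem _ _), cu_rep]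
  have e1 : cu SB (cpy SB (pr 1) (rep SB (cu SB b))) = cu SB b := by
    rw [cu_cpy SB (pr_inj 1) (rep_nonneg _ _) (rep_mem _ _), cu_rep]
  show _ = cu SB (cpy SB (pr 0) (rep SB (cu SB a)) + cpy SB (pr 1) (rep SB (cu SB b)))
  refine le_antisymm ?_ ?_
  · exact cu_orth_le SB ha har hb hbr (cpy_nonneg _ _ _) (cpy_mem _ _ _) (cpy_nonneg _ _ _) (cpy_mem _ _ _)
      (cpy_orth SB (pr_inj 0) (pr_inj 1) (pr_ne (by norm_num)) _ _) e0.ge e1.ge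
  · exact cu_orth_le SB (cpy_nonneg _ _ _) (cpy_mem _ _ _) (cpy_nonneg _ _ _) (cpy_mem _ _ _)
      ha har hb hbr h e0.le e1.le

/-- representatives in prescribed rows -/
lemma cu_row (SB : Stabilization A W) (x : CuT SB) (i : ℕ) :
    cu SB (cpy SB (pr i) (rep SB x)) = x := by
  rw [cu_cpy SB (pr_inj i) (rep_nonneg _ _) (rep_mem _ _), cu_rep]

lemma row_orth (SB : Stabilization A W) (a b : Unitization ℂ W) {i j : ℕ} (h : i ≠ j) :
    cpy SB (pr i) a * cpy SB (pr j) b = 0 :=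
  cpy_orth SB (pr_inj i) (pr_inj j) (pr_ne h) _ _

lemma cu_add_row (SB : Stabilization A W) (x y : CuT SB) {i j : ℕ} (h : i ≠ j) :
    x + y = cu SB (cpy SB (pr i) (rep SB x) + cpy SB (pr j) (rep SB y)) := by
  rw [cu_orth SB (cpy_nonneg _ _ _) (cpy_mem _ _ _) (cpy_nonneg _ _ _) (cpy_mem _ _ _) (row_orth SB _ _ h),
    cu_row, cu_row]

lemma CuT_nonneg (SB : Stabilization A W) (x : CuT SB) : 0 ≤ x := by
  rw [← cu_rep SB x, ← cu_zero, cu_le_iff SB le_rfl (ran W).zero_mem (rep_nonneg _ _) (rep_mem _ _)]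
  exact CLE.zero _

lemma CuT_add_comm (SB : Stabilization A W) (x y : CuT SB) : x + y = y + x := by
  rw [cu_add_row SB x y (i := 0) (j := 1) (by norm_num), cu_add_row SB y x (i := 1) (j := 0) (by norm_num),
    add_comm]

lemma CuT_zero_add (SB : Stabilization A W) (x : CuT SB) : 0 + x = x := by
  have := cu_orth SB le_rfl (ran W).zero_mem (rep_nonneg SB x) (rep_mem SB x) (zero_mul _)
  rw [zero_add, cu_rep, cu_zero] at this
  exact this.symm

lemma CuT_add_assoc (SB : Stabilization A W) (x y z : CuT SB) : x + y + z = x + (y + z) := by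
  have h01 := row_orth SB (rep SB x) (rep SB y) (i := 0) (j := 1) (by norm_num)
  have h02 := row_orth SB (rep SB x) (rep SB z) (i := 0) (j := 2) (by norm_num)
  have h12 := row_orth SB (rep SB y) (rep SB z) (i := 1) (j := 2) (by norm_num)
  have nx := cpy_nonneg SB (pr 0) (rep SB x)
  have ny := cpy_nonneg SB (pr 1) (rep SB y)
  have nz := cpy_nonneg SB (pr 2) (rep SB z)
  have mx := cpy_mem SB (pr 0) (rep SB x)
  have my := cpy_mem SB (pr 1) (rep SB y)
  have mz := cpy_mem SB (pr 2) (rep SB z)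
  have e1 := cu_orth SB (add_nonneg nx ny) ((ran W).add_mem mx my) nz mz (by rw [add_mul, h02, h12, add_zero])
  have e2 := cu_orth SB nx mx (add_nonneg ny nz) ((ran W).add_mem my mz) (by rw [mul_add, h01, h02, add_zero])
  rw [cu_orth SB nx mx ny my h01, cu_row, cu_row, cu_row] at e1
  rw [cu_orth SB ny my nz mz h12, cu_row, cu_row, cu_row] at e2
  rw [← e1, ← e2, add_assoc]

instance instAddCommMonoidCuT (SB : Stabilization A W) : AddCommMonoid (CuT SB) where
  add_assoc := CuT_add_assoc SB
  zero_add := CuT_zero_add SB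
  add_zero x := by rw [CuT_add_comm, CuT_zero_add]
  add_comm := CuT_add_comm SB
  nsmul := nsmulRec

instance instOrderedCuT (SB : Stabilization A W) : IsOrderedAddMonoid (CuT SB) where
  add_le_add_left x y h z := by
    rw [cu_add_row SB x z (i := 0) (j := 1) (by norm_num), cu_add_row SB y z (i := 0) (j := 1) (by norm_num)]
    refine cu_orth_le SB (cpy_nonneg _ _ _) (cpy_mem _ _ _) (cpy_nonneg _ _ _) (cpy_mem _ _ _)
      (cpy_nonneg _ _ _) (cpy_mem _ _ _) (cpy_nonneg _ _ _) (cpy_mem _ _ _) (row_orth SB _ _ (by norm_num)) ?_ le_rfl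
    rw [cu_row, cu_row]; exact h

lemma cu_add (SB : Stabilization A W) {a b : Unitization ℂ W}
    (ha : 0 ≤ a) (har : a ∈ ran W) (hb : 0 ≤ b) (hbr : b ∈ ran W) :
    cu SB (a + b) ≤ cu SB a + cu SB b := by
  have h01 := row_orth SB a b (i := 0) (j := 1) (by norm_num)
  have h := cu_orth SB (cpy_nonneg SB (pr 0) a) (cpy_mem _ _ _) (cpy_nonneg _ _ _) (cpy_mem _ _ _) h01
  rw [cu_cpy SB (pr_inj 0) ha har, cu_cpy SB (pr_inj 1) hb hbr] at h
  rw [← h, cu_le_iff SB (add_nonneg ha hb) ((ran W).add_mem har hbr)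
    (add_nonneg (cpy_nonneg _ _ _) (cpy_nonneg _ _ _)) ((ran W).add_mem (cpy_mem _ _ _) (cpy_mem _ _ _))]
  obtain ⟨T, hT⟩ : ∃ T, T = mv SB (pr 0) a + mv SB (pr 1) b := ⟨_, rfl⟩
  have e1 : star T * T = a + b := by
    rw [hT, star_add, add_mul, mul_add, mul_add, mv_inner SB (pr_inj 0) ha har,
      mv_inner SB (pr_inj 1) hb hbr, mv_orth SB (pr_inj 0) (pr_inj 1) (pr_ne (by norm_num)),
      mv_orth SB (pr_inj 1) (pr_inj 0) (pr_ne (by norm_num))]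
    abel
  have e2 := two_mul_le (star (mv SB (pr 0) a)) (star (mv SB (pr 1) b))
  rw [← star_add, star_star, star_star, star_star, ← hT, ← smul_add] at e2
  have := CLE.sm T
  rw [e1] at this
  exact this.trans ((CLE.of_le (mul_star_self_nonneg _) e2).trans (CLE.smul_left 2 zero_le_two))

lemma cu_sum (SB : Stabilization A W) {ι : Type*} (s : Finset ι) (f : ι → Unitization ℂ W)
    (h0 : ∀ i, 0 ≤ f i) (hr : ∀ i, f i ∈ ran W) (ho : ∀ i j, i ≠ j → f i * f j = 0) :
    cu SB (∑ i ∈ s, f i) = ∑ i ∈ s, cu SB (f i) := by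
  classical
  induction s using Finset.induction_on with
  | empty => simp [cu_zero]
  | insert a s ha ih =>
    rw [Finset.sum_insert ha, Finset.sum_insert ha, ← ih]
    refine cu_orth SB (h0 _) (hr _) (Finset.sum_nonneg fun i _ => h0 i) ((ran W).sum_mem fun i _ => hr i) ?_
    rw [Finset.mul_sum]
    exact Finset.sum_eq_zero fun i hi => ho _ _ (by rintro rfl; exact ha hi)

lemma cuntzLE_cu (SB : Stabilization A W) {a b : W} (ha : 0 ≤ a) (hb : 0 ≤ b) :
    CuntzLE a b ↔ cu SB (a : Unitization ℂ W) ≤ cu SB (b : Unitization ℂ W) := by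
  rw [cuntzLE_iff ha, cu_le_iff SB (Unitization.inr_nonneg_iff.2 ha) (inr_mem _)
    (Unitization.inr_nonneg_iff.2 hb) (inr_mem _)]

lemma cu_fold (SB : Stabilization A W) {n : ℕ} {a c : W} (ha : 0 ≤ a) (h : IsNFoldRep n a c) :
    0 ≤ c ∧ cu SB (c : Unitization ℂ W) = n • cu SB (a : Unitization ℂ W) := by
  obtain ⟨f, h0, h1, h2, rfl⟩ := h
  refine ⟨Finset.sum_nonneg fun i _ => h0 i, ?_⟩
  have e : ((∑ i, f i : W) : Unitization ℂ W) = ∑ i, (f i : Unitization ℂ W) :=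
    map_sum (Unitization.inrHom ℂ ℂ W) f Finset.univ
  rw [e, cu_sum SB _ _ (fun i => Unitization.inr_nonneg_iff.2 (h0 i)) (fun i => inr_mem _)
    (fun i j hij => by rw [← Unitization.inr_mul, h2 i j hij, Unitization.inr_zero])]
  rw [Finset.sum_congr rfl (g := fun _ => cu SB (a : Unitization ℂ W)) fun i _ =>
    le_antisymm ((cuntzLE_cu SB (h0 i) ha).1 (h1 i).1) ((cuntzLE_cu SB ha (h0 i)).1 (h1 i).2)]
  simp

lemma exists_fold (SB : Stabilization A W) (n : ℕ) {a : W} (ha : 0 ≤ a) :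
    ∃ c, IsNFoldRep n a c := by
  have ha' := Unitization.inr_nonneg_iff.2 ha
  refine ⟨_, fun i => (cpy SB (pr i) (a : Unitization ℂ W)).snd, fun i => ?_, fun i => ?_, fun i j hij => ?_, rfl⟩
  · rw [← Unitization.inr_nonneg_iff (A := W), ← ran_eq (cpy_mem _ _ _)]
    exact cpy_nonneg _ _ _
  · have h0 : 0 ≤ (cpy SB (pr i) (a : Unitization ℂ W)).snd := by
      rw [← Unitization.inr_nonneg_iff (A := W), ← ran_eq (cpy_mem _ _ _)]
      exact cpy_nonneg _ _ _
    constructor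
    · rw [cuntzLE_iff h0, ← ran_eq (cpy_mem _ _ _)]
      exact cpy_le SB (pr_inj _) ha' (inr_mem _)
    · rw [cuntzLE_iff ha, ← ran_eq (cpy_mem _ _ _)]
      exact le_cpy SB (pr_inj _) ha' (inr_mem _)
  · apply Unitization.inr_injective (R := ℂ)
    rw [Unitization.inr_mul, ← ran_eq (cpy_mem _ _ _), ← ran_eq (cpy_mem _ _ _), Unitization.inr_zero]
    exact row_orth SB _ _ (by simpa [Fin.ext_iff] using hij)

lemma CuT_AU (SB : Stabilization A W) (hAU : AlmostUnperforated W) (k : ℕ) (x y : CuT SB) (hk : 1 ≤ k)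
    (h : (k + 1) • x ≤ k • y) : x ≤ y := by
  obtain ⟨a, ha, har, rfl⟩ := cu_surj SB x
  obtain ⟨b, hb, hbr, rfl⟩ := cu_surj SB y
  obtain ⟨a, rfl⟩ := ran_exists har
  obtain ⟨b, rfl⟩ := ran_exists hbr
  rw [Unitization.inr_nonneg_iff] at ha hb
  rw [← cuntzLE_cu SB ha hb]
  obtain ⟨c, hc⟩ := exists_fold SB (k + 1) ha
  obtain ⟨d, hd⟩ := exists_fold SB k hb
  refine hAU a b k hk ha hb ⟨c, d, hc, hd, ?_⟩
  obtain ⟨hc0, hc1⟩ := cu_fold SB ha hc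
  obtain ⟨hd0, hd1⟩ := cu_fold SB hb hd
  rw [cuntzLE_cu SB hc0 hd0, hc1, hd1]
  exact h

end CuSemi

section WayBelow
variable {A W : Type*} [NonUnitalCStarAlgebra A] [PartialOrder A] [StarOrderedRing A]
  [NonUnitalCStarAlgebra W] [PartialOrder W] [StarOrderedRing W]

lemma exists_pos_le {δ : ℕ → ℝ} (h : ∀ n, 0 < δ n) (m : ℕ) : ∃ e : ℝ, 0 < e ∧ ∀ n, n ≤ m → e ≤ δ n := by
  induction m with
  | zero => exact ⟨δ 0, h 0, fun n hn => by rw [Nat.le_zero.1 hn]⟩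
  | succ m ih =>
    obtain ⟨e, he, h1⟩ := ih
    refine ⟨min e (δ (m + 1)), lt_min he (h _), fun n hn => ?_⟩
    rcases Nat.lt_or_ge m n with h2 | h2
    · obtain rfl : n = m + 1 := by omega
      exact min_le_right _ _
    · exact (min_le_left _ _).trans (h1 n h2)

lemma wb_step (SB : Stabilization A W) {d y : Unitization ℂ W} (hd : 0 ≤ d) (hdr : d ∈ ran W)
    (hy : 0 ≤ y) (hyr : y ∈ ran W) (h : CLE d y) {τ : ℝ} (hτ : 0 < τ) :
    ∃ d' : Unitization ℂ W, 0 ≤ d' ∧ d' ∈ ran W ∧ ‖d - d'‖ ≤ τ ∧ CLE d' y ∧ CLE y d' := by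
  obtain ⟨x, hxr, hx⟩ := cle_ran hd hdr h hτ
  have ho : IsOpen {z : Unitization ℂ W | ‖d - z * y * star z‖ < τ} :=
    isOpen_lt (by fun_prop) continuous_const
  have hxm : star x ∈ {z : Unitization ℂ W | ‖d - z * y * star z‖ < τ} := by
    show ‖d - star x * y * star (star x)‖ < τ
    rwa [star_star]
  obtain ⟨δ, hδ, hball⟩ := Metric.isOpen_iff.1 ho _ hxm
  obtain ⟨z, N, hzr, hz, hzT⟩ := mv_far SB (ran_star hxr) hδ
  have hz' : ‖d - z * y * star z‖ < τ := by
    have : z ∈ Metric.ball (star x) δ := by rwa [Metric.mem_ball, dist_comm, dist_eq_norm]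
    exact hball this
  obtain ⟨T, hT⟩ : ∃ T, T = mv SB (fun j => j + N) y := ⟨_, rfl⟩
  have hTr : T ∈ ran W := by rw [hT]; exact mv_mem _ _ _
  have hTT : star T * T = y := by rw [hT]; exact mv_inner SB (shift_inj N) hy hyr
  have hTz : star T * z = 0 := by rw [hT]; exact hzT y
  have hzT' : star z * T = 0 := by have := congrArg star hTz; simpa using this
  have hc : Continuous fun μ : ℝ => ‖d - (z * rt y + μ • T) * star (z * rt y + μ • T)‖ := by fun_prop
  have h0 : ‖d - (z * rt y + (0 : ℝ) • T) * star (z * rt y + (0 : ℝ) • T)‖ < τ := by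
    rw [zero_smul, add_zero, star_mul, rt_star]
    have : z * rt y * (rt y * star z) = z * y * star z := by
      nth_rewrite 3 [← rt_mul hy]; simp only [mul_assoc]
    rwa [this]
  have hev : ∀ᶠ μ in 𝓝[>] (0 : ℝ), ‖d - (z * rt y + μ • T) * star (z * rt y + μ • T)‖ < τ :=
    (hc.continuousAt.eventually_lt continuousAt_const h0).filter_mono nhdsWithin_le_nhds
  obtain ⟨μ, hμ, hμ0⟩ := (hev.and self_mem_nhdsWithin).exists
  have hμ0 : 0 < μ := hμ0
  obtain ⟨r, hr⟩ : ∃ r, r = z * rt y + μ • T := ⟨_, rfl⟩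
  rw [← hr] at hμ
  have hrr : star r * r = star (rt y) * (star z * z) * rt y + (μ * μ) • y := by
    rw [hr, star_add, star_mul, star_smul, star_trivial μ, ← hTT, add_mul, mul_add, mul_add]
    have e1 : star (rt (star T * T)) * star z * μ • T = 0 := by
      rw [mul_smul_comm, mul_assoc, hzT', mul_zero, smul_zero]
    have e2 : μ • star T * (z * rt (star T * T)) = 0 := by
      rw [smul_mul_assoc, ← mul_assoc, hTz, zero_mul, smul_zero]
    rw [e1, e2, smul_mul_smul_comm]; simp only [mul_assoc, add_zero, zero_add]
  refine ⟨r * star r, mul_star_self_nonneg _, ?_, hμ.le, (CLE.ms r).trans ?_, CLE.trans ?_ (CLE.sm r)⟩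
  · refine ran_mul_right _ ?_
    rw [hr]; exact (ran W).add_mem (ran_mul_left _ (ran_rt hy hyr)) (ran_smul _ hTr)
  · have h1 : star r * r ≤ (‖star z * z‖ + μ * μ) • y := by
      rw [hrr, add_smul]
      gcongr
      have := conj_mono (sa_le_norm (IsSelfAdjoint.star_mul_self z)) (rt y)
      refine this.trans_eq ?_
      rw [rt_star, Algebra.algebraMap_eq_smul_one, mul_smul_comm, smul_mul_assoc, mul_one, rt_mul hy]
    exact (CLE.of_le (star_mul_self_nonneg _) h1).trans (CLE.smul_left _ (by positivity))
  · have h1 : (μ * μ) • y ≤ star r * r := by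
      rw [hrr]; exact le_add_of_nonneg_left (conj_nonneg (star_mul_self_nonneg _) _)
    have h2 : y = (μ * μ)⁻¹ • ((μ * μ) • y) := by
      rw [smul_smul, inv_mul_cancel₀ (by positivity), one_smul]
    have h3 : CLE ((μ * μ)⁻¹ • ((μ * μ) • y)) ((μ * μ) • y) := CLE.smul_left _ (by positivity)
    rw [← h2] at h3
    exact h3.trans (CLE.of_le (smul_nonneg (by positivity) hy) h1)

lemma sup_exists (SB : Stabilization A W) (y : ℕ → Unitization ℂ W) (hy : ∀ n, 0 ≤ y n)
    (hyr : ∀ n, y n ∈ ran W) (hmono : ∀ n, CLE (y n) (y (n + 1))) :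
    ∃ d : Unitization ℂ W, 0 ≤ d ∧ d ∈ ran W ∧ (∀ n, CLE (y n) d) ∧
      ∀ ε : ℝ, 0 < ε → ∃ n, CLE (cut ε d) (y n) := by
  have hmono' : ∀ m n, n ≤ m → CLE (y n) (y m) := by
    intro m n h
    induction m, h using Nat.le_induction with
    | base => exact CLE.refl _
    | succ m h ih => exact ih.trans (hmono m)
  obtain ⟨Q, hQ⟩ : ∃ Q : ℕ → Unitization ℂ W × ℝ → Prop, Q = fun m p => 0 ≤ p.1 ∧ p.1 ∈ ran W ∧
      CLE p.1 (y m) ∧ 0 < p.2 ∧ ∀ n, n ≤ m → CLE (cut (1 / ((m : ℝ) + 1)) (y n)) (cut p.2 p.1) := ⟨_, rfl⟩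
  have hmk : ∀ m (d : Unitization ℂ W) (e : ℝ), 0 < e → 0 ≤ d → d ∈ ran W → CLE d (y m) → CLE (y m) d →
      ∃ e', 0 < e' ∧ e' ≤ e ∧ Q m (d, e') := by
    intro m d e he hd hdr h1 h2
    have : ∀ n, ∃ δ : ℝ, 0 < δ ∧ (n ≤ m → CLE (cut (1 / ((m : ℝ) + 1)) (y n)) (cut δ d)) := by
      intro n
      by_cases hn : n ≤ m
      · obtain ⟨δ, hδ, h⟩ := CLE.cut_cut (hy n) hd ((hmono' m n hn).trans h2)
          (ε := 1 / ((m : ℝ) + 1)) (by positivity)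
        exact ⟨δ, hδ, fun _ => h⟩
      · exact ⟨1, one_pos, fun h => absurd h hn⟩
    choose δ hδ hδ' using this
    obtain ⟨e', he', hle⟩ := exists_pos_le hδ m
    refine ⟨min e e', lt_min he he', min_le_left _ _, ?_⟩
    rw [hQ]
    exact ⟨hd, hdr, h1, lt_min he he', fun n hn => (hδ' n hn).trans
      (CLE.cut_cut_le hd ((min_le_right _ _).trans (hle n hn)))⟩
  have hstep : ∀ m (p : {p // Q m p}), ∃ p' : {p // Q (m + 1) p},
      ‖p.1.1 - p'.1.1‖ ≤ p.1.2 / 2 ∧ p'.1.2 ≤ p.1.2 / 2 := by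
    rintro m ⟨⟨d, e⟩, hp⟩
    have hp' := hp
    rw [hQ] at hp'
    obtain ⟨h1, h2, h3, h4, h5⟩ := hp'
    simp only at h1 h2 h3 h4 h5
    obtain ⟨d', g1, g2, g3, g4, g5⟩ := wb_step SB h1 h2 (hy (m + 1)) (hyr (m + 1)) (h3.trans (hmono m))
      (half_pos h4)
    obtain ⟨e', k1, k2, k3⟩ := hmk (m + 1) d' (e / 2) (half_pos h4) g1 g2 g4 g5
    exact ⟨⟨(d', e'), k3⟩, g3, k2⟩
  obtain ⟨e0, _, _, hQ0⟩ := hmk 0 (y 0) 1 one_pos (hy 0) (hyr 0) (CLE.refl _) (CLE.refl _)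
  choose nx hnx1 hnx2 using hstep
  obtain ⟨p, hp0, hps⟩ : ∃ p : ∀ m, {p // Q m p}, p 0 = ⟨(y 0, e0), hQ0⟩ ∧ ∀ m, p (m + 1) = nx m (p m) :=
    ⟨fun m => Nat.rec (motive := fun m => {p // Q m p}) ⟨(y 0, e0), hQ0⟩ nx m, rfl, fun m => rfl⟩
  obtain ⟨D, hD⟩ : ∃ D : ℕ → Unitization ℂ W, D = fun m => (p m).1.1 := ⟨_, rfl⟩
  obtain ⟨e, he⟩ : ∃ e : ℕ → ℝ, e = fun m => (p m).1.2 := ⟨_, rfl⟩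
  have hprop : ∀ m, 0 ≤ D m ∧ D m ∈ ran W ∧ CLE (D m) (y m) ∧ 0 < e m ∧
      ∀ n, n ≤ m → CLE (cut (1 / ((m : ℝ) + 1)) (y n)) (cut (e m) (D m)) := by
    intro m
    have := (p m).2
    generalize hpm : (p m).1 = q at this
    rw [hQ] at this
    rw [hD, he]
    simp only [hpm]
    exact this
  have hDs : ∀ m, ‖D m - D (m + 1)‖ ≤ e m / 2 := by
    intro m; rw [hD, he]; simp only; rw [hps]; exact hnx1 _ _
  have hes : ∀ m, e (m + 1) ≤ e m / 2 := by
    intro m; rw [he]; simp only; rw [hps]; exact hnx2 _ _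
  have hgeo : ∀ m, e m ≤ e 0 / 2 ^ m := by
    intro m
    induction m with
    | zero => simp
    | succ m ih =>
      refine (hes m).trans ?_
      rw [pow_succ, ← div_div]; linarith
  have hcau : CauchySeq D := by
    refine cauchySeq_of_le_geometric_two (C := e 0) fun m => ?_
    rw [dist_eq_norm]
    refine (hDs m).trans ?_
    rw [div_right_comm]; linarith [hgeo m]
  obtain ⟨d, hd⟩ := cauchySeq_tendsto_of_complete hcau
  have hdist : ∀ m k, m ≤ k → ‖D m - D k‖ ≤ e m - e k := by
    intro m k h
    induction k, h using Nat.le_induction with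
    | base => simp
    | succ k h ih =>
      have : D m - D (k + 1) = (D m - D k) + (D k - D (k + 1)) := by abel
      rw [this]
      refine (norm_add_le _ _).trans ?_
      linarith [hDs k, hes k]
  have hlim : ∀ m, ‖D m - d‖ ≤ e m := by
    intro m
    refine le_of_tendsto ((tendsto_const_nhds.sub hd).norm) ?_
    filter_upwards [eventually_ge_atTop m] with k hk
    linarith [hdist m k hk, (hprop k).2.2.2.1]
  have hd0 : 0 ≤ d := CStarAlgebra.isClosed_nonneg.mem_of_tendsto hd (Eventually.of_forall fun m => (hprop m).1)
  have hdr : d ∈ ran W := ran_closed.mem_of_tendsto hd (Eventually.of_forall fun m => (hprop m).2.1)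
  refine ⟨d, hd0, hdr, fun n => CLE.of_cut (hy n) fun ε hε => ?_, fun ε hε => ?_⟩
  · obtain ⟨K, hK⟩ := exists_nat_one_div_lt hε
    have h1 : 1 / (((max n K : ℕ) : ℝ) + 1) ≤ ε := by
      refine le_trans ?_ hK.le
      gcongr
      exact le_max_right _ _
    refine (CLE.cut_cut_le (hy n) h1).trans (((hprop (max n K)).2.2.2.2 n (le_max_left _ _)).trans ?_)
    exact CLE.cut_of_norm (hprop _).1 hd0 (hlim _)
  · have ht : Tendsto (fun m : ℕ => e 0 / 2 ^ m) atTop (𝓝 0) := by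
      have := (tendsto_pow_atTop_nhds_zero_of_lt_one (r := (1 / 2 : ℝ)) (by norm_num) (by norm_num)).const_mul (e 0)
      rw [mul_zero] at this
      refine this.congr fun m => ?_
      rw [one_div, inv_pow]; rfl
    obtain ⟨m, hm⟩ := (ht.eventually (eventually_lt_nhds hε)).exists
    refine ⟨m, CLE.trans (CLE.cut_of_norm hd0 (hprop m).1 ?_) (hprop m).2.2.1⟩
    rw [norm_sub_rev]
    exact (hlim m).trans ((hgeo m).trans hm.le)

lemma wayBelow (SB : Stabilization A W) {a a' : W} (ha : 0 ≤ a) {ε : ℝ} (hε : 0 < ε)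
    (h : (a' : Unitization ℂ W) = cut ε (a : Unitization ℂ W)) : CuntzWayBelow a' a := by
  intro y hy hmono s hs hlub has
  have haU := Unitization.inr_nonneg_iff.2 ha
  obtain ⟨d, hd0, hdr, hd1, hd2⟩ := sup_exists SB (fun n => (y n : Unitization ℂ W))
    (fun n => Unitization.inr_nonneg_iff.2 (hy n)) (fun n => inr_mem _)
    (fun n => (cuntzLE_iff (hy n)).1 (hmono n))
  obtain ⟨d, rfl⟩ := ran_exists hdr
  have hd0' := hd0
  rw [Unitization.inr_nonneg_iff] at hd0'
  have h1 : CuntzLE s d := hlub.2 d hd0' fun n => (cuntzLE_iff (hy n)).2 (hd1 n)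
  have h2 := ((cuntzLE_iff ha).1 has).trans ((cuntzLE_iff hs).1 h1)
  obtain ⟨δ, hδ, h3⟩ := CLE.cut_cut haU hd0 h2 hε
  obtain ⟨n, hn⟩ := hd2 δ hδ
  refine ⟨n, ?_⟩
  have ha'0 : 0 ≤ a' := by rw [← Unitization.inr_nonneg_iff (A := W), h]; exact cut_nonneg haU
  rw [cuntzLE_iff ha'0, h]
  exact h3.trans hn

end WayBelow

section Corner
variable {A W : Type*} [NonUnitalCStarAlgebra A] [PartialOrder A] [StarOrderedRing A]
  [NonUnitalCStarAlgebra W] [PartialOrder W] [StarOrderedRing W]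

/-- the corner embedding -/
def e00 (SB : Stabilization A W) : A →⋆ₙₐ[ℂ] W where
  toFun := SB.emb 0 0
  map_smul' c x := by simp
  map_zero' := by simp
  map_add' := by simp
  map_mul' x y := by rw [SB.emb_mul, if_pos rfl]
  map_star' x := by rw [SB.emb_star]

/-- its unitization -/
def Ph (SB : Stabilization A W) : Unitization ℂ A →⋆ₐ[ℂ] Unitization ℂ W :=
  Unitization.starMap (e00 SB)

lemma Ph_inr (SB : Stabilization A W) (a : A) :
    Ph SB (a : Unitization ℂ A) = (SB.emb 0 0 a : Unitization ℂ W) := by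
  rw [Ph, Unitization.starMap_inr]; rfl

lemma Ph_inj (SB : Stabilization A W) : Function.Injective (Ph SB) := by
  refine Unitization.starMap_injective ?_
  rw [injective_iff_map_eq_zero]
  intro a ha
  have h := SB.norm_emb 0 0 a
  rw [show SB.emb 0 0 a = 0 from ha, norm_zero] at h
  exact norm_eq_zero.1 h.symm

lemma Ph_norm (SB : Stabilization A W) (x : Unitization ℂ A) : ‖Ph SB x‖ = ‖x‖ :=
  NonUnitalStarAlgHom.norm_map (Ph SB) (Ph_inj SB) x

lemma Ph_isom (SB : Stabilization A W) : Isometry (Ph SB) :=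
  NonUnitalStarAlgHom.isometry (Ph SB) (Ph_inj SB)

lemma Ph_mem (SB : Stabilization A W) {x : Unitization ℂ A} (h : x ∈ ran A) : Ph SB x ∈ ran W := by
  obtain ⟨a, rfl⟩ := ran_exists h
  rw [Ph_inr]; exact inr_mem _

lemma Ph_nonneg (SB : Stabilization A W) {x : Unitization ℂ A} (h : 0 ≤ x) : 0 ≤ Ph SB x := by
  have : x = star (rt x) * rt x := by rw [rt_star, rt_mul h]
  rw [this, map_mul, map_star]
  exact star_mul_self_nonneg _

lemma Ph_cfc (SB : Stabilization A W) {f : ℝ → ℝ} (hf : Continuous f) {x : Unitization ℂ A} (h : 0 ≤ x) :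
    Ph SB (cfc f x) = cfc f (Ph SB x) :=
  StarAlgHomClass.map_cfc (Ph SB) f x (hf.continuousOn) (Ph_isom SB).continuous (IsSelfAdjoint.of_nonneg h)
    ((IsSelfAdjoint.of_nonneg h).map (Ph SB))

lemma Ph_cut (SB : Stabilization A W) (ε : ℝ) {x : Unitization ℂ A} (h : 0 ≤ x) :
    Ph SB (cut ε x) = cut ε (Ph SB x) := Ph_cfc SB (cutf_cont _) h

lemma Ph_rmp (SB : Stabilization A W) (s t : ℝ) {x : Unitization ℂ A} (h : 0 ≤ x) :
    Ph SB (rmp s t x) = rmp s t (Ph SB x) := Ph_cfc SB (ramp_cont _ _) h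

lemma Ph_image_closed (SB : Stabilization A W) :
    IsClosed (Ph SB '' (ran A : Set (Unitization ℂ A))) :=
  (Ph_isom SB).isClosedEmbedding.isClosedMap _ ran_closed

lemma Ph_corner (SB : Stabilization A W) {p q : Unitization ℂ A} (hp : p ∈ ran A) (hq : q ∈ ran A)
    (x : Unitization ℂ W) : ∃ r ∈ ran A, Ph SB r = Ph SB p * x * Ph SB q := by
  have key : ∀ w : W, ∃ r ∈ ran A, Ph SB r = Ph SB p * (w : Unitization ℂ W) * Ph SB q := by
    intro w
    have hcl : IsClosed {w : W | Ph SB p * (w : Unitization ℂ W) * Ph SB q ∈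
        Ph SB '' (ran A : Set (Unitization ℂ A))} := by
      refine (Ph_image_closed SB).preimage ?_
      have : Continuous fun w : W => (w : Unitization ℂ W) := (Unitization.isometry_inr (𝕜 := ℂ) (A := W)).continuous
      fun_prop
    have hsub : (Submodule.span ℂ {w | ∃ i j a, w = SB.emb i j a} : Set W) ⊆
        {w : W | Ph SB p * (w : Unitization ℂ W) * Ph SB q ∈ Ph SB '' (ran A : Set (Unitization ℂ A))} := by
      intro w hw
      refine Submodule.span_induction (p := fun w _ => w ∈ {w : W | Ph SB p * (w : Unitization ℂ W) * Ph SB q ∈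
        Ph SB '' (ran A : Set (Unitization ℂ A))}) ?_ ?_ ?_ ?_ hw
      · rintro _ ⟨i, j, a, rfl⟩
        obtain ⟨p, rfl⟩ := ran_exists hp
        obtain ⟨q, rfl⟩ := ran_exists hq
        show Ph SB p * (SB.emb i j a : Unitization ℂ W) * Ph SB q ∈ Ph SB '' (ran A : Set (Unitization ℂ A))
        rw [Ph_inr, Ph_inr, ← Unitization.inr_mul, ← Unitization.inr_mul, SB.emb_mul]
        split_ifs with h
        · rw [SB.emb_mul]
          split_ifs with h'
          · exact ⟨_, inr_mem _, Ph_inr SB _⟩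
          · exact ⟨0, (ran A).zero_mem, by simp⟩
        · exact ⟨0, (ran A).zero_mem, by simp⟩
      · exact ⟨0, (ran A).zero_mem, by simp⟩
      · rintro x y _ _ ⟨r, hr, hr'⟩ ⟨s, hs, hs'⟩
        exact ⟨r + s, (ran A).add_mem hr hs, by
          rw [map_add, hr', hs', Unitization.inr_add, mul_add, add_mul]⟩
      · rintro c x _ ⟨r, hr, hr'⟩
        refine ⟨c • r, ?_, ?_⟩
        · show c • r ∈ ran A
          rw [mem_ran] at *; simp [show r.fst = 0 from hr]
        · rw [map_smul, hr', Unitization.inr_smul, mul_smul_comm, smul_mul_assoc]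
    have := hcl.closure_subset_iff.2 hsub (SB.dense_span w)
    obtain ⟨r, hr, hr'⟩ := this
    exact ⟨r, hr, hr'⟩
  obtain ⟨r, hr, hr'⟩ := key x.snd
  refine ⟨x.fst • (p * q) + r, (ran A).add_mem ?_ hr, ?_⟩
  · have := ran_mul_left p hq
    rw [mem_ran] at *; simp [this, hp]
  · have e : x = x.fst • (1 : Unitization ℂ W) + (x.snd : Unitization ℂ W) := by
      ext <;> simp
    nth_rewrite 2 [e]
    rw [map_add, map_smul, map_mul, hr', mul_add, add_mul, mul_smul_comm, smul_mul_assoc, mul_one]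

lemma Ph_cle (SB : Stabilization A W) {a b : Unitization ℂ A} (h : CLE a b) : CLE (Ph SB a) (Ph SB b) := by
  intro ε hε
  obtain ⟨x, hx⟩ := h ε hε
  refine ⟨Ph SB x, ?_⟩
  rw [← map_star, ← map_mul, ← map_mul, ← map_sub, Ph_norm]
  exact hx

lemma Ph_cle_rev (SB : Stabilization A W) {a b : Unitization ℂ A} (ha : 0 ≤ a) (har : a ∈ ran A)
    (hb : 0 ≤ b) (hbr : b ∈ ran A) (h : CLE (Ph SB a) (Ph SB b)) : CLE a b := by
  intro ε hε
  obtain ⟨x, hx⟩ := h (ε / 4) (by linarith)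
  obtain ⟨u, hu⟩ : ∃ u, u = rmp (ε / 8) (2 * (ε / 8)) a := ⟨_, rfl⟩
  have hur : u ∈ ran A := by rw [hu]; exact ran_rmp (by linarith) ha har
  have hus : star u = u := by rw [hu]; exact rmp_star _ _ _
  have hun : ‖Ph SB u‖ ≤ 1 := by rw [Ph_norm, hu]; exact rmp_norm ha
  have h1 : ‖a - u * a * u‖ ≤ 2 * (ε / 8) := by rw [hu]; exact rmp_mul_approx (by linarith) ha
  obtain ⟨κ, hκ⟩ : ∃ κ, κ = ε / (8 * (‖x‖ ^ 2 + 1)) := ⟨_, rfl⟩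
  have hκ0 : 0 < κ := by rw [hκ]; positivity
  obtain ⟨v, hv⟩ : ∃ v, v = rmp κ (2 * κ) b := ⟨_, rfl⟩
  have hvr : v ∈ ran A := by rw [hv]; exact ran_rmp hκ0 hb hbr
  have hvs : star v = v := by rw [hv]; exact rmp_star _ _ _
  have h2 : ‖b - v * b * v‖ ≤ 2 * κ := by rw [hv]; exact rmp_mul_approx hκ0 hb
  obtain ⟨r, hr, hr'⟩ := Ph_corner SB hvr hur x
  refine ⟨r, ?_⟩
  have hus' : star (Ph SB u) = Ph SB u := by rw [← map_star, hus]
  have hvs' : star (Ph SB v) = Ph SB v := by rw [← map_star, hvs]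
  rw [← Ph_norm SB, map_sub, map_mul, map_mul, map_star, hr']
  have e : Ph SB a - star (Ph SB v * x * Ph SB u) * Ph SB b * (Ph SB v * x * Ph SB u) =
      Ph SB (a - u * a * u) + (star (Ph SB u) * (Ph SB a - star x * Ph SB b * x) * Ph SB u +
        star (x * Ph SB u) * Ph SB (b - v * b * v) * (x * Ph SB u)) := by
    simp only [map_sub, map_mul, star_mul, hus', hvs']
    noncomm_ring
  rw [e]
  have n1 := norm_conj_le (Ph SB u) (Ph SB a - star x * Ph SB b * x)
  have n2 := norm_conj_le (x * Ph SB u) (Ph SB (b - v * b * v))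
  rw [Ph_norm SB (b - _)] at n2
  have n3 : ‖x * Ph SB u‖ ≤ ‖x‖ := by
    refine (norm_mul_le _ _).trans ?_
    nlinarith [norm_nonneg x]
  have n4 : ‖Ph SB a - star x * Ph SB b * x‖ * ‖Ph SB u‖ ^ 2 ≤ ‖Ph SB a - star x * Ph SB b * x‖ * 1 := by
    gcongr; exact pow_le_one₀ (norm_nonneg _) hun
  have n5 : ‖b - v * b * v‖ * ‖x * Ph SB u‖ ^ 2 ≤ 2 * κ * (‖x‖ ^ 2 + 1) := by
    gcongr
    have : ‖x * Ph SB u‖ ^ 2 ≤ ‖x‖ ^ 2 := by gcongr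
    linarith
  have n6 : 2 * κ * (‖x‖ ^ 2 + 1) = ε / 4 := by
    rw [hκ]; field_simp; norm_num
  refine (norm_add_le _ _).trans_lt ?_
  have n7 := norm_add_le (star (Ph SB u) * (Ph SB a - star x * Ph SB b * x) * Ph SB u)
        (star (x * Ph SB u) * Ph SB (b - v * b * v) * (x * Ph SB u))
  rw [Ph_norm]
  linarith

end Corner

section Full
variable {A W : Type*} [NonUnitalCStarAlgebra A] [PartialOrder A] [StarOrderedRing A]
  [NonUnitalCStarAlgebra W] [PartialOrder W] [StarOrderedRing W]

lemma inr_cont (R : Type*) [NonUnitalCStarAlgebra R] : Continuous fun w : R => (w : Unitization ℂ R) :=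
  (Unitization.isometry_inr (𝕜 := ℂ) (A := R)).continuous

lemma alg_mono {M : Type*} [CStarAlgebra M] [PartialOrder M] [StarOrderedRing M] {r s : ℝ} (h : r ≤ s) :
    algebraMap ℝ M r ≤ algebraMap ℝ M s := by
  have := alg_nonneg (M := M) (sub_nonneg.2 h)
  rw [map_sub] at this
  exact sub_nonneg.1 this

/-- additive group generated by `p a q` -/
def SG (a : Unitization ℂ A) : AddSubgroup (Unitization ℂ A) :=
  AddSubgroup.closure {x | ∃ p q, x = p * a * q}

lemma SG_mul_left (a m : Unitization ℂ A) {x : Unitization ℂ A} (h : x ∈ SG a) : m * x ∈ SG a := by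
  induction h using AddSubgroup.closure_induction with
  | mem x hx =>
    obtain ⟨p, q, rfl⟩ := hx
    exact AddSubgroup.subset_closure ⟨m * p, q, by noncomm_ring⟩
  | zero => rw [mul_zero]; exact zero_mem _
  | add x y _ _ h1 h2 => rw [mul_add]; exact add_mem h1 h2
  | neg x _ h => rw [mul_neg]; exact neg_mem h

lemma SG_mul_right (a m : Unitization ℂ A) {x : Unitization ℂ A} (h : x ∈ SG a) : x * m ∈ SG a := by
  induction h using AddSubgroup.closure_induction with
  | mem x hx =>
    obtain ⟨p, q, rfl⟩ := hx
    exact AddSubgroup.subset_closure ⟨p, q * m, by noncomm_ring⟩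
  | zero => rw [zero_mul]; exact zero_mem _
  | add x y _ _ h1 h2 => rw [add_mul]; exact add_mem h1 h2
  | neg x _ h => rw [neg_mul]; exact neg_mem h

lemma SG_dense (hs : IsSimpleCStar A) {a : Unitization ℂ A} (har : a ∈ ran A) (hne : a ≠ 0)
    {b : Unitization ℂ A} (hbr : b ∈ ran A) : b ∈ closure (SG a : Set (Unitization ℂ A)) := by
  obtain ⟨a, rfl⟩ := ran_exists har
  obtain ⟨b, rfl⟩ := ran_exists hbr
  obtain ⟨T, hT⟩ : ∃ T, T = (SG (a : Unitization ℂ A)).topologicalClosure := ⟨_, rfl⟩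
  have hTc : ∀ x, x ∈ T ↔ x ∈ closure (SG (a : Unitization ℂ A) : Set (Unitization ℂ A)) := by
    intro x; rw [hT]; rfl
  have hl : ∀ m x, x ∈ T → m * x ∈ T := by
    intro m x hx
    rw [hTc] at *
    exact map_mem_closure (by fun_prop : Continuous fun x => m * x) hx fun y hy => SG_mul_left _ m hy
  have hr : ∀ m x, x ∈ T → x * m ∈ T := by
    intro m x hx
    rw [hTc] at *
    exact map_mem_closure (f := fun x => x * m) (by fun_prop) hx fun y hy => SG_mul_right _ m hy
  obtain ⟨J, hJ⟩ : ∃ J : TwoSidedIdeal A, (J : Set A) = {b : A | (b : Unitization ℂ A) ∈ T} :=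
    ⟨TwoSidedIdeal.mk' {b : A | (b : Unitization ℂ A) ∈ T} (by simp [T.zero_mem])
      (fun {x y} h1 h2 => by
        show ((x + y : A) : Unitization ℂ A) ∈ T
        rw [Unitization.inr_add]; exact T.add_mem h1 h2)
      (fun {x} h1 => by
        show ((-x : A) : Unitization ℂ A) ∈ T
        rw [Unitization.inr_neg]; exact T.neg_mem h1)
      (fun {x y} h => by
        show ((x * y : A) : Unitization ℂ A) ∈ T
        rw [Unitization.inr_mul]; exact hl _ _ h)
      (fun {x y} h => by
        show ((x * y : A) : Unitization ℂ A) ∈ T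
        rw [Unitization.inr_mul]; exact hr _ _ h), TwoSidedIdeal.coe_mk' _ _ _ _ _ _⟩
  have hcl : IsClosed (J : Set A) := by
    rw [hJ]
    have : IsClosed (T : Set (Unitization ℂ A)) := by
      rw [hT]; exact AddSubgroup.isClosed_topologicalClosure _
    exact this.preimage (inr_cont A)
  have haJ : a ∈ (J : Set A) := by
    rw [hJ]
    show (a : Unitization ℂ A) ∈ T
    rw [hTc]
    exact subset_closure (AddSubgroup.subset_closure ⟨1, 1, by simp⟩)
  rcases hs.2 J hcl with h | h
  · rw [h] at haJ
    exact absurd (by rw [Set.mem_singleton_iff.1 haJ, Unitization.inr_zero]) hne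
  · have : b ∈ (J : Set A) := by rw [h]; trivial
    rw [hJ] at this
    exact (hTc _).1 this

lemma SG_bound (SB : Stabilization A W) {a : Unitization ℂ A} (har : a ∈ ran A) (ha : 0 ≤ a)
    {x : Unitization ℂ A} (h : x ∈ SG a) : ∃ (m : ℕ) (c : Unitization ℂ A), c ∈ ran A ∧ 0 ≤ c ∧
      x + star x ≤ c ∧ -(x + star x) ≤ c ∧ cu SB (Ph SB c) ≤ m • cu SB (Ph SB a) := by
  have hadd : ∀ c d : Unitization ℂ A, c ∈ ran A → 0 ≤ c → d ∈ ran A → 0 ≤ d →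
      cu SB (Ph SB (c + d)) ≤ cu SB (Ph SB c) + cu SB (Ph SB d) := by
    intro c d hc hc0 hd hd0
    rw [map_add]
    exact cu_add SB (Ph_nonneg SB hc0) (Ph_mem SB hc) (Ph_nonneg SB hd0) (Ph_mem SB hd)
  induction h using AddSubgroup.closure_induction with
  | mem x hx =>
    obtain ⟨p, q, rfl⟩ := hx
    have c0 : ∀ p, 0 ≤ star p * a * p := fun p => conj_nonneg ha p
    have cr : ∀ p, star p * a * p ∈ ran A := fun p => ran_mul_right _ (ran_mul_left _ har)
    have cc : ∀ p, cu SB (Ph SB (star p * a * p)) ≤ cu SB (Ph SB a) := fun p =>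
      (cu_le_iff SB (Ph_nonneg SB (c0 p)) (Ph_mem SB (cr p)) (Ph_nonneg SB ha) (Ph_mem SB har)).2
        (Ph_cle SB (CLE.conj _ _))
    refine ⟨2, star (star p) * a * star p + star q * a * q, (ran A).add_mem (cr _) (cr _),
      add_nonneg (c0 _) (c0 _), ?_, ?_, ?_⟩
    · have := c0 (star p - q)
      rw [← sub_nonneg]
      convert this using 1
      simp only [star_mul, star_sub, star_star, nonneg_sa ha]; noncomm_ring
    · have := c0 (star p + q)
      rw [← sub_nonneg]
      convert this using 1
      simp only [star_mul, star_add, star_star, nonneg_sa ha]; noncomm_ring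
    · rw [two_nsmul]
      exact (hadd _ _ (cr _) (c0 _) (cr _) (c0 _)).trans (add_le_add (cc _) (cc _))
  | zero => exact ⟨0, 0, (ran A).zero_mem, le_rfl, by simp, by simp, by simp [cu_zero]⟩
  | add x y _ _ h k =>
    obtain ⟨m, c, h1, h2, h3, h4, h5⟩ := h
    obtain ⟨n, d, k1, k2, k3, k4, k5⟩ := k
    refine ⟨m + n, c + d, (ran A).add_mem h1 k1, add_nonneg h2 k2, ?_, ?_, ?_⟩
    · convert add_le_add h3 k3 using 1
      rw [star_add]; abel
    · convert add_le_add h4 k4 using 1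
      rw [star_add]; abel
    · rw [add_nsmul]
      exact (hadd _ _ h1 h2 k1 k2).trans (add_le_add h5 k5)
  | neg x _ h =>
    obtain ⟨m, c, h1, h2, h3, h4, h5⟩ := h
    refine ⟨m, c, h1, h2, ?_, ?_, h5⟩
    · rwa [star_neg, ← neg_add]
    · rwa [star_neg, ← neg_add, neg_neg]

lemma cu_full (SB : Stabilization A W) (hs : IsSimpleCStar A) {a b : Unitization ℂ A} (har : a ∈ ran A)
    (ha : 0 ≤ a) (hbr : b ∈ ran A) (hb : 0 ≤ b) (hne : a ≠ 0) {ε : ℝ} (hε : 0 < ε) :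
    ∃ m : ℕ, cu SB (Ph SB (cut ε b)) ≤ m • cu SB (Ph SB a) := by
  obtain ⟨x, hx, hxb⟩ := Metric.mem_closure_iff.1 (SG_dense hs har hne hbr) ε hε
  rw [dist_eq_norm] at hxb
  obtain ⟨m, c, h1, h2, h3, h4, h5⟩ := SG_bound SB har ha hx
  refine ⟨m, le_trans ?_ h5⟩
  rw [cu_le_iff SB (Ph_nonneg SB (cut_nonneg hb)) (Ph_mem SB (ran_cut hε.le hb hbr)) (Ph_nonneg SB h2)
    (Ph_mem SB h1)]
  refine Ph_cle SB (CLE.trans ?_ (CLE.smul_left (1/2 : ℝ) (by norm_num)))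
  refine CLE.cut_of_le hb ?_
  obtain ⟨H, hH⟩ : ∃ H, H = (1/2 : ℝ) • ((b - x) + star (b - x)) := ⟨_, rfl⟩
  have hHs : IsSelfAdjoint H := by
    rw [hH, IsSelfAdjoint, star_smul, star_add, star_star, star_trivial (1/2 : ℝ), add_comm (star _)]
  have hHn : ‖H‖ ≤ ε := by
    rw [hH, norm_smul]
    have := norm_add_le (b - x) (star (b - x))
    rw [norm_star] at this
    rw [Real.norm_of_nonneg (by norm_num)]
    linarith
  have e : b = (1/2 : ℝ) • (x + star x) + H := by
    rw [hH, star_sub, nonneg_sa hb, ← smul_add]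
    have : x + star x + (b - x + (b - star x)) = (2 : ℝ) • b := by rw [two_smul]; abel
    rw [this, smul_smul]; norm_num
  rw [e]
  refine add_le_add (smul_le_smul_of_nonneg_left h3 (by norm_num)) ?_
  exact (sa_le_norm hHs).trans (alg_mono hHn)

end Full

section Div0
variable {M : Type*} [CStarAlgebra M] [PartialOrder M] [StarOrderedRing M]

lemma cut_cut_eq {s t : ℝ} (hs : 0 ≤ s) {a : M} (ha : 0 ≤ a) : cut s (cut t a) = cut (s + t) a := by
  unfold cut
  rw [fc_comp (cutf_cont _) (cutf_cont _) ha]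
  refine fc_congr ha fun x _ => ?_
  unfold cutf
  rcases le_total (x - t) 0 with h | h
  · rw [max_eq_right h, max_eq_right (by linarith), max_eq_right (by linarith)]
  · rw [max_eq_left h]; congr 1; ring

lemma cle_sq {X : M} (hX : 0 ≤ X) : CLE X (X * X) := by
  refine CLE.of_cut hX fun ε hε => ?_
  rw [sq_eq hX]
  refine CLE.cfc_le (C := 1 / ε) (cutf_cont _) (by fun_prop) hX (by positivity) fun t h0 _ =>
    ⟨cutf_nonneg _ _, ?_⟩
  rcases le_total t ε with h2 | h2
  · rw [cutf_eq_zero h2]; positivity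
  · rw [cutf_eq h2, div_mul_eq_mul_div, one_mul, le_div_iff₀ hε]; nlinarith

lemma rt_mem_Rid {a : M} (ha : 0 ≤ a) : rt a ∈ Rid a := by
  refine Metric.mem_closure_iff.2 fun ε hε => ?_
  have hc : Continuous fun t : ℝ => (max (Real.sqrt t) (ε / 2))⁻¹ := by
    refine Continuous.inv₀ (by fun_prop) fun t => ?_
    have : ε / 2 ≤ max (Real.sqrt t) (ε / 2) := le_max_right _ _
    linarith
  refine ⟨_, ⟨cfc (fun t : ℝ => (max (Real.sqrt t) (ε / 2))⁻¹) a, rfl⟩, ?_⟩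
  rw [dist_eq_norm]
  have e : rt a - a * cfc (fun t : ℝ => (max (Real.sqrt t) (ε / 2))⁻¹) a =
      cfc (fun t : ℝ => Real.sqrt t - t * (max (Real.sqrt t) (ε / 2))⁻¹) a := by
    have e1 := fc_mul (f := fun t : ℝ => t) continuous_id' hc a
    rw [fc_id ha] at e1
    have e2 := fc_sub (f := Real.sqrt) Real.continuous_sqrt (continuous_id'.mul hc) a
    rw [rt, e1]
    exact e2
  show ‖rt a - a * cfc (fun t : ℝ => (max (Real.sqrt t) (ε / 2))⁻¹) a‖ < ε
  rw [e]
  refine lt_of_le_of_lt (fc_norm_le ha (C := ε / 2) (by linarith) fun t h0 _ => ?_) (by linarith)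
  have hs := Real.sqrt_nonneg t
  have hm := Real.mul_self_sqrt h0
  rcases le_total (Real.sqrt t) (ε / 2) with h | h
  · rw [max_eq_right h]
    have : t * (ε / 2)⁻¹ ≤ Real.sqrt t := by
      rw [← div_eq_mul_inv, div_le_iff₀ (by linarith)]; nlinarith
    have h' : 0 ≤ t * (ε / 2)⁻¹ := by positivity
    rw [abs_of_nonneg (by linarith)]; linarith
  · rw [max_eq_left h]
    have : t * (Real.sqrt t)⁻¹ = Real.sqrt t := by
      rw [← div_eq_mul_inv, div_eq_iff (by linarith)]; linarith
    rw [this]; simp; linarith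

lemma sum_cut_le {n : ℕ} (F : Fin n → M) (h0 : ∀ i, 0 ≤ F i) {δ : ℝ} (hδ : 0 ≤ δ) (s : Finset (Fin n)) :
    ∑ i ∈ s, F i ≤ ∑ i ∈ s, cut δ (F i) + algebraMap ℝ M (s.card * δ) := by
  classical
  induction s using Finset.induction_on with
  | empty => simp
  | insert a s ha ih =>
    rw [Finset.sum_insert ha, Finset.sum_insert ha, Finset.card_insert_of_notMem ha]
    have h1 := add_le_add (cut_le_add hδ (h0 a)) ih
    refine h1.trans (le_of_eq ?_)
    rw [Nat.cast_add, Nat.cast_one, add_mul, one_mul, map_add]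
    abel

end Div0

section Div
variable {A W : Type*} [NonUnitalCStarAlgebra A] [PartialOrder A] [StarOrderedRing A]
  [NonUnitalCStarAlgebra W] [PartialOrder W] [StarOrderedRing W]

lemma cu_sum_le (SB : Stabilization A W) {ι : Type*} (s : Finset ι) (f : ι → Unitization ℂ W)
    (h0 : ∀ i, 0 ≤ f i) (hr : ∀ i, f i ∈ ran W) :
    cu SB (∑ i ∈ s, f i) ≤ ∑ i ∈ s, cu SB (f i) := by
  classical
  induction s using Finset.induction_on with
  | empty => simp [cu_zero]
  | insert a s ha ih =>
    rw [Finset.sum_insert ha, Finset.sum_insert ha]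
    exact (cu_add SB (h0 _) (hr _) (Finset.sum_nonneg fun i _ => h0 i)
      ((ran W).sum_mem fun i _ => hr i)).trans (add_le_add le_rfl ih)

lemma div_upper (SB : Stabilization A W) {n : ℕ} {x Z : Unitization ℂ W} (F : Fin n → Unitization ℂ W)
    (hx0 : 0 ≤ x) (hxr : x ∈ ran W) (hZ0 : 0 ≤ Z) (hZr : Z ∈ ran W) (hF0 : ∀ i, 0 ≤ F i)
    (hFr : ∀ i, F i ∈ ran W) (hFZ : ∀ i, CLE (F i) Z) (hx : CLE x (∑ i, F i)) {ε : ℝ} (hε : 0 < ε) :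
    ∃ δ, 0 < δ ∧ cu SB (cut ε x) ≤ n • cu SB (cut δ Z) := by
  obtain ⟨δ, hδ, h1⟩ := CLE.cut_cut hx0 (Finset.sum_nonneg fun i _ => hF0 i) hx hε
  obtain ⟨δ1, hδ1⟩ : ∃ δ1, δ1 = δ / (n + 1) := ⟨_, rfl⟩
  have hδ10 : 0 < δ1 := by rw [hδ1]; positivity
  have h2 : CLE (cut δ (∑ i, F i)) (∑ i, cut δ1 (F i)) := by
    refine CLE.cut_of_le (Finset.sum_nonneg fun i _ => hF0 i) ?_
    refine (sum_cut_le F hF0 hδ10.le Finset.univ).trans (add_le_add le_rfl (alg_mono ?_))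
    rw [Finset.card_univ, Fintype.card_fin, hδ1, mul_div_assoc', div_le_iff₀ (by positivity)]
    nlinarith
  choose d hd0 hd using fun i => CLE.cut_cut (hF0 i) hZ0 (hFZ i) hδ10
  obtain ⟨e, he, hed⟩ : ∃ e, 0 < e ∧ ∀ i, e ≤ d i := by
    obtain ⟨e, he, h⟩ := exists_pos_le (δ := fun k => if h : k < n then d ⟨k, h⟩ else 1)
      (fun k => by split_ifs with h; exacts [hd0 _, one_pos]) n
    refine ⟨e, he, fun i => ?_⟩
    have := h i.1 i.2.le
    rwa [dif_pos i.2] at this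
  refine ⟨e, he, ?_⟩
  have hcr : ∀ i, cut δ1 (F i) ∈ ran W := fun i => ran_cut hδ10.le (hF0 i) (hFr i)
  have hc0 : ∀ i, 0 ≤ cut δ1 (F i) := fun i => cut_nonneg (hF0 i)
  have h3 : cu SB (cut ε x) ≤ cu SB (∑ i, cut δ1 (F i)) :=
    (cu_le_iff SB (cut_nonneg hx0) (ran_cut hε.le hx0 hxr) (Finset.sum_nonneg fun i _ => hc0 i)
      ((ran W).sum_mem fun i _ => hcr i)).2 (h1.trans h2)
  refine h3.trans ((cu_sum_le SB _ _ hc0 hcr).trans ?_)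
  have h4 : ∀ i ∈ Finset.univ, cu SB (cut δ1 (F i)) ≤ cu SB (cut e Z) := fun i _ =>
    (cu_le_iff SB (hc0 i) (hcr i) (cut_nonneg hZ0) (ran_cut he.le hZ0 hZr)).2
      ((hd i).trans (CLE.cut_cut_le hZ0 (hed i)))
  refine (Finset.sum_le_sum h4).trans ?_
  simp

lemma div_lower (SB : Stabilization A W) {n : ℕ} {P Z : Unitization ℂ W} (F : Fin n → Unitization ℂ W)
    (hP0 : 0 ≤ P) (hPr : P ∈ ran W) (hZ0 : 0 ≤ Z) (hZr : Z ∈ ran W) (hF0 : ∀ i, 0 ≤ F i)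
    (hFr : ∀ i, F i ∈ ran W) (hFo : ∀ i j, i ≠ j → F i * F j = 0)
    (hFZ : ∀ i, CLE Z (F i)) (hP : CLE (∑ i, F i) P) {η : ℝ} (hη : 0 < η) :
    ∃ V : Fin n → Unitization ℂ W, (∀ i, V i ∈ Rid (rt P)) ∧ (∀ i j, i ≠ j → star (V i) * V j = 0) ∧
      ∀ i, star (V i) * V i = cut η Z * cut η (cut η Z) := by
  choose g hg hgc using fun i => CLE.exact hZ0 (hF0 i) (hFZ i) hη
  have hgr : ∀ i, g i ∈ ran W := fun i => by
    refine closure_minimal (t := (ran W : Set (Unitization ℂ W))) ?_ ran_closed (hgc i)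
    rintro _ ⟨m, rfl⟩
    exact ran_mul_right _ (ran_rt (hF0 i) (hFr i))
  have hrt : ∀ i j, i ≠ j → rt (F i) * rt (F j) = 0 := fun i j hij => by
    have h1 := rt_ann (hF0 i) (hFo j i hij.symm)
    have h2 := congrArg star h1
    rw [star_mul, rt_star, nonneg_sa (hF0 j), star_zero] at h2
    exact rt_ann (hF0 j) h2
  have hgo : ∀ i j, i ≠ j → star (g i) * g j = 0 := fun i j hij => by
    have h1 := clos_zero (hrt j i hij.symm) (hgc i)
    have h2 := congrArg star h1
    rw [star_mul, rt_star, star_zero] at h2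
    exact clos_zero h2 (hgc j)
  obtain ⟨G, hG⟩ : ∃ G, G = ∑ i, g i * star (g i) := ⟨_, rfl⟩
  have hg0 : ∀ i, 0 ≤ g i * star (g i) := fun i => mul_star_self_nonneg _
  have hg1 : ∀ i, g i * star (g i) ∈ ran W := fun i => ran_mul_right _ (hgr i)
  have hG0 : 0 ≤ G := by rw [hG]; exact Finset.sum_nonneg fun i _ => hg0 i
  have hGr : G ∈ ran W := by rw [hG]; exact (ran W).sum_mem fun i _ => hg1 i
  have hGP : CLE G P := by
    refine CLE.trans ?_ hP
    rw [← cu_le_iff SB hG0 hGr (Finset.sum_nonneg fun i _ => hF0 i) ((ran W).sum_mem fun i _ => hFr i),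
      cu_sum SB _ _ hF0 hFr hFo, hG]
    refine (cu_sum_le SB _ _ hg0 hg1).trans (Finset.sum_le_sum fun i _ => ?_)
    rw [cu_le_iff SB (hg0 i) (hg1 i) (hF0 i) (hFr i)]
    have := CLE.ms (g i)
    rw [hg] at this
    exact this.trans ((CLE.cut_self hη.le hZ0).trans (hFZ i))
  obtain ⟨Y, hY, hYc⟩ := CLE.exact hG0 hP0 hGP hη
  have hGg : ∀ j, G * g j = g j * cut η Z := fun j => by
    rw [hG, Finset.sum_mul, Finset.sum_eq_single j]
    · rw [mul_assoc, hg]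
    · intro i _ hij
      rw [mul_assoc, hgo i j hij, mul_zero]
    · simp
  have hGc : ∀ j, cut η G * g j = g j * cut η (cut η Z) := fun j =>
    intertwine (IsSelfAdjoint.of_nonneg hG0) (IsSelfAdjoint.of_nonneg (cut_nonneg hZ0)) (hGg j) (cutf_cont _)
  have hV : ∀ i j, star (Y * g i) * (Y * g j) = star (g i) * g j * cut η (cut η Z) := fun i j => by
    rw [star_mul, mul_assoc, ← mul_assoc (star Y), hY, hGc, mul_assoc]
  refine ⟨fun i => Y * g i, fun i => Rid.mul hYc _, fun i j hij => ?_, fun i => ?_⟩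
  · show star (Y * g i) * (Y * g j) = 0
    rw [hV, hgo i j hij, zero_mul]
  · show star (Y * g i) * (Y * g i) = _
    rw [hV, hg]

lemma Ph_pull (SB : Stabilization A W) {a : Unitization ℂ A} (ha : 0 ≤ a) (har : a ∈ ran A)
    {X Y : Unitization ℂ W} (hX : X ∈ Rid (rt (Ph SB a))) (hY : Y ∈ Rid (rt (Ph SB a))) :
    ∃ v ∈ ran A, v ∈ Rid a ∧ Ph SB v = X * star Y := by
  have hcl : IsClosed (Ph SB '' ((ran A : Set (Unitization ℂ A)) ∩ Rid a)) :=
    (Ph_isom SB).isClosedEmbedding.isClosedMap _ (ran_closed.inter isClosed_closure)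
  have hc : Continuous (Function.uncurry fun x y : Unitization ℂ W => x * star y) := by
    unfold Function.uncurry; fun_prop
  have key := map_mem_closure₂ (u := Ph SB '' ((ran A : Set (Unitization ℂ A)) ∩ Rid a)) hc hX hY ?_
  · rw [hcl.closure_eq] at key
    obtain ⟨v, ⟨h1, h2⟩, h3⟩ := key
    exact ⟨v, h1, h2, h3⟩
  · rintro _ ⟨m, rfl⟩ _ ⟨k, rfl⟩
    have er : rt (Ph SB a) = Ph SB (rt a) := (Ph_cfc SB Real.continuous_sqrt ha).symm
    have hp0 := rt_nonneg ha
    have hpr := ran_rt ha har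
    have hqr := ran_rt hp0 hpr
    obtain ⟨r, hr, hr'⟩ := Ph_corner SB hqr hpr (m * star k)
    refine ⟨rt (rt a) * r, ⟨ran_mul_left _ hr, Rid.mul (Rid.trans (rt_mem_Rid hp0) (rt_mem_Rid ha)) _⟩, ?_⟩
    show Ph SB (rt (rt a) * r) = rt (Ph SB a) * m * star (rt (Ph SB a) * k)
    rw [map_mul, hr', star_mul, rt_star, er]
    have e2 : Ph SB (rt (rt a)) * Ph SB (rt (rt a)) = Ph SB (rt a) := by rw [← map_mul, rt_mul hp0]
    rw [← mul_assoc, ← mul_assoc, e2]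
    simp only [mul_assoc]

lemma cu_div (SB : Stabilization A W) (hAD : AlmostDivisible W) {a : Unitization ℂ A} (har : a ∈ ran A)
    (ha : 0 ≤ a) {ε : ℝ} (hε : 0 < ε) {N : ℕ} (hN : 1 ≤ N) :
    ∃ (v : ℕ → Unitization ℂ A) (β : Unitization ℂ A) (η : ℝ), 0 < η ∧ β ∈ ran A ∧ 0 ≤ β ∧
      (∀ i, v i ∈ ran A) ∧
      (∀ i < N, v i ∈ Rid a) ∧ (∀ i < N, ∀ j < N, i ≠ j → star (v i) * v j = 0) ∧
      (∀ i < N, star (v i) * v i = β) ∧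
      cu SB (Ph SB (cut ε a)) ≤ (N + 1) • cu SB (Ph SB (cut η β)) := by
  have hP0 := Ph_nonneg SB ha
  have hPr := Ph_mem SB har
  have hc0 : 0 ≤ cut (ε / 2) (Ph SB a) := cut_nonneg hP0
  have hcr : cut (ε / 2) (Ph SB a) ∈ ran W := ran_cut (by linarith) hP0 hPr
  obtain ⟨α, hα⟩ := ran_exists hPr
  obtain ⟨x0, hx0⟩ := ran_exists hcr
  have hα0 : 0 ≤ α := by rw [← Unitization.inr_nonneg_iff, ← hα]; exact hP0
  have hx00 : 0 ≤ x0 := by rw [← Unitization.inr_nonneg_iff, ← hx0]; exact hc0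
  obtain ⟨z, hz0, ⟨c1, ⟨f, f0, f1, f2, rfl⟩, hc1⟩, ⟨c2, ⟨f', f0', f1', f2', rfl⟩, hc2⟩⟩ :=
    hAD x0 α hx00 hα0 (wayBelow SB hα0 (half_pos hε) (by rw [← hα, ← hx0])) N hN
  have es : ∀ {n : ℕ} (f : Fin n → W), ((∑ i, f i : W) : Unitization ℂ W) = ∑ i, (f i : Unitization ℂ W) :=
    fun f => map_sum (Unitization.inrHom ℂ ℂ W) f Finset.univ
  rw [cuntzLE_iff (Finset.sum_nonneg fun i _ => f0 i), es, ← hα] at hc1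
  rw [cuntzLE_iff hx00, es, ← hx0] at hc2
  obtain ⟨Z, hZ⟩ : ∃ Z, Z = (z : Unitization ℂ W) := ⟨_, rfl⟩
  have hZ0 : 0 ≤ Z := by rw [hZ]; exact Unitization.inr_nonneg_iff.2 hz0
  have hZr : Z ∈ ran W := by rw [hZ]; exact inr_mem _
  obtain ⟨δ, hδ, hup⟩ := div_upper SB (Z := Z) (fun i => (f' i : Unitization ℂ W)) hc0 hcr hZ0 hZr
    (fun i => Unitization.inr_nonneg_iff.2 (f0' i)) (fun i => inr_mem _)
    (fun i => by rw [hZ]; exact (cuntzLE_iff (f0' i)).1 (f1' i).1) hc2 (half_pos hε)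
  rw [cut_cut_eq (by linarith) hP0, add_halves] at hup
  obtain ⟨η, hη⟩ : ∃ η, η = δ / 4 := ⟨_, rfl⟩
  have hη0 : 0 < η := by rw [hη]; linarith
  obtain ⟨V, hV1, hV2, hV3⟩ := div_lower SB (Z := Z) (P := Ph SB a) (fun i => (f i : Unitization ℂ W)) hP0 hPr hZ0 hZr
    (fun i => Unitization.inr_nonneg_iff.2 (f0 i)) (fun i => inr_mem _)
    (fun i j hij => by rw [← Unitization.inr_mul, f2 i j hij, Unitization.inr_zero])
    (fun i => by rw [hZ]; exact (cuntzLE_iff hz0).1 (f1 i).2) hc1 hη0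
  obtain ⟨o, ho⟩ : ∃ o : Fin N, o = ⟨0, hN⟩ := ⟨_, rfl⟩
  choose v hvr hvR hv using fun i => Ph_pull SB ha har (hV1 i) (hV1 o)
  have hvv : ∀ i j, Ph SB (star (v i) * v j) = V o * (star (V i) * V j) * star (V o) := fun i j => by
    rw [map_mul, map_star, hv, hv, star_mul, star_star]; simp only [mul_assoc]
  have ho' : ∀ i j, i ≠ j → star (v i) * v j = 0 := fun i j hij => by
    apply Ph_inj SB
    rw [hvv, hV2 i j hij, mul_zero, zero_mul, map_zero]
  have hs' : ∀ i, star (v i) * v i = star (v o) * v o := fun i => by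
    apply Ph_inj SB
    rw [hvv, hvv, hV3, hV3]
  have hβ0 : 0 ≤ star (v o) * v o := star_mul_self_nonneg _
  have hβr : star (v o) * v o ∈ ran A := ran_mul_left _ (hvr o)
  have hcle : CLE (cut (δ / 2) Z) (Ph SB (star (v o) * v o)) := by
    have h1 : CLE (cut (δ / 2) Z) (star (V o) * V o) := by
      rw [hV3, cut_cut_eq hη0.le hZ0]
      unfold cut
      rw [fc_mul (cutf_cont _) (cutf_cont _)]
      refine CLE.cfc_le (C := 1 / η) (cutf_cont _) ((cutf_cont _).mul (cutf_cont _)) hZ0 (by positivity)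
        fun t h0 _ => ⟨cutf_nonneg _ _, ?_⟩
      have e : δ / 2 = η + η := by rw [hη]; ring
      rw [e]
      show cutf (η + η) t ≤ 1 / η * (cutf η t * cutf (η + η) t)
      rcases le_total t (η + η) with h2 | h2
      · rw [cutf_eq_zero h2]; simp
      · rw [cutf_eq h2, cutf_eq (by linarith), div_mul_eq_mul_div, one_mul, le_div_iff₀ hη0]; nlinarith
    have h2 := (h1.trans (CLE.sm (V o))).trans (cle_sq (mul_star_self_nonneg (V o)))
    have e : Ph SB (star (v o) * v o) = V o * star (V o) * (V o * star (V o)) := by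
      rw [hvv]; simp only [mul_assoc]
    rw [e]
    exact h2
  obtain ⟨κ, hκ, hκ'⟩ := CLE.cut_cut (cut_nonneg hZ0) (Ph_nonneg SB hβ0) hcle (half_pos hδ)
  rw [cut_cut_eq (by linarith) hZ0, add_halves, ← Ph_cut SB κ hβ0] at hκ'
  refine ⟨fun i => if h : i < N then v ⟨i, h⟩ else 0, star (v o) * v o, κ, hκ, hβr, hβ0, fun i => ?_,
    fun i hi => ?_, fun i hi j hj hij => ?_, fun i hi => ?_, ?_⟩
  · dsimp only
    split_ifs with h
    · exact hvr _
    · exact (ran A).zero_mem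
  · dsimp only
    rw [dif_pos hi]; exact hvR _
  · dsimp only
    rw [dif_pos hi, dif_pos hj]
    exact ho' _ _ fun h => hij (Fin.mk.inj h)
  · dsimp only
    rw [dif_pos hi]
    exact hs' _
  · rw [Ph_cut SB ε ha]
    refine hup.trans (nsmul_le_nsmul_right ?_ _)
    exact (cu_le_iff SB (cut_nonneg hZ0) (ran_cut hδ.le hZ0 hZr) (Ph_nonneg SB (cut_nonneg hβ0))
      (Ph_mem SB (ran_cut hκ.le hβ0 hβr))).2 hκ'

end Div

section Final
variable {A W : Type*} [NonUnitalCStarAlgebra A] [PartialOrder A] [StarOrderedRing A]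
  [NonUnitalCStarAlgebra W] [PartialOrder W] [StarOrderedRing W]

/-- the abstract data of a pure simple algebra -/
def theData (SB : Stabilization A W) (hs : IsSimpleCStar A) (hAU : AlmostUnperforated W)
    (hAD : AlmostDivisible W)
    (hn : ∃ a b : A, 0 ≤ a ∧ 0 ≤ b ∧ a ≠ 0 ∧ ¬ CuntzLE b a) : CuData (Unitization ℂ A) (CuT SB) where
  I := ran A
  mul_left m x h := ran_mul_left m h
  mul_right m x h := ran_mul_right m h
  star_mem x h := ran_star h
  closed := ran_closed
  cl a := cu SB (Ph SB a)
  nonneg := CuT_nonneg SB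
  cl_mono a b ha ha0 hb hb0 h :=
    (cu_le_iff SB (Ph_nonneg SB ha0) (Ph_mem SB ha) (Ph_nonneg SB hb0) (Ph_mem SB hb)).2 (Ph_cle SB h)
  cl_le a b ha ha0 hb hb0 h := Ph_cle_rev SB ha0 ha hb0 hb
    ((cu_le_iff SB (Ph_nonneg SB ha0) (Ph_mem SB ha) (Ph_nonneg SB hb0) (Ph_mem SB hb)).1 h)
  cl_zero := by rw [map_zero, cu_zero]
  cl_orth a b ha ha0 hb hb0 h := by
    rw [map_add]
    exact cu_orth SB (Ph_nonneg SB ha0) (Ph_mem SB ha) (Ph_nonneg SB hb0) (Ph_mem SB hb)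
      (by rw [← map_mul, h, map_zero])
  cl_add a b ha ha0 hb hb0 := by
    rw [map_add]
    exact cu_add SB (Ph_nonneg SB ha0) (Ph_mem SB ha) (Ph_nonneg SB hb0) (Ph_mem SB hb)
  AU := CuT_AU SB hAU
  full a b ha ha0 hb hb0 hne ε hε := cu_full SB hs ha ha0 hb hb0 hne hε
  npi := by
    obtain ⟨a, b, ha, hb, hne, h⟩ := hn
    refine ⟨a, b, inr_mem _, Unitization.inr_nonneg_iff.2 ha, inr_mem _, Unitization.inr_nonneg_iff.2 hb,
      fun h => hne ?_, fun h' => h ((cuntzLE_iff hb).2 h')⟩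
    exact Unitization.inr_injective (R := ℂ) (h.trans (Unitization.inr_zero ℂ).symm)
  div a ha ha0 ε hε N hN := cu_div SB hAD ha ha0 hε hN

lemma perturb_fst (x : Unitization ℂ A) {ε : ℝ} (hε : 0 < ε) :
    ∃ y : Unitization ℂ A, y.fst ≠ 0 ∧ y.snd = x.snd ∧ dist x y < ε := by
  by_cases h : x.fst = 0
  · refine ⟨x + algebraMap ℂ (Unitization ℂ A) ((ε / 2 : ℝ) : ℂ), ?_, ?_, ?_⟩
    · simp [Unitization.algebraMap_eq_inl, h, hε.ne']
    · simp [Unitization.algebraMap_eq_inl]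
    · rw [dist_self_add_right, norm_algebraMap', Complex.norm_real, Real.norm_of_nonneg (by linarith)]
      linarith
  · exact ⟨x, h, rfl, by simpa using hε⟩

lemma dense_of_one_add (h : ∀ a ∈ ran A, 1 + a ∈ closure {x : Unitization ℂ A | IsUnit x}) :
    StableRankOne A := by
  unfold StableRankOne
  intro x
  rw [← closure_closure, Metric.mem_closure_iff]
  intro ε hε
  obtain ⟨y, hy, -, hd⟩ := perturb_fst x hε
  refine ⟨y, ?_, hd⟩
  have e : y = y.fst • (1 + (y.fst)⁻¹ • (y.snd : Unitization ℂ A)) := by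
    rw [smul_add, smul_smul, mul_inv_cancel₀ hy, one_smul]
    ext <;> simp
  rw [e]
  refine map_mem_closure (f := fun z => y.fst • z) (by fun_prop) (h _ ?_) ?_
  · rw [mem_ran]; simp
  · intro z hz
    obtain ⟨u, rfl⟩ := hz
    exact (IsUnit.smul (Units.mk0 y.fst hy) u.isUnit : _)

lemma stableRankOne_of_C (φ : A →⋆ₙₐ[ℂ] ℂ) (hφ : Function.Bijective φ) : StableRankOne A := by
  refine dense_of_one_add fun a ha => ?_
  rw [Metric.mem_closure_iff]
  intro ε hε
  -- the character
  obtain ⟨Ψ, hΨ⟩ : ∃ Ψ : Unitization ℂ A →⋆ₐ[ℂ] ℂ, Ψ = Unitization.starLift φ := ⟨_, rfl⟩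
  have hΨ' : ∀ x, Ψ x = x.fst + φ x.snd := fun x => by
    rw [hΨ]; rfl
  have hu : ∀ x : Unitization ℂ A, x.fst ≠ 0 → Ψ x ≠ 0 → IsUnit x := by
    intro x h1 h2
    have hinj : ∀ x y : Unitization ℂ A, x.fst = y.fst → Ψ x = Ψ y → x = y := by
      intro x y h h'
      rw [hΨ', hΨ', h] at h'
      exact Unitization.ext h (hφ.1 (add_left_cancel h'))
    obtain ⟨s, hs⟩ := hφ.2 ((Ψ x)⁻¹ - (x.fst)⁻¹)
    obtain ⟨y, hy⟩ : ∃ y : Unitization ℂ A, y = Unitization.inl (x.fst)⁻¹ + (s : Unitization ℂ A) := ⟨_, rfl⟩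
    have hyf : y.fst = (x.fst)⁻¹ := by simp [hy]
    have hyP : Ψ y = (Ψ x)⁻¹ := by
      rw [hΨ', hyf]
      have : y.snd = s := by simp [hy]
      rw [this, hs]; ring
    refine isUnit_iff_exists.2 ⟨y, hinj _ _ ?_ ?_, hinj _ _ ?_ ?_⟩
    · rw [Unitization.fst_mul, hyf, mul_inv_cancel₀ h1, Unitization.fst_one]
    · rw [map_mul, hyP, mul_inv_cancel₀ h2, map_one]
    · rw [Unitization.fst_mul, hyf, inv_mul_cancel₀ h1, Unitization.fst_one]
    · rw [map_mul, hyP, inv_mul_cancel₀ h2, map_one]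
  have hf1 : (1 + a).fst = 1 := by simp [mem_ran.1 ha]
  by_cases h : Ψ (1 + a) = 0
  · obtain ⟨t, ht⟩ : ∃ t : ℝ, t = min (ε / 2) (1 / 2) := ⟨_, rfl⟩
    have ht0 : 0 < t := by rw [ht]; positivity
    have htε : t ≤ ε / 2 := by rw [ht]; exact min_le_left _ _
    refine ⟨1 + a + algebraMap ℂ (Unitization ℂ A) (t : ℂ), hu _ ?_ ?_, ?_⟩
    · rw [Unitization.fst_add, hf1, Unitization.algebraMap_eq_inl]
      simp only [Unitization.fst_inl]
      intro h'
      have := congrArg Complex.re h'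
      simp at this
      linarith
    · rw [map_add, h, zero_add]
      have : Ψ (algebraMap ℂ (Unitization ℂ A) (t : ℂ)) = t := AlgHomClass.commutes Ψ _
      rw [this]
      exact_mod_cast ht0.ne'
    · rw [dist_self_add_right, norm_algebraMap', Complex.norm_real, Real.norm_of_nonneg ht0.le]
      linarith
  · exact ⟨1 + a, hu _ (by rw [hf1]; exact one_ne_zero) h, by simpa using hε⟩

theorem final [TopologicalSpace.SeparableSpace A] (SB : Stabilization A W)
    (hsimple : IsSimpleCStar A) (hAU : AlmostUnperforated W) (hAD : AlmostDivisible W)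
    (hnpi : ¬ PurelyInfinite A) : StableRankOne A := by
  by_cases hC : ∃ φ : A →⋆ₙₐ[ℂ] ℂ, Function.Bijective φ
  · obtain ⟨φ, hφ⟩ := hC
    exact stableRankOne_of_C φ hφ
  · have hn : ∃ a b : A, 0 ≤ a ∧ 0 ≤ b ∧ a ≠ 0 ∧ ¬ CuntzLE b a := by
      by_contra hcon
      push Not at hcon
      exact hnpi ⟨hC, fun a b ha hb ha0 _ => hcon a b ha hb ha0⟩
    exact dense_of_one_add fun a ha => CuData.core (theData SB hsimple hAU hAD hn) ha

end Final

/-- **Corollary.** A separable simple pure C*-algebra (i.e. `Cu(A)` is almost unperforated and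
almost divisible) which is not purely infinite has stable rank one. -/
theorem stableRankOne_of_pure
    [TopologicalSpace.SeparableSpace A]
    (SB : Stabilization A W)
    (hsimple : IsSimpleCStar A)
    (hAU : AlmostUnperforated W) (hAD : AlmostDivisible W)
    (hnpi : ¬ PurelyInfinite A) :
    StableRankOne A := by
  exact final SB hsimple hAU hAD hnpi
end Paper
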